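/- Every Borwein polynomial of degree at most 8 which divides some Newman polynomial also divides some Littlewood polynomial. -/

import Mathlib

open Polynomial

/-- A Borwein polynomial: all coefficients in {-1,0,1} and nonzero constant term. -/
def IsBorwein (P : Polynomial ℤ) : Prop :=
  (∀ i, P.coeff i ∈ ({-1, 0, 1} : Set ℤ)) ∧ P.coeff 0 ≠ 0

/-- A Littlewood polynomial: all coefficients of X^0,...,X^(deg) lie in {-1,1}. -/
def IsLittlewood (L : Polynomial ℤ) : Prop :=
  ∀ i ≤ L.natDegree, L.coeff i ∈ ({-1, 1} : Set ℤ)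

/-- A Newman polynomial: all coefficients in {0,1} and constant term 1. -/
def IsNewman (P : Polynomial ℤ) : Prop :=
  (∀ i, P.coeff i ∈ ({0, 1} : Set ℤ)) ∧ P.coeff 0 = 1


noncomputable section
namespace BW

/-- Evaluate the numeral `x` before passing it on. -/
def force {α : Type} (x : ℕ) (f : ℕ → α) : α :=
  Nat.rec (motive := fun _ => α) (f 0) (fun m _ => f (Nat.succ m)) x

/-- value of a digit list in base `B` -/
def ev (B : ℕ) (l : List ℕ) : ℕ :=
  List.rec (motive := fun _ => ℕ) 0 (fun a _ ih => Nat.add a (Nat.mul B ih)) l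

/-- repunit with as many digits as `l` -/
def rp (B : ℕ) (l : List ℕ) : ℕ :=
  List.rec (motive := fun _ => ℕ) 0 (fun _ _ ih => Nat.add 1 (Nat.mul B ih)) l

/-- `l1` norm of the list with offset `o` -/
def l1 (o : ℕ) (l : List ℕ) : ℕ :=
  List.rec (motive := fun _ => ℕ) 0
    (fun a _ ih => Nat.add (Nat.add (Nat.sub a o) (Nat.sub o a)) ih) l

/-- `n` digits of `x` in base `b` -/
def digs (b n x : ℕ) : List ℕ :=
  Nat.rec (motive := fun _ => ℕ → List ℕ) (fun _ => [])
    (fun _ ih x => force (Nat.mod x b) fun a => force (Nat.div x b) fun y => a :: ih y) n x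

/-- sum of `leaf` over the `2^e` digits -/
def ksum (leaf : ℕ → ℕ) (B e W : ℕ) : ℕ :=
  Nat.rec (motive := fun _ => ℕ → ℕ) (fun W => leaf W)
    (fun e ih W => force (Nat.pow B (Nat.pow 2 e)) fun b =>
      force (Nat.mod W b) fun x => force (Nat.div W b) fun y => Nat.add (ih x) (ih y)) e W

def kS (B e : ℕ) : ℕ :=
  Nat.rec (motive := fun _ => ℕ) 1
    (fun e ih => Nat.mul ih (Nat.add 1 (Nat.pow B (Nat.pow 2 e)))) e

/-- spread of the `n` low bits of `b` -/
def spread (B n b : ℕ) : ℕ :=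
  Nat.rec (motive := fun _ => ℕ → ℕ) (fun _ => 0)
    (fun _ ih b => force (Nat.div b 2) fun y => Nat.add (Nat.mod b 2) (Nat.mul B (ih y))) n b

/-- untrusted signed division: `h + (a-b)/(c-d)` -/
def sdiv (h a b c d : ℕ) : ℕ :=
  force (Nat.div (Nat.add (Nat.sub a b) (Nat.sub b a)) (Nat.add (Nat.sub c d) (Nat.sub d c)))
    fun q => cond (Nat.ble b a) (cond (Nat.ble d c) (Nat.add h q) (Nat.sub h q))
      (cond (Nat.ble d c) (Nat.sub h q) (Nat.add h q))

def leafPos (h u : ℕ) : ℕ := Nat.sub u h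
def leafNeg (h u : ℕ) : ℕ := Nat.sub h u

def pl (c : ℕ) : List ℕ := 2 :: digs 3 8 c

def litChk (c b : ℕ) : Bool :=
  force c fun c => force b fun b =>
  force (Nat.log2 b) fun n => force (Nat.succ (Nat.log2 n)) fun e =>
  force (ev 65536 (pl c)) fun Pv => force (rp 65536 (pl c)) fun R =>
  force (Nat.mul 2 (spread 65536 n b)) fun L =>
  force (Nat.div (Nat.sub (Nat.pow 65536 n) 1) 65535) fun RL =>
  force (Nat.mul 32768 (kS 65536 e)) fun S =>
  force (sdiv S L RL Pv R) fun W =>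
  force (ksum (leafPos 32768) 65536 e W) fun p =>
  force (ksum (leafNeg 32768) 65536 e W) fun m =>
  cond (Nat.beq (Nat.add (Nat.add (Nat.mul Pv W) (Nat.mul R S)) RL)
    (Nat.add (Nat.add (Nat.mul R W) (Nat.mul Pv S)) L))
    (cond (Nat.ble (Nat.add (Nat.add p m) 2) 65536) (Nat.ble 1 n) false) false

/-! dot products on keys -/
def dotN (al : List ℕ) (key : ℕ) : ℕ :=
  List.rec (motive := fun _ => ℕ → ℕ) (fun _ => 0)
    (fun a _ ih key => force (Nat.mod key 256) fun x => force (Nat.div key 256) fun y =>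
      Nat.add (Nat.add (Nat.mul a x) (Nat.mul 4 (Nat.sub 256 x))) (ih y)) al key

inductive Tr where
  | lf : Tr
  | nd : Tr → ℕ → Tr → Tr

def insK (T : Tr) (s : ℕ) (fnd : Bool) (k : Tr → Bool) : Bool :=
  Tr.rec (motive := fun _ => (Tr → Bool) → Bool) (fun k => k (Tr.nd Tr.lf s Tr.lf))
    (fun l x r ihl ihr k => cond (Nat.beq s x) fnd
      (cond (Nat.ble s x) (ihl fun t => k (Tr.nd t x r)) (ihr fun t => k (Tr.nd l x t)))) T k

/-- one transition; `zz` is `zf+zg+128`, `pw = 256^(d-1)` -/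
def step (lo hi zf zz pw df dg eps s : ℕ) (st : List ℕ) (k : List ℕ → Bool) : Bool :=
  force (Nat.add eps (Nat.add 128 df)) fun y =>
  cond (Nat.ble zz (Nat.add lo (Nat.add y dg)))
    (cond (Nat.ble (Nat.add y dg) (Nat.add zz hi))
      (cond (Nat.ble zf y) (cond (Nat.ble (Nat.succ (Nat.sub y zf)) 256)
        (force (Nat.add (Nat.mul 256 (Nat.mod s pw)) (Nat.sub y zf)) fun t => k (t :: st)) false)
        false) (k st)) (k st)

def explore (al gl : List ℕ) (lo hi Z zf zz pw fuel : ℕ) (st : List ℕ) (T : Tr) : Bool :=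
  Nat.rec (motive := fun _ => List ℕ → Tr → Bool) (fun _ _ => false)
    (fun _ ih st T => List.rec (motive := fun _ => Bool) true
      (fun s st' _ => insK T s (ih st' T) fun T' =>
        cond (Nat.beq s Z) false
          (force (dotN al s) fun df => force (dotN gl s) fun dg =>
            step lo hi zf zz pw df dg 0 s st' fun st1 =>
            step lo hi zf zz pw df dg 1 s st1 fun st2 => ih st2 T')) st) fuel st T

/-- octal decoding, 0 terminates -/
def oct (x : ℕ) : List ℕ :=
  Nat.rec (motive := fun _ => ℕ → List ℕ) (fun _ => [])
    (fun _ ih x => force (Nat.mod x 8) fun a => force (Nat.div x 8) fun y =>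
      cond (Nat.beq a 0) [] (a :: ih y)) 10 x

def fct (c F O : ℕ) : Bool :=
  cond (Nat.beq (Nat.add (Nat.add (Nat.mul (ev 1024 (oct F)) (ev 1024 (oct O)))
      (Nat.mul 16 (Nat.mul (rp 1024 (oct F)) (rp 1024 (oct O))))) (rp 1024 (pl c)))
    (Nat.add (Nat.add (Nat.mul 4 (Nat.mul (ev 1024 (oct F)) (rp 1024 (oct O))))
      (Nat.mul 4 (Nat.mul (rp 1024 (oct F)) (ev 1024 (oct O))))) (ev 1024 (pl c))))
    (Nat.ble (l1 4 (oct O)) 100) false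

def getN (l : List ℕ) (j : ℕ) : ℕ :=
  List.rec (motive := fun _ => ℕ → ℕ) (fun _ => 0)
    (fun a _ ih j => Nat.rec (motive := fun _ => ℕ) a (fun j _ => ih j) j) l j

/-- Dead certificate: bounds for `A` -/
def bndChk (fl gl cl : List ℕ) (h k e w lo hi j : ℕ) : Bool :=
  force (Nat.pow 2 w) fun B => force (Nat.pow 2 (Nat.pred w)) fun hB =>
  force (ev B fl) fun Fv => force (rp B fl) fun Fr =>
  force (ev B gl) fun Gv => force (rp B gl) fun Gr =>
  force (Nat.pow B (Nat.pow 2 k)) fun Bs =>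
  force (ev Bs cl) fun Cv => force (Nat.mul h (rp Bs cl)) fun Cr =>
  force (Nat.mul hB (kS B e)) fun S =>
  force (Nat.add (Nat.mul Gv Cv) (Nat.mul 4 (Nat.mul Gr Cr))) fun rP =>
  force (Nat.add (Nat.mul Gv Cr) (Nat.mul 4 (Nat.mul Gr Cv))) fun rM =>
  force (sdiv S rP rM Fv (Nat.mul 4 Fr)) fun W =>
  force (ksum (leafPos hB) B e W) fun p =>
  force (ksum (leafNeg hB) B e W) fun m =>
  force (l1 h cl) fun c1 => force (Nat.sub (getN cl j) h) fun M => force (Nat.sub c1 M) fun E =>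
  force (Nat.div (cond (Nat.ble p m) m p) (Nat.sub M E)) fun B0 =>
  cond (Nat.beq (Nat.add (Nat.add (Nat.mul Fv W) (Nat.mul 4 (Nat.mul Fr S))) rM)
    (Nat.add (Nat.add (Nat.mul Fv S) (Nat.mul 4 (Nat.mul Fr W))) rP))
  (cond (Nat.ble (Nat.succ (Nat.mul 4 (Nat.add (Nat.add p m) c1))) B)
  (cond (Nat.ble (Nat.succ E) M)
  (cond (Nat.ble (Nat.succ (Nat.add p (Nat.mul E B0))) (Nat.mul (Nat.succ hi) M))
    (Nat.ble (Nat.succ (Nat.add m (Nat.mul E B0))) (Nat.mul (Nat.succ lo) M)) false) false) false)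
    false

def neg8 (l : List ℕ) : List ℕ :=
  List.rec (motive := fun _ => List ℕ) [] (fun a _ ih => force (Nat.sub 8 a) fun b => b :: ih) l

def len (l : List ℕ) : ℕ :=
  List.rec (motive := fun _ => ℕ) 0 (fun _ _ ih => Nat.succ ih) l

def tl (l : List ℕ) : List ℕ :=
  List.rec (motive := fun _ => List ℕ) [] (fun _ l _ => l) l

def hd (l : List ℕ) : ℕ :=
  List.rec (motive := fun _ => ℕ) 0 (fun a _ _ => a) l

def forceL {α : Type} (l : List ℕ) (f : List ℕ → α) : α :=
  List.rec (motive := fun _ => (List ℕ → α) → α) (fun f => f [])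
    (fun a _ ih f => force a fun a => ih fun l => f (a :: l)) l f

/-- The automaton check. -/
def autChk (fl gl : List ℕ) (lo hi : ℕ) : Bool :=
  forceL (neg8 (tl fl)) fun al => forceL (tl gl) fun g => force (len al) fun d =>
  force (Nat.pow 256 (Nat.pred d)) fun pw =>
  force (Nat.mul 128 (Nat.div (Nat.pred (Nat.pow 256 d)) 255)) fun Z =>
  force (dotN al Z) fun zf => force (dotN g Z) fun zg =>
  cond (Nat.beq (hd fl) 5) (cond (Nat.beq (hd gl) 5)
    (cond (Nat.ble (len g) d) (cond (Nat.ble 1 d)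
    (explore al g lo hi Z zf (Nat.add 128 (Nat.add zf zg)) pw 2000 [Nat.succ Z] Tr.lf)
    false) false) false) false

/-- full check of a nonexistence certificate -/
def nonChk (c F O G k e w lo hi m j X : ℕ) : Bool :=
  force c fun c => force F fun F => force O fun O => force G fun G => force k fun k =>
  force e fun e => force w fun w => force lo fun lo => force hi fun hi => force m fun m =>
  force j fun j => force X fun X =>
  forceL (oct F) fun fl => forceL (oct G) fun gl => force (Nat.pow 2 m) fun b =>
  forceL (digs b (len fl) X) fun cl => force (Nat.pow 2 (Nat.pred m)) fun h =>
  cond (fct c F O) (cond (bndChk fl gl cl h k e w lo hi j) (autChk fl gl lo hi) false) false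

theorem force_eq {α : Type} (x : ℕ) (f : ℕ → α) : force x f = f x := by cases x <;> rfl

theorem forceL_eq {α : Type} (l : List ℕ) (f : List ℕ → α) : forceL l f = f l := by
  induction l generalizing f with
  | nil => rfl
  | cons a l ih =>
    have : forceL (a :: l) f = force a fun a => forceL l fun l => f (a :: l) := rfl
    rw [this, force_eq, ih]

theorem ev_nil (B : ℕ) : ev B [] = 0 := rfl
theorem ev_cons (B a : ℕ) (l : List ℕ) : ev B (a :: l) = a + B * ev B l := rfl
theorem rp_nil (B : ℕ) : rp B [] = 0 := rfl
theorem rp_cons (B a : ℕ) (l : List ℕ) : rp B (a :: l) = 1 + B * rp B l := rfl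
theorem l1_nil (B : ℕ) : l1 B [] = 0 := rfl
theorem l1_cons (o a : ℕ) (l : List ℕ) : l1 o (a :: l) = ((a - o) + (o - a)) + l1 o l := rfl

theorem l1_cons_cast (o a : ℕ) (l : List ℕ) :
    (l1 o (a :: l) : ℤ) = |(a : ℤ) - o| + l1 o l := by
  rw [l1_cons]
  rcases le_total a o with h | h
  · rw [abs_of_nonpos (by have : (a : ℤ) ≤ o := by exact_mod_cast h
                          linarith)]
    rw [Nat.sub_eq_zero_of_le h]; push_cast [h]; ring
  · rw [abs_of_nonneg (by have : (o : ℤ) ≤ a := by exact_mod_cast h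
                          linarith)]
    rw [Nat.sub_eq_zero_of_le h]; push_cast [h]; ring

/-- Polynomial with coefficient list `l`, offset `o`, stride `s`. -/
def op (o s : ℕ) : List ℕ → ℤ[X]
  | [] => 0
  | a :: l => C ((a : ℤ) - o) + X ^ s * op o s l

theorem eval_op (o s B : ℕ) (l : List ℕ) :
    (op o s l).eval (B : ℤ) = ev (B ^ s) l - o * rp (B ^ s) l := by
  induction l with
  | nil => simp [op, ev_nil, rp_nil]
  | cons a l ih =>
    simp only [op, eval_add, eval_C, eval_mul, eval_pow, eval_X, ih, ev_cons, rp_cons]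
    push_cast; ring

theorem coeff_step (A Q : ℤ[X]) (c : ℤ) (s m : ℕ) :
    (A * (C c + X ^ s * Q)).coeff m =
      A.coeff m * c + (if s ≤ m then (A * Q).coeff (m - s) else 0) := by
  rw [mul_add, coeff_add, coeff_mul_C, show A * (X ^ s * Q) = (A * Q) * X ^ s by ring,
    coeff_mul_X_pow']

theorem bound_op (A : ℤ[X]) (a : ℤ) (hA : ∀ i, |A.coeff i| ≤ a) (o s : ℕ) (l : List ℕ) (m : ℕ) :
    |(A * op o s l).coeff m| ≤ a * l1 o l := by
  have ha : 0 ≤ a := (abs_nonneg _).trans (hA 0)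
  induction l generalizing m with
  | nil => simp [op, l1_nil]
  | cons b l ih =>
    rw [op, coeff_step, l1_cons_cast, mul_add]
    refine (abs_add_le _ _).trans (add_le_add ?_ ?_)
    · rw [abs_mul]; exact mul_le_mul_of_nonneg_right (hA m) (abs_nonneg _)
    · split_ifs
      · exact ih _
      · simp only [abs_zero]; positivity

theorem getN_nil (j : ℕ) : getN [] j = 0 := rfl
theorem getN_zero (a : ℕ) (l : List ℕ) : getN (a :: l) 0 = a := rfl
theorem getN_succ (a j : ℕ) (l : List ℕ) : getN (a :: l) (j + 1) = getN l j := rfl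

theorem split_op (o s : ℕ) (l : List ℕ) (j : ℕ) (hj : o < getN l j) :
    ∃ R : ℤ[X], op o s l = C ((getN l j : ℤ) - o) * X ^ (s * j) + R ∧
      ∃ E : ℕ, l1 o l = (getN l j - o) + E ∧
      ∀ (A : ℤ[X]) (a : ℤ), (∀ i, |A.coeff i| ≤ a) → ∀ m, |(A * R).coeff m| ≤ a * E := by
  induction l generalizing j with
  | nil => simp [getN_nil] at hj
  | cons b l ih =>
    cases j with
    | zero =>
      rw [getN_zero] at hj ⊢
      refine ⟨X ^ s * op o s l, by simp [op], l1 o l, ?_, ?_⟩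
      · rw [l1_cons]; omega
      · intro A a hA m
        have ha : 0 ≤ a := (abs_nonneg _).trans (hA 0)
        have := coeff_step A (op o s l) 0 s m
        simp only [map_zero, zero_add, mul_zero] at this
        rw [this]
        split_ifs
        · exact bound_op A a hA o s l _
        · simp only [abs_zero]; positivity
    | succ j =>
      rw [getN_succ] at hj ⊢
      obtain ⟨R, h1, E, h2, h3⟩ := ih j hj
      refine ⟨C ((b : ℤ) - o) + X ^ s * R, ?_, ((b - o) + (o - b)) + E, ?_, ?_⟩
      · rw [op, h1]; ring
      · rw [l1_cons, h2]; ring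
      · intro A a hA m
        have ha : 0 ≤ a := (abs_nonneg _).trans (hA 0)
        have hb := l1_cons_cast o b []
        rw [l1_cons, l1_nil] at hb
        push_cast at hb ⊢
        simp only [add_zero] at hb
        rw [coeff_step, hb, mul_add]
        refine (abs_add_le _ _).trans (add_le_add ?_ ?_)
        · rw [abs_mul]; exact mul_le_mul_of_nonneg_right (hA m) (abs_nonneg _)
        · split_ifs
          · exact h3 A a hA _
          · simp only [abs_zero]; positivity

/-- Kronecker substitution is injective on small coefficients. -/
theorem kron (B : ℤ) (hB : 0 < B) (n : ℕ) : ∀ Z : ℤ[X], Z.natDegree ≤ n → (∀ i, |Z.coeff i| < B) →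
    Z.eval B = 0 → Z = 0 := by
  induction n with
  | zero =>
    intro Z hd _ he
    rw [eq_C_of_natDegree_le_zero hd] at he ⊢
    simpa using he
  | succ n ih =>
    intro Z hd hc he
    have hz := divX_mul_X_add Z
    have he2 : Z.divX.eval B * B + Z.coeff 0 = 0 := by
      rw [← hz] at he; simpa using he
    have h0 : Z.coeff 0 = 0 := by
      apply Int.eq_zero_of_abs_lt_dvd (m := B) _ (hc 0)
      exact ⟨- Z.divX.eval B, by linarith⟩
    rw [h0, add_zero] at he2
    have h3 : Z.divX = 0 := by
      apply ih
      · rw [natDegree_divX_eq_natDegree_tsub_one]; omega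
      · intro i; rw [coeff_divX]; exact hc _
      · rcases mul_eq_zero.mp he2 with h | h
        · exact h
        · omega
    rw [← hz, h3, h0]; simp

theorem kron_eq (B : ℤ) (hB : 0 < B) (Y Z : ℤ[X]) (hc : ∀ i, |Y.coeff i| + |Z.coeff i| < B)
    (he : Y.eval B = Z.eval B) : Y = Z := by
  rw [← sub_eq_zero]
  refine kron B hB _ (Y - Z) le_rfl (fun i => ?_) (by rw [eval_sub, he, sub_self])
  rw [coeff_sub]
  exact (abs_sub _ _).trans_lt (hc i)

theorem ksum_zero (f : ℕ → ℕ) (B W : ℕ) : ksum f B 0 W = f W := rfl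
theorem ksum_succ (f : ℕ → ℕ) (B e W : ℕ) : ksum f B (e + 1) W =
    ksum f B e (W % B ^ 2 ^ e) + ksum f B e (W / B ^ 2 ^ e) := by
  have : ksum f B (e + 1) W = (force (Nat.pow B (Nat.pow 2 e)) fun b =>
      force (Nat.mod W b) fun x => force (Nat.div W b) fun y =>
        Nat.add (ksum f B e x) (ksum f B e y)) := rfl
  rw [this]; simp only [force_eq]; rfl

theorem kS_zero (B : ℕ) : kS B 0 = 1 := rfl
theorem kS_succ (B e : ℕ) : kS B (e + 1) = kS B e * (1 + B ^ 2 ^ e) := rfl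

/-- The polynomial with the `2^e` digits of `W`, shifted by `h`. -/
def kp (h B : ℕ) : ℕ → ℕ → ℤ[X]
  | 0, W => C ((W : ℤ) - h)
  | e + 1, W => kp h B e (W % B ^ 2 ^ e) + X ^ (2 ^ e) * kp h B e (W / B ^ 2 ^ e)

theorem eval_kp (h B e W : ℕ) : (kp h B e W).eval (B : ℤ) = (W : ℤ) - h * kS B e := by
  induction e generalizing W with
  | zero => simp [kp, kS_zero]
  | succ e ih =>
    have := Nat.mod_add_div W (B ^ 2 ^ e)
    have h2 : ((W % B ^ 2 ^ e : ℕ) : ℤ) + (B ^ 2 ^ e : ℤ) * ((W / B ^ 2 ^ e : ℕ) : ℤ) = W := by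
      exact_mod_cast this
    rw [kp, eval_add, eval_mul, ih, ih, kS_succ]
    simp only [eval_pow, eval_X]
    push_cast at h2 ⊢
    linear_combination h2

theorem kp_step (A K1 K2 : ℤ[X]) (s m : ℕ) :
    (A * (K1 + X ^ s * K2)).coeff m =
      (A * K1).coeff m + (if s ≤ m then (A * K2).coeff (m - s) else 0) := by
  rw [mul_add, coeff_add, show A * (X ^ s * K2) = (A * K2) * X ^ s by ring,
    coeff_mul_X_pow']

theorem bnd_kp (h B e : ℕ) (N : ℤ[X]) (hN : ∀ i, N.coeff i = 0 ∨ N.coeff i = 1) (W m : ℕ) :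
    -(ksum (leafNeg h) B e W : ℤ) ≤ (N * kp h B e W).coeff m ∧
    (N * kp h B e W).coeff m ≤ ksum (leafPos h) B e W := by
  induction e generalizing W m with
  | zero =>
    rw [kp, coeff_mul_C, ksum_zero, ksum_zero]
    have h1 : leafNeg h W = h - W := rfl
    have h2 : leafPos h W = W - h := rfl
    rw [h1, h2]
    rcases hN m with h | h <;> rw [h] <;> constructor <;> omega
  | succ e ih =>
    rw [kp, kp_step, ksum_succ, ksum_succ]
    have h1 := ih (W % B ^ 2 ^ e) m
    have h2 := ih (W / B ^ 2 ^ e)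
    split_ifs with hs
    · have h2 := h2 (m - 2 ^ e)
      push_cast
      constructor <;> linarith [h1.1, h1.2, h2.1, h2.2]
    · have h3 : (0 : ℤ) ≤ ksum (leafNeg h) B e (W / B ^ 2 ^ e) := by positivity
      have h4 : (0 : ℤ) ≤ ksum (leafPos h) B e (W / B ^ 2 ^ e) := by positivity
      push_cast
      constructor <;> linarith [h1.1, h1.2]

theorem abs_kp (h B e : ℕ) (F : ℤ[X]) (a : ℤ) (hF : ∀ i, |F.coeff i| ≤ a) (W m : ℕ) :
    |(F * kp h B e W).coeff m| ≤
      a * ((ksum (leafPos h) B e W : ℤ) + ksum (leafNeg h) B e W) := by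
  have ha : 0 ≤ a := (abs_nonneg _).trans (hF 0)
  induction e generalizing W m with
  | zero =>
    rw [kp, coeff_mul_C, ksum_zero, ksum_zero]
    have h1 : leafNeg h W = h - W := rfl
    have h2 : leafPos h W = W - h := rfl
    have h3 := l1_cons_cast h W []
    rw [l1_cons, l1_nil] at h3
    push_cast at h3
    simp only [add_zero] at h3
    rw [h1, h2, h3, abs_mul]
    exact mul_le_mul_of_nonneg_right (hF m) (abs_nonneg _)
  | succ e ih =>
    rw [kp, kp_step, ksum_succ, ksum_succ]
    have h1 := ih (W % B ^ 2 ^ e) m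
    have h2 := ih (W / B ^ 2 ^ e)
    have e1 : ∀ p q r t : ℤ, a * ((p + q) + (r + t)) = a * (p + r) + a * (q + t) := by
      intros; ring
    push_cast
    rw [e1]
    refine (abs_add_le _ _).trans (add_le_add h1 ?_)
    split_ifs with hs
    · exact h2 _
    · simp only [abs_zero]; positivity

theorem ndiv (a b : ℕ) : Nat.div a b = a / b := rfl
theorem nmod (a b : ℕ) : Nat.mod a b = a % b := rfl

theorem digs_zero (b x : ℕ) : digs b 0 x = [] := rfl
theorem digs_succ (b n x : ℕ) : digs b (n + 1) x = x % b :: digs b n (x / b) := by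
  have : digs b (n + 1) x = force (Nat.mod x b) fun a => force (Nat.div x b) fun y =>
    a :: digs b n y := rfl
  rw [this, force_eq, force_eq]; rfl

theorem digs_lt (b n x : ℕ) (hb : 0 < b) : ∀ a ∈ digs b n x, a < b := by
  induction n generalizing x with
  | zero => simp [digs_zero]
  | succ n ih =>
    rw [digs_succ]
    intro a ha
    rcases List.mem_cons.mp ha with h | h
    · rw [h]; exact Nat.mod_lt _ hb
    · exact ih _ a h

theorem coeff_op (o : ℕ) (l : List ℕ) (i : ℕ) :
    (op o 1 l).coeff i = (l.getD i o : ℤ) - o := by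
  induction l generalizing i with
  | nil => simp [op]
  | cons a l ih =>
    rw [op, pow_one]
    cases i with
    | zero => simp
    | succ i => simp [coeff_X_mul, ih]

theorem coeff_op_le (o M : ℕ) (l : List ℕ) (h : ∀ a ∈ l, a ≤ o + M ∧ o ≤ a + M) (i : ℕ) :
    |(op o 1 l).coeff i| ≤ M := by
  rw [coeff_op]
  by_cases hi : i < l.length
  · have h1 : l.getD i o = l[i] := by simp [List.getD_eq_getElem?_getD, hi]
    have := h l[i] (List.getElem_mem hi)
    rw [h1, abs_le]; constructor <;> omega
  · have h1 : l.getD i o = o := by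
      rw [List.getD_eq_getElem?_getD, List.getElem?_eq_none (by omega)]; rfl
    rw [h1]; simp

theorem pl_coeff (c i : ℕ) : |(op 1 1 (pl c)).coeff i| ≤ 1 := by
  have := coeff_op_le 1 1 (pl c) (by
    intro a ha
    rw [pl] at ha
    rcases List.mem_cons.mp ha with h | h
    · omega
    · have := digs_lt 3 8 c (by norm_num) a h
      omega) i
  simpa using this

theorem spread_zero (B b : ℕ) : spread B 0 b = 0 := rfl
theorem spread_succ (B n b : ℕ) : spread B (n + 1) b = b % 2 + B * spread B n (b / 2) := by
  have : spread B (n + 1) b = force (Nat.div b 2) fun y =>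
    Nat.add (Nat.mod b 2) (Nat.mul B (spread B n y)) := rfl
  rw [this, force_eq]; rfl

/-- The Littlewood polynomial of the `n` low bits of `b`. -/
def lp : ℕ → ℕ → ℤ[X]
  | 0, _ => 0
  | n + 1, b => C (2 * ((b % 2 : ℕ) : ℤ) - 1) + X ^ 1 * lp n (b / 2)

theorem coeff_lp (n b i : ℕ) : (i < n → (lp n b).coeff i = -1 ∨ (lp n b).coeff i = 1) ∧
    (n ≤ i → (lp n b).coeff i = 0) := by
  induction n generalizing b i with
  | zero => simp [lp]
  | succ n ih =>
    rw [lp, pow_one]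
    cases i with
    | zero =>
      simp only [coeff_add, coeff_C_zero, mul_coeff_zero, coeff_X_zero, zero_mul, add_zero]
      refine ⟨fun _ => ?_, fun h => by omega⟩
      rcases Nat.mod_two_eq_zero_or_one b with h | h <;> rw [h] <;> norm_num
    | succ i =>
      simp only [coeff_add, coeff_C_succ, coeff_X_mul, zero_add]
      have := ih (b / 2) i
      exact ⟨fun h => this.1 (by omega), fun h => this.2 (by omega)⟩

theorem eval_lp (B n b : ℕ) : (lp n b).eval (B : ℤ) =
    2 * spread B n b - ((∑ k ∈ Finset.range n, B ^ k : ℕ) : ℤ) := by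
  induction n generalizing b with
  | zero => simp [lp, spread_zero]
  | succ n ih =>
    rw [lp, spread_succ, Finset.sum_range_succ']
    simp only [eval_add, eval_C, eval_mul, eval_pow, eval_X, ih, pow_succ, ← Finset.sum_mul]
    push_cast; ring

theorem lp_littlewood (n b : ℕ) (hn : 1 ≤ n) : IsLittlewood (lp n b) := by
  intro i hi
  have hd : (lp n b).natDegree ≤ n - 1 := by
    rw [natDegree_le_iff_coeff_eq_zero]
    intro N hN
    exact (coeff_lp n b N).2 (by omega)
  have := (coeff_lp n b i).1 (by omega)
  simpa using this

theorem lit_core (c b n e W : ℕ)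
    (hv : (ev 65536 (pl c) * W + rp 65536 (pl c) * (32768 * kS 65536 e)) + (65536 ^ n - 1) / 65535 =
      (rp 65536 (pl c) * W + ev 65536 (pl c) * (32768 * kS 65536 e)) + 2 * spread 65536 n b)
    (hb : ksum (leafPos 32768) 65536 e W + ksum (leafNeg 32768) 65536 e W + 2 ≤ 65536) :
    op 1 1 (pl c) * kp 32768 65536 e W = lp n b := by
  apply kron_eq 65536 (by norm_num)
  · intro i
    have h1 := abs_kp 32768 65536 e (op 1 1 (pl c)) 1 (pl_coeff c) W i
    have h2 : |(lp n b).coeff i| ≤ 1 := by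
      by_cases hi : i < n
      · rcases (coeff_lp n b i).1 hi with h | h <;> rw [h] <;> norm_num
      · rw [(coeff_lp n b i).2 (by omega)]; norm_num
    have h3 : ((ksum (leafPos 32768) 65536 e W : ℕ) : ℤ) + ksum (leafNeg 32768) 65536 e W + 2
      ≤ 65536 := by exact_mod_cast hb
    linarith
  · have e1 := eval_op 1 1 65536 (pl c)
    have e2 := eval_kp 32768 65536 e W
    have e3 := eval_lp 65536 n b
    have e4 := Nat.geomSum_eq (show 2 ≤ 65536 by norm_num) n
    rw [e4] at e3
    rw [pow_one] at e1
    have hv' := congrArg (Nat.cast : ℕ → ℤ) hv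
    simp only [Nat.cast_add, Nat.cast_mul] at hv'
    norm_num only at e3 hv'
    simp only [Nat.cast_ofNat, Nat.cast_one, one_mul] at e1 e2 e3 hv'
    rw [eval_mul, e1, e2, e3]
    linear_combination hv'

theorem litChk_sound (c b : ℕ) (h : litChk c b = true) :
    ∃ L : ℤ[X], IsLittlewood L ∧ op 1 1 (pl c) ∣ L := by
  simp only [litChk, force_eq, Bool.cond_false_right, Bool.and_eq_true, Nat.beq_eq, Nat.ble_eq,
    Nat.add_eq, Nat.mul_eq, Nat.pow_eq, Nat.sub_eq, ndiv] at h
  obtain ⟨h1, h2, h3⟩ := h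
  exact ⟨_, lp_littlewood _ b h3, _, (lit_core _ _ _ _ _ h1 h2).symm⟩

theorem octAux (n x : ℕ) : ∀ a ∈ (Nat.rec (motive := fun _ => ℕ → List ℕ) (fun _ => [])
    (fun _ ih x => force (Nat.mod x 8) fun a => force (Nat.div x 8) fun y =>
      cond (Nat.beq a 0) [] (a :: ih y)) n x : List ℕ), 1 ≤ a ∧ a ≤ 7 := by
  induction n generalizing x with
  | zero => simp
  | succ n ih =>
    simp only [force_eq, nmod, ndiv] at ih ⊢
    by_cases h0 : x % 8 = 0
    · simp [h0]
    · have : Nat.beq (x % 8) 0 = false := by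
        rw [Bool.eq_false_iff]; simpa using h0
      rw [this, cond_false]
      intro a ha
      rcases List.mem_cons.mp ha with h | h
      · omega
      · exact ih _ a h

theorem oct_mem (x : ℕ) : ∀ a ∈ oct x, 1 ≤ a ∧ a ≤ 7 := octAux 10 x

theorem oct_coeff (x i : ℕ) : |(op 4 1 (oct x)).coeff i| ≤ 4 := by
  have := coeff_op_le 4 4 (oct x) (fun a ha => by have := oct_mem x a ha; omega) i
  simpa using this

theorem fct_sound (c F O : ℕ) (h : fct c F O = true) :
    op 4 1 (oct F) * op 4 1 (oct O) = op 1 1 (pl c) := by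
  simp only [fct, Bool.cond_false_right, Bool.and_eq_true, Nat.beq_eq, Nat.ble_eq,
    Nat.add_eq, Nat.mul_eq] at h
  obtain ⟨h1, h2⟩ := h
  apply kron_eq 1024 (by norm_num)
  · intro i
    have h3 := bound_op (op 4 1 (oct F)) 4 (oct_coeff F) 4 1 (oct O) i
    have h4 := pl_coeff c i
    have h5 : (l1 4 (oct O) : ℤ) ≤ 100 := by exact_mod_cast h2
    linarith
  · have e1 := eval_op 4 1 1024 (oct F)
    have e2 := eval_op 4 1 1024 (oct O)
    have e3 := eval_op 1 1 1024 (pl c)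
    have hv' := congrArg (Nat.cast : ℕ → ℤ) h1
    simp only [Nat.cast_add, Nat.cast_mul] at hv'
    simp only [Nat.cast_ofNat, Nat.cast_one, one_mul, pow_one] at e1 e2 e3 hv'
    rw [eval_mul, e1, e2, e3]
    linear_combination hv'

/-- The key inequality. -/
theorem bnd_core (N A K : ℤ[X]) (h s j : ℕ) (cl : List ℕ) (p m lo hi M E B0 : ℕ)
    (hK : N * K = A * op h s cl)
    (hN : ∀ i, -(m : ℤ) ≤ (N * K).coeff i ∧ (N * K).coeff i ≤ p)
    (hM : M = getN cl j - h) (hE : E = l1 h cl - M) (hME : E < M)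
    (hB0 : B0 = max m p / (M - E))
    (h1 : p + E * B0 < (hi + 1) * M) (h2 : m + E * B0 < (lo + 1) * M) (i : ℕ) :
    -(lo : ℤ) ≤ A.coeff i ∧ A.coeff i ≤ hi := by
  have hj : h < getN cl j := by omega
  obtain ⟨R, hR, E', hE', hb⟩ := split_op h s cl j hj
  have hEE : E' = E := by omega
  subst hEE
  have key : ∀ i, (N * K).coeff (i + s * j) = M * A.coeff i + (A * R).coeff (i + s * j) := by
    intro i
    have : ((getN cl j : ℕ) : ℤ) - h = M := by omega
    rw [hK, hR, this, mul_add, coeff_add, show A * (C (M : ℤ) * X ^ (s * j)) =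
      (C (M : ℤ) * A) * X ^ (s * j) by ring, coeff_mul_X_pow, coeff_C_mul]
  obtain ⟨i0, hi0⟩ : ∃ i0, ∀ i, (A.coeff i).natAbs ≤ (A.coeff i0).natAbs := by
    obtain ⟨i0, -, h0⟩ := Finset.exists_max_image (Finset.range (A.natDegree + 1))
      (fun i => (A.coeff i).natAbs) ⟨0, by simp⟩
    refine ⟨i0, fun i => ?_⟩
    by_cases hi : i < A.natDegree + 1
    · exact h0 i (by simpa using hi)
    · rw [coeff_eq_zero_of_natDegree_lt (by omega)]; simp
  obtain ⟨a, ha⟩ : ∃ a, a = (A.coeff i0).natAbs := ⟨_, rfl⟩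
  have hle : ∀ i, |A.coeff i| ≤ (a : ℤ) := by
    intro i
    rw [Int.abs_eq_natAbs, ha]; exact_mod_cast hi0 i
  have hr := hb A a hle
  have haB : a ≤ B0 := by
    rw [hB0, Nat.le_div_iff_mul_le (by omega)]
    have k := key i0
    have n1 := hN (i0 + s * j)
    have r1 := abs_le.mp (hr (i0 + s * j))
    have hx : (M : ℤ) * a ≤ max m p + a * E' := by
      have hm : (m : ℤ) ≤ ((max m p : ℕ) : ℤ) := by exact_mod_cast le_max_left m p
      have hp : (p : ℤ) ≤ ((max m p : ℕ) : ℤ) := by exact_mod_cast le_max_right m p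
      have habs : (a : ℤ) = |A.coeff i0| := by rw [Int.abs_eq_natAbs, ha]
      rcases abs_cases (A.coeff i0) with ⟨h, _⟩ | ⟨h, _⟩
      · rw [h] at habs
        have : (M : ℤ) * a = M * A.coeff i0 := by rw [habs]
        linarith [n1.1, n1.2, r1.1, r1.2]
      · rw [h] at habs
        have : (M : ℤ) * a = - (M * A.coeff i0) := by rw [habs]; ring
        linarith [n1.1, n1.2, r1.1, r1.2]
    rw [Nat.cast_max] at hx
    zify [hME.le]
    linarith
  have k := key i
  have n1 := hN (i + s * j)
  have r1 := abs_le.mp (hr (i + s * j))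
  have haE : (a : ℤ) * E' ≤ E' * B0 := by
    rw [mul_comm]; exact mul_le_mul_of_nonneg_left (by exact_mod_cast haB) (by positivity)
  have h1' : (p : ℤ) + E' * B0 < (hi + 1) * M := by exact_mod_cast h1
  have h2' : (m : ℤ) + E' * B0 < (lo + 1) * M := by exact_mod_cast h2
  have hM0 : (0 : ℤ) < M := by omega
  constructor
  · have : (M : ℤ) * (-(lo + 1)) < M * A.coeff i := by linarith [n1.1, n1.2, r1.1, r1.2]
    have := lt_of_mul_lt_mul_left this hM0.le
    omega
  · have : (M : ℤ) * A.coeff i < M * (hi + 1) := by linarith [n1.1, n1.2, r1.1, r1.2]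
    have := lt_of_mul_lt_mul_left this hM0.le
    omega

theorem fK_core (fl gl cl : List ℕ) (h s e B hB W : ℕ)
    (hf : ∀ i, |(op 4 1 fl).coeff i| ≤ 4) (hg : ∀ i, |(op 4 1 gl).coeff i| ≤ 4)
    (hv : (ev B fl * W + 4 * (rp B fl * (hB * kS B e))) +
        (ev B gl * (h * rp (B ^ s) cl) + 4 * (rp B gl * ev (B ^ s) cl)) =
      (ev B fl * (hB * kS B e) + 4 * (rp B fl * W)) +
        (ev B gl * ev (B ^ s) cl + 4 * (rp B gl * (h * rp (B ^ s) cl))))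
    (hb : 4 * (ksum (leafPos hB) B e W + ksum (leafNeg hB) B e W + l1 h cl) < B) :
    op 4 1 fl * kp hB B e W = op 4 1 gl * op h s cl := by
  apply kron_eq B (by omega)
  · intro i
    have h1 := abs_kp hB B e (op 4 1 fl) 4 hf W i
    have h2 := bound_op (op 4 1 gl) 4 hg h s cl i
    have h3 : 4 * (((ksum (leafPos hB) B e W : ℕ) : ℤ) + ksum (leafNeg hB) B e W + l1 h cl) < B := by
      exact_mod_cast hb
    linarith
  · have e1 := eval_op 4 1 B fl
    have e2 := eval_op 4 1 B gl
    have e3 := eval_op h s B cl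
    have e4 := eval_kp hB B e W
    have hv' := congrArg (Nat.cast : ℕ → ℤ) hv
    simp only [Nat.cast_add, Nat.cast_mul] at hv'
    simp only [Nat.cast_ofNat, pow_one] at e1 e2 hv'
    rw [eval_mul, eval_mul, e1, e2, e3, e4]
    linear_combination hv'

theorem cond_max (p m : ℕ) : cond (Nat.ble p m) m p = max m p := by
  by_cases h : p ≤ m
  · rw [Nat.ble_eq_true_of_le h, max_eq_left h]; rfl
  · have : Nat.ble p m = false := by
      rw [Bool.eq_false_iff]; intro h2; exact h (Nat.le_of_ble_eq_true h2)
    rw [this, max_eq_right (by omega)]; rfl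

theorem bndChk_sound (fl gl cl : List ℕ) (h k e w lo hi j : ℕ)
    (hc : bndChk fl gl cl h k e w lo hi j = true)
    (hf : ∀ i, |(op 4 1 fl).coeff i| ≤ 4) (hg : ∀ i, |(op 4 1 gl).coeff i| ≤ 4)
    (N Q : ℤ[X]) (hN : ∀ i, N.coeff i = 0 ∨ N.coeff i = 1) (hQ : N = op 4 1 fl * Q) (i : ℕ) :
    -(lo : ℤ) ≤ (op 4 1 gl * Q).coeff i ∧ (op 4 1 gl * Q).coeff i ≤ hi := by
  simp only [bndChk, force_eq, Bool.cond_false_right, Bool.and_eq_true, Nat.beq_eq, Nat.ble_eq,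
    Nat.add_eq, Nat.mul_eq, Nat.pow_eq, Nat.sub_eq, ndiv, cond_max, Nat.succ_eq_add_one,
    Nat.add_one_le_iff] at hc
  obtain ⟨h1, h2, h3, h4, h5⟩ := hc
  have hK := fK_core fl gl cl h (2 ^ k) e (2 ^ w) _ _ hf hg h1 h2
  refine bnd_core N (op 4 1 gl * Q) _ h (2 ^ k) j cl _ _ lo hi _ _ _ ?_
    (fun i => bnd_kp _ _ e N hN _ i) rfl rfl h3 rfl h4 h5 i
  rw [hQ]
  linear_combination Q * hK

/-- Window of the last coefficients. -/
def wd (Q : ℤ[X]) (k i : ℕ) : ℤ := if i < k then Q.coeff (k - 1 - i) else 0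

theorem wd_zero (Q : ℤ[X]) (k : ℕ) : wd Q (k + 1) 0 = Q.coeff k := by simp [wd]
theorem wd_succ (Q : ℤ[X]) (k i : ℕ) : wd Q (k + 1) (i + 1) = wd Q k i := by
  simp only [wd, Nat.add_lt_add_iff_right]
  split_ifs
  · congr 1; omega
  · rfl

/-- The key `key` encodes the first `d` values of `φ`. -/
def KR (φ : ℕ → ℤ) : ℕ → ℕ → Prop
  | 0, key => key = 0
  | d + 1, key => ∃ x y : ℕ, x < 256 ∧ (x : ℤ) = φ 0 + 128 ∧ key = x + 256 * y ∧
      KR (fun i => φ (i + 1)) d y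

/-- Signed scalar product. -/
def sp (φ : ℕ → ℤ) : List ℕ → ℤ
  | [] => 0
  | a :: l => ((a : ℤ) - 4) * φ 0 + sp (fun i => φ (i + 1)) l

theorem sp_zero (φ : ℕ → ℤ) (h : ∀ i, φ i = 0) (l : List ℕ) : sp φ l = 0 := by
  induction l generalizing φ with
  | nil => rfl
  | cons a l ih => rw [sp, h, ih _ (fun i => h (i + 1))]; simp

theorem coeff_sp (Q : ℤ[X]) (l : List ℕ) (k : ℕ) :
    (op 4 1 l * Q).coeff k = sp (wd Q (k + 1)) l := by
  induction l generalizing k with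
  | nil => simp [op, sp]
  | cons a l ih =>
    rw [op, sp, wd_zero, mul_comm, coeff_step, mul_comm Q]
    have h1 : (fun i => wd Q (k + 1) (i + 1)) = wd Q k := by
      funext i; exact wd_succ Q k i
    rw [h1]
    cases k with
    | zero =>
      rw [sp_zero (wd Q 0) (fun i => by simp [wd])]
      simp; ring
    | succ k =>
      rw [← ih k]; simp; ring

theorem dotN_nil (key : ℕ) : dotN [] key = 0 := rfl
theorem dotN_cons (a : ℕ) (l : List ℕ) (key : ℕ) :
    dotN (a :: l) key = (a * (key % 256) + 4 * (256 - key % 256)) + dotN l (key / 256) := by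
  have : dotN (a :: l) key = force (Nat.mod key 256) fun x => force (Nat.div key 256) fun y =>
      Nat.add (Nat.add (Nat.mul a x) (Nat.mul 4 (Nat.sub 256 x))) (dotN l y) := rfl
  rw [this, force_eq, force_eq]; rfl

theorem dot_KR (l : List ℕ) (φ : ℕ → ℤ) (d key Z : ℕ) (h : KR φ d key)
    (hZ : KR (fun _ => 0) d Z) (hd : l.length ≤ d) :
    (dotN l key : ℤ) = dotN l Z + sp φ l := by
  induction l generalizing φ d key Z with
  | nil => simp [dotN_nil, sp]
  | cons a l ih =>
    cases d with
    | zero => simp at hd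
    | succ d =>
      obtain ⟨x, y, hx, hx2, hk, hy⟩ := h
      obtain ⟨x', y', hx', hx2', hk', hy'⟩ := hZ
      beta_reduce at hx2'
      rw [dotN_cons, dotN_cons, sp]
      have e1 : key % 256 = x := by omega
      have e2 : key / 256 = y := by omega
      have e3 : Z % 256 = 128 := by omega
      have e4 : Z / 256 = y' := by omega
      have := ih _ d y y' hy hy' (by simpa using hd)
      rw [e1, e2, e3, e4]
      push_cast [hx.le]
      rw [this, hx2]; ring

theorem KR_mod (φ : ℕ → ℤ) (d d' key : ℕ) (h : KR φ d key) (hd : d' ≤ d) :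
    KR φ d' (key % 256 ^ d') := by
  induction d' generalizing φ d key with
  | zero => simp [KR, Nat.mod_one]
  | succ d' ih =>
    cases d with
    | zero => omega
    | succ d =>
      obtain ⟨x, y, hx, hx2, hk, hy⟩ := h
      refine ⟨x, y % 256 ^ d', hx, hx2, ?_, ih _ d y hy (by omega)⟩
      rw [pow_succ', Nat.mod_mul]
      have e1 : key % 256 = x := by omega
      have e2 : key / 256 = y := by omega
      rw [e1, e2]

theorem KR_unique (φ : ℕ → ℤ) (d key Z : ℕ) (h : KR φ d key) (hZ : KR (fun _ => 0) d Z)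
    (h0 : ∀ i < d, φ i = 0) : key = Z := by
  induction d generalizing φ key Z with
  | zero => exact Eq.trans h (Eq.symm hZ)
  | succ d ih =>
    obtain ⟨x, y, hx, hx2, hk, hy⟩ := h
    obtain ⟨x', y', hx', hx2', hk', hy'⟩ := hZ
    beta_reduce at hx2'
    have := ih _ y y' hy hy' (fun i hi => h0 (i + 1) (by omega))
    rw [h0 0 (by omega)] at hx2
    omega

theorem KR_Z (d : ℕ) : KR (fun _ => 0) d (128 * ((256 ^ d - 1) / 255)) := by
  have := Nat.geomSum_eq (show 2 ≤ 256 by norm_num) d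
  norm_num only at this
  rw [← this]
  clear this
  induction d with
  | zero => simp [KR]
  | succ d ih =>
    refine ⟨128, _, by norm_num, by norm_num, ?_, ih⟩
    rw [Finset.sum_range_succ']
    simp only [pow_succ, ← Finset.sum_mul]
    ring

/-! soundness of the search -/
def TM (x : ℕ) : Tr → Prop
  | Tr.lf => False
  | Tr.nd l y r => TM x l ∨ x = y ∨ TM x r

theorem insK_sound (T : Tr) (s : ℕ) (fnd : Bool) (k : Tr → Bool) :
    (insK T s fnd k = fnd ∧ TM s T) ∨
      ∃ T', insK T s fnd k = k T' ∧ ∀ x, TM x T' → TM x T ∨ x = s := by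
  induction T generalizing k with
  | lf => right; exact ⟨Tr.nd Tr.lf s Tr.lf, rfl, by simp [TM]⟩
  | nd l y r ihl ihr =>
    have e : insK (Tr.nd l y r) s fnd k = cond (Nat.beq s y) fnd
      (cond (Nat.ble s y) (insK l s fnd fun t => k (Tr.nd t y r))
        (insK r s fnd fun t => k (Tr.nd l y t))) := rfl
    rw [e]
    cases hb : Nat.beq s y with
    | true =>
      left
      rw [Nat.beq_eq] at hb
      exact ⟨rfl, Or.inr (Or.inl hb)⟩
    | false =>
      rw [cond_false]
      cases Nat.ble s y with
      | true =>
        rw [cond_true]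
        rcases ihl (fun t => k (Tr.nd t y r)) with ⟨h1, h2⟩ | ⟨T', h1, h2⟩
        · left; exact ⟨h1, Or.inl h2⟩
        · right
          refine ⟨_, h1, fun x hx => ?_⟩
          rcases hx with hx | hx | hx
          · rcases h2 x hx with h | h
            · exact Or.inl (Or.inl h)
            · exact Or.inr h
          · exact Or.inl (Or.inr (Or.inl hx))
          · exact Or.inl (Or.inr (Or.inr hx))
      | false =>
        rw [cond_false]
        rcases ihr (fun t => k (Tr.nd l y t)) with ⟨h1, h2⟩ | ⟨T', h1, h2⟩
        · left; exact ⟨h1, Or.inr (Or.inr h2)⟩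
        · right
          refine ⟨_, h1, fun x hx => ?_⟩
          rcases hx with hx | hx | hx
          · exact Or.inl (Or.inl hx)
          · exact Or.inl (Or.inr (Or.inl hx))
          · rcases h2 x hx with h | h
            · exact Or.inl (Or.inr (Or.inr h))
            · exact Or.inr h

/-- successor condition for one `eps` -/
def SOK (lo hi zf zz pw df dg eps s : ℕ) (S : ℕ → Prop) : Prop :=
  zz ≤ lo + (eps + (128 + df) + dg) → eps + (128 + df) + dg ≤ zz + hi →
    zf ≤ eps + (128 + df) ∧ eps + (128 + df) - zf < 256 ∧
      S (256 * (s % pw) + (eps + (128 + df) - zf))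

theorem SOK.mono {lo hi zf zz pw df dg eps s : ℕ} {S S' : ℕ → Prop} (h : ∀ x, S x → S' x)
    (hs : SOK lo hi zf zz pw df dg eps s S) : SOK lo hi zf zz pw df dg eps s S' :=
  fun h1 h2 => ⟨(hs h1 h2).1, (hs h1 h2).2.1, h _ (hs h1 h2).2.2⟩

theorem step_sound (lo hi zf zz pw df dg eps s : ℕ) (st : List ℕ) (k : List ℕ → Bool)
    (h : step lo hi zf zz pw df dg eps s st k = true) :
    ∃ st', k st' = true ∧ (∀ x ∈ st, x ∈ st') ∧
      SOK lo hi zf zz pw df dg eps s (fun x => x ∈ st') := by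
  simp only [step, force_eq, Nat.add_eq, Nat.mul_eq, Nat.sub_eq, nmod] at h
  cases h1 : Nat.ble zz (lo + (eps + (128 + df) + dg)) with
  | false =>
    rw [h1, cond_false] at h
    refine ⟨st, h, fun x hx => hx, fun h2 => ?_⟩
    rw [Nat.ble_eq_true_of_le h2] at h1; cases h1
  | true =>
    rw [h1, cond_true] at h
    cases h3 : Nat.ble (eps + (128 + df) + dg) (zz + hi) with
    | false =>
      rw [h3, cond_false] at h
      refine ⟨st, h, fun x hx => hx, fun _ h2 => ?_⟩
      rw [Nat.ble_eq_true_of_le h2] at h3; cases h3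
    | true =>
      rw [h3, cond_true] at h
      simp only [Bool.cond_false_right, Bool.and_eq_true, Nat.ble_eq] at h
      obtain ⟨h4, h5, h6⟩ := h
      exact ⟨_, h6, fun x hx => List.mem_cons_of_mem _ hx, fun _ _ =>
        ⟨h4, h5, List.mem_cons_self⟩⟩

theorem explore_sound (al gl : List ℕ) (lo hi Z zf zz pw fuel : ℕ) (st : List ℕ) (T : Tr)
    (h : explore al gl lo hi Z zf zz pw fuel st T = true) :
    ∃ S : ℕ → Prop, (∀ s, S s → s ≠ Z ∧ ∀ eps, eps = 0 ∨ eps = 1 →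
        SOK lo hi zf zz pw (dotN al s) (dotN gl s) eps s (fun x => S x ∨ TM x T)) ∧
      ∀ s ∈ st, S s ∨ TM s T := by
  induction fuel generalizing st T with
  | zero => cases h
  | succ n ih =>
    cases st with
    | nil => exact ⟨fun _ => False, fun s hs => hs.elim, by simp⟩
    | cons s st =>
      have e : explore al gl lo hi Z zf zz pw (n + 1) (s :: st) T =
        insK T s (explore al gl lo hi Z zf zz pw n st T) fun T' =>
        cond (Nat.beq s Z) false
          (force (dotN al s) fun df => force (dotN gl s) fun dg =>
            step lo hi zf zz pw df dg 0 s st fun st1 =>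
            step lo hi zf zz pw df dg 1 s st1 fun st2 =>
              explore al gl lo hi Z zf zz pw n st2 T') := rfl
      rw [e] at h
      rcases insK_sound T s (explore al gl lo hi Z zf zz pw n st T) (fun T' =>
        cond (Nat.beq s Z) false
          (force (dotN al s) fun df => force (dotN gl s) fun dg =>
            step lo hi zf zz pw df dg 0 s st fun st1 =>
            step lo hi zf zz pw df dg 1 s st1 fun st2 =>
              explore al gl lo hi Z zf zz pw n st2 T')) with ⟨h1, h2⟩ | ⟨T', h1, h2⟩
      · rw [h1] at h
        obtain ⟨S, hS, hst⟩ := ih st T h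
        refine ⟨S, hS, fun x hx => ?_⟩
        rcases List.mem_cons.mp hx with hx | hx
        · rw [hx]; exact Or.inr h2
        · exact hst x hx
      · rw [h1] at h
        simp only [force_eq] at h
        cases hz : Nat.beq s Z with
        | true => rw [hz, cond_true] at h; cases h
        | false =>
          rw [hz, cond_false] at h
          obtain ⟨st1, g1, i1, s1⟩ := step_sound _ _ _ _ _ _ _ _ _ _ _ h
          obtain ⟨st2, g2, i2, s2⟩ := step_sound _ _ _ _ _ _ _ _ _ _ _ g1
          obtain ⟨S, hS, hst⟩ := ih st2 T' g2
          have hsub : ∀ x, S x ∨ TM x T' → (S x ∨ x = s) ∨ TM x T := by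
            intro x hx
            rcases hx with hx | hx
            · exact Or.inl (Or.inl hx)
            · rcases h2 x hx with h | h
              · exact Or.inr h
              · exact Or.inl (Or.inr h)
          refine ⟨fun x => S x ∨ x = s, ?_, ?_⟩
          · intro x hx
            rcases hx with hx | hx
            · exact ⟨(hS x hx).1, fun eps he => ((hS x hx).2 eps he).mono hsub⟩
            · subst hx
              refine ⟨fun hx => ?_, ?_⟩
              · have : Nat.beq x Z = true := by rw [Nat.beq_eq]; exact hx
                rw [this] at hz; cases hz
              · rintro eps (he | he) <;> subst he
                · exact s1.mono fun y hy => hsub y (hst y (i2 y hy))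
                · exact s2.mono fun y hy => hsub y (hst y hy)
          · intro x hx
            rcases List.mem_cons.mp hx with hx | hx
            · exact Or.inl (Or.inr hx)
            · exact hsub x (hst x (i2 x (i1 x hx)))

theorem len_eq (l : List ℕ) : len l = l.length := by
  induction l with
  | nil => rfl
  | cons a l ih => rw [List.length_cons, ← ih]; rfl

theorem neg8_cons (a : ℕ) (l : List ℕ) : neg8 (a :: l) = (8 - a) :: neg8 l := by
  have : neg8 (a :: l) = force (Nat.sub 8 a) fun b => b :: neg8 l := rfl
  rw [this, force_eq]; rfl

theorem neg8_len (l : List ℕ) : (neg8 l).length = l.length := by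
  induction l with
  | nil => rfl
  | cons a l ih => rw [neg8_cons]; simp [ih]

theorem neg8_sp (φ : ℕ → ℤ) (l : List ℕ) (h : ∀ a ∈ l, a ≤ 7) : sp φ (neg8 l) = - sp φ l := by
  induction l generalizing φ with
  | nil => simp [neg8, sp]
  | cons a l ih =>
    rw [neg8_cons, sp, sp, ih _ (fun b hb => h b (List.mem_cons_of_mem _ hb))]
    have := h a List.mem_cons_self
    push_cast [show a ≤ 8 by omega]; ring

theorem autChk_sound (fl gl : List ℕ) (lo hi : ℕ) (hc : autChk fl gl lo hi = true)
    (hfl : ∀ a ∈ fl, a ≤ 7)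
    (N Q : ℤ[X]) (hN : ∀ i, N.coeff i = 0 ∨ N.coeff i = 1) (hN0 : N.coeff 0 = 1)
    (hQ : N = op 4 1 fl * Q)
    (hA : ∀ i, -(lo : ℤ) ≤ (op 4 1 gl * Q).coeff i ∧ (op 4 1 gl * Q).coeff i ≤ hi) : False := by
  cases fl with
  | nil => simp [op] at hQ; rw [hQ] at hN0; simp at hN0
  | cons f0 ft =>
  cases gl with
  | nil =>
    simp only [autChk, force_eq, forceL_eq, Bool.cond_false_right, Bool.and_eq_true, Nat.beq_eq] at hc
    have := hc.2.1
    simp [hd] at this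
  | cons g0 gt =>
  simp only [autChk, force_eq, forceL_eq, Bool.cond_false_right, Bool.and_eq_true, Nat.beq_eq,
    Nat.ble_eq, Nat.add_eq, Nat.mul_eq, Nat.pow_eq, ndiv, Nat.pred_eq_sub_one,
    Nat.succ_eq_add_one, len_eq] at hc
  have t1 : tl (f0 :: ft) = ft := rfl
  have t2 : tl (g0 :: gt) = gt := rfl
  have t3 : hd (f0 :: ft) = f0 := rfl
  have t4 : hd (g0 :: gt) = g0 := rfl
  rw [t1, t2, t3, t4, neg8_len] at hc
  obtain ⟨hf0, hg0, hgd, hd1, hex⟩ := hc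
  obtain ⟨d, hd⟩ : ∃ d, d = ft.length := ⟨_, rfl⟩
  rw [← hd] at hgd hd1 hex
  have hZ := KR_Z d
  generalize 128 * ((256 ^ d - 1) / 255) = Z at hZ hex
  obtain ⟨S, hS, hst⟩ := explore_sound _ _ _ _ _ _ _ _ _ _ _ hex
  simp only [TM, or_false] at hS hst
  have hstart := hst (Z + 1) (by simp)
  have cN : ∀ k, N.coeff k = Q.coeff k + sp (wd Q k) ft := by
    intro k
    rw [hQ, coeff_sp, sp, wd_zero, hf0]
    have h1 : (fun i => wd Q (k + 1) (i + 1)) = wd Q k := by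
      funext i; exact wd_succ Q k i
    rw [h1]; norm_num
  have cA : ∀ k, (op 4 1 (g0 :: gt) * Q).coeff k = Q.coeff k + sp (wd Q k) gt := by
    intro k
    rw [coeff_sp, sp, wd_zero, hg0]
    have h1 : (fun i => wd Q (k + 1) (i + 1)) = wd Q k := by
      funext i; exact wd_succ Q k i
    rw [h1]; norm_num
  have main : ∀ k, ∃ key, S key ∧ KR (wd Q (k + 1)) d key := by
    intro k
    induction k with
    | zero =>
      refine ⟨Z + 1, hstart, ?_⟩
      cases d with
      | zero => omega
      | succ d =>
        obtain ⟨x, y, hx, hx2, hk, hy⟩ := hZ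
        beta_reduce at hx2
        have hq : Q.coeff 0 = 1 := by
          have := cN 0
          rw [sp_zero _ (fun i => by simp [wd])] at this
          omega
        refine ⟨x + 1, y, by omega, ?_, by omega, ?_⟩
        · rw [wd_zero, hq]; push_cast; rw [hx2]; norm_num
        · have : (fun i => wd Q (0 + 1) (i + 1)) = fun _ => 0 := by
            funext i; rw [wd_succ]; simp [wd]
          rw [this]; exact hy
    | succ k ih =>
      obtain ⟨key, hk, hKR⟩ := ih
      obtain ⟨eps, he, heN⟩ : ∃ eps : ℕ, (eps = 0 ∨ eps = 1) ∧ (eps : ℤ) = N.coeff (k + 1) := by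
        rcases hN (k + 1) with h | h
        · exact ⟨0, Or.inl rfl, by simp [h]⟩
        · exact ⟨1, Or.inr rfl, by simp [h]⟩
      have h1 := (hS key hk).2 eps he
      have df := dot_KR (neg8 ft) _ d key Z hKR hZ (by rw [neg8_len, hd])
      have dg := dot_KR gt _ d key Z hKR hZ hgd
      rw [neg8_sp _ _ (fun a ha => hfl a (List.mem_cons_of_mem _ ha))] at df
      have a1 := hA (k + 1)
      rw [cA] at a1
      have n1 := cN (k + 1)
      obtain ⟨h2, h3, h4⟩ := h1 (by omega) (by omega)
      refine ⟨_, h4, ?_⟩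
      obtain ⟨d', hd'⟩ : ∃ d', d = d' + 1 := ⟨d - 1, by omega⟩
      have hmod := KR_mod _ d d' key hKR (by omega)
      rw [hd', Nat.add_sub_cancel]
      refine ⟨_, _, h3, ?_, by ring, ?_⟩
      · rw [wd_zero]; push_cast [h2]; omega
      · have : (fun i => wd Q (k + 1 + 1) (i + 1)) = wd Q (k + 1) := by
          funext i; exact wd_succ Q (k + 1) i
        rw [this]; exact hmod
  obtain ⟨key, hk, hKR⟩ := main (Q.natDegree + d)
  refine (hS key hk).1 (KR_unique _ d key Z hKR hZ ?_)
  intro i hi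
  rw [wd]
  split_ifs
  · apply coeff_eq_zero_of_natDegree_lt; omega
  · rfl

theorem nonChk_sound (c F O G k e w lo hi m j X' : ℕ)
    (h : nonChk c F O G k e w lo hi m j X' = true) (N : ℤ[X]) (hN : IsNewman N)
    (hd : op 1 1 (pl c) ∣ N) : False := by
  simp only [nonChk, force_eq, forceL_eq, Bool.cond_false_right, Bool.and_eq_true] at h
  obtain ⟨h1, h2, h3⟩ := h
  have hf := fct_sound _ _ _ h1
  obtain ⟨Q, hQ⟩ := hd
  have hN' : ∀ i, N.coeff i = 0 ∨ N.coeff i = 1 := fun i => by simpa using hN.1 i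
  have hQ' : N = op 4 1 (oct F) * (op 4 1 (oct O) * Q) := by rw [hQ, ← hf]; ring
  exact autChk_sound _ _ _ _ h3 (fun a ha => (oct_mem F a ha).2) N _ hN' hN.2 hQ'
    (bndChk_sound _ _ _ _ _ _ _ _ _ _ h2 (oct_coeff F) (oct_coeff G) N _ hN' hQ')

/-! ### The two exceptional polynomials -/

lemma norm_newman_le (w : ℂ) (r : ℝ) (hw : ‖w‖ ≤ r) (hr : r < 1) (Q : ℤ[X])
    (hQ : ∀ i, Q.coeff i ∈ ({0, 1} : Set ℤ)) : ‖aeval w Q‖ ≤ 1 / (1 - r) := by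
  have h0 : 0 ≤ r := (norm_nonneg _).trans hw
  rw [aeval_eq_sum_range]
  refine (norm_sum_le _ _).trans ?_
  refine le_trans (Finset.sum_le_sum (g := fun i => r ^ i) ?_) ?_
  · intro i _
    rw [zsmul_eq_mul, norm_mul, norm_pow]
    have h1 : ‖((Q.coeff i : ℤ) : ℂ)‖ ≤ 1 := by
      rcases hQ i with h | h <;> rw [h] <;> simp
    calc _ ≤ 1 * r ^ i := by gcongr
      _ = _ := one_mul _
  · rw [one_div, ← tsum_geometric_of_lt_one h0 hr]
    exact (summable_geometric_of_lt_one h0 hr).sum_le_tsum _ (fun i _ => pow_nonneg h0 i)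

/-- If the low powers of `w` are not too negative, a Newman type polynomial is large at `w`. -/
lemma newman_re (w : ℂ) (r : ℝ) (hw : ‖w‖ ≤ r) (hr : r < 1) (b : ℕ → ℝ) (hb : ∀ n, 0 ≤ b n) :
    ∀ (K n : ℕ) (Q : ℤ[X]), (∀ i, Q.coeff i ∈ ({0, 1} : Set ℤ)) →
      (∀ i < K, - b (n + i) ≤ (w ^ (n + i)).re) →
      - (∑ i ∈ Finset.range K, b (n + i)) - r ^ (n + K) / (1 - r) ≤ (w ^ n * aeval w Q).re := by
  have h0 : 0 ≤ r := (norm_nonneg _).trans hw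
  intro K
  induction K with
  | zero =>
    intro n Q hQ _
    have h1 : ‖w ^ n * aeval w Q‖ ≤ r ^ n * (1 / (1 - r)) := by
      rw [norm_mul, norm_pow]
      have := norm_newman_le w r hw hr Q hQ
      gcongr
    have h2 := (abs_le.1 (Complex.abs_re_le_norm (w ^ n * aeval w Q))).1
    simp only [Finset.range_zero, Finset.sum_empty, add_zero]
    rw [mul_one_div] at h1
    linarith
  | succ K ih =>
    intro n Q hQ hn
    have h1 := ih (n + 1) Q.divX (fun i => by rw [coeff_divX]; exact hQ _)
      (fun i hi => by have := hn (i + 1) (by omega); rwa [← add_assoc, add_right_comm] at this)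
    have h2 : aeval w Q = w * aeval w Q.divX + (Q.coeff 0 : ℂ) := by
      conv_lhs => rw [← divX_mul_X_add Q]
      simp [mul_comm]
    have h3 : (w ^ n * aeval w Q).re
        = (w ^ (n + 1) * aeval w Q.divX).re + (Q.coeff 0 : ℝ) * (w ^ n).re := by
      have h4 : w ^ n * aeval w Q
          = w ^ (n + 1) * aeval w Q.divX + ((Q.coeff 0 : ℝ) : ℂ) * w ^ n := by
        rw [h2]; push_cast; ring
      rw [h4, Complex.add_re, Complex.re_ofReal_mul]
    have h5 : - b n ≤ (Q.coeff 0 : ℝ) * (w ^ n).re := by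
      have h6 := hn 0 (by omega)
      have h7 := hb n
      rw [add_zero] at h6
      rcases hQ 0 with h | h
      · rw [h]; simpa using h7
      · rw [h]; simpa using h6
    rw [Finset.sum_range_succ', h3]
    have e1 : ∑ i ∈ Finset.range K, b (n + (i + 1)) = ∑ i ∈ Finset.range K, b (n + 1 + i) :=
      Finset.sum_congr rfl fun i _ => by rw [show n + (i + 1) = n + 1 + i by ring]
    rw [e1, add_zero]
    rw [show n + (K + 1) = n + 1 + K by ring]
    linarith

lemma newman_ne (w : ℂ) (b : ℕ → ℝ) (hw : ‖w‖ ≤ 0.6935) (hb : ∀ n, 0 ≤ b n)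
    (hn : ∀ i < 8, - b (1 + i) ≤ (w ^ (1 + i)).re)
    (hs : ∑ i ∈ Finset.range 8, b (1 + i) < 0.87) (N : ℤ[X]) (hN : IsNewman N) :
    aeval w N ≠ 0 := by
  intro h
  have h1 := newman_re w 0.6935 hw (by norm_num) b hb 8 1 N.divX
    (fun i => by rw [coeff_divX]; exact hN.1 _) hn
  have h2 : aeval w N = w ^ 1 * aeval w N.divX + 1 := by
    conv_lhs => rw [← divX_mul_X_add N, hN.2]
    simp [mul_comm]
  rw [h] at h2
  have h3 : (w ^ 1 * aeval w N.divX).re = -1 := by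
    have := congrArg Complex.re h2
    simp only [Complex.add_re, Complex.zero_re, Complex.one_re] at this
    linarith
  rw [h3] at h1
  norm_num at h1
  linarith

lemma prod_ge (z : ℂ) (ε : ℝ) (hε : 0 ≤ ε) (s : Multiset ℂ) (h : ∀ a ∈ s, ε ≤ ‖z - a‖) :
    ε ^ (Multiset.card s) ≤ ‖(s.map fun a => z - a).prod‖ := by
  induction s using Multiset.induction_on with
  | empty => simp
  | cons a s ih =>
    rw [Multiset.map_cons, Multiset.prod_cons, Multiset.card_cons, pow_succ', norm_mul]
    have h1 := h a (Multiset.mem_cons_self a s)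
    have h2 := ih fun b hb => h b (Multiset.mem_cons_of_mem hb)
    gcongr

lemma exists_near_root (P : ℂ[X]) (hP : P.Monic) (z : ℂ) (ε : ℝ) (hε : 0 ≤ ε)
    (h : ‖P.eval z‖ < ε ^ P.natDegree) : ∃ a, P.eval a = 0 ∧ ‖z - a‖ < ε := by
  by_contra! hc
  have hs := IsAlgClosed.splits P
  have h1 := prod_ge z ε hε P.roots (fun a ha => hc a (isRoot_of_mem_roots ha))
  rw [← hs.natDegree_eq_card_roots] at h1
  have h2 : P.eval z = (P.roots.map fun a => z - a).prod := by
    conv_lhs => rw [hs.eq_prod_roots_of_monic hP]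
    rw [eval_multiset_prod, Multiset.map_map]
    simp
  rw [h2] at h
  linarith

lemma mk_add (a b n : ℝ) : (⟨a, b⟩ : ℂ) + (n : ℂ) = ⟨a + n, b⟩ := by
  apply Complex.ext <;> simp

lemma mk_mul_add (a b c d n : ℝ) :
    (⟨a, b⟩ : ℂ) * ⟨c, d⟩ + (n : ℂ) = ⟨a * c - b * d + n, a * d + b * c⟩ := by
  apply Complex.ext <;> simp

def Pex : ℂ[X] := X ^ 8 - X ^ 7 + X ^ 5 + X ^ 4 + X ^ 3 - X + 1

lemma beta_exists : ∃ a : ℂ, a ^ 8 - a ^ 7 + a ^ 5 + a ^ 4 + a ^ 3 - a + 1 = 0 ∧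
    ‖a - ⟨0.5475, 0.4235⟩‖ ≤ 0.001 := by
  have hm : Pex.Monic := by unfold Pex; monicity!
  have hd : Pex.natDegree = 8 := by unfold Pex; compute_degree!
  have hev : ∀ a : ℂ, Pex.eval a = a ^ 8 - a ^ 7 + a ^ 5 + a ^ 4 + a ^ 3 - a + 1 := by
    intro a; simp [Pex]
  set z : ℂ := ⟨0.547456564490348313469809521388, 0.423529031747509116210349926501⟩ with hz
  obtain ⟨a, ha, hza⟩ := exists_near_root Pex hm z 0.0009 (by norm_num) (by
    rw [hd, hev]
    refine lt_of_le_of_lt (Complex.norm_le_abs_re_add_abs_im _) ?_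
    have e2 : z ^ 8 - z ^ 7 + z ^ 5 + z ^ 4 + z ^ 3 - z + 1 = z * (z * (z * (z * (z * (z * (z *
        (z + (-1 : ℝ)) + (0 : ℝ)) + (1 : ℝ)) + (1 : ℝ)) + (1 : ℝ)) + (0 : ℝ)) + (-1 : ℝ))
        + (1 : ℝ) := by
      push_cast; ring
    rw [e2, hz, mk_add]
    norm_num [abs_of_nonneg, abs_of_neg])
  refine ⟨a, by rw [← hev, ha], ?_⟩
  have h1 : ‖z - ⟨0.5475, 0.4235⟩‖ ≤ 0.0001 := by
    refine (Complex.norm_le_abs_re_add_abs_im _).trans ?_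
    rw [hz, Complex.sub_re, Complex.sub_im]
    norm_num [abs_of_nonneg, abs_of_neg]
  calc ‖a - ⟨0.5475, 0.4235⟩‖ = ‖(z - ⟨0.5475, 0.4235⟩) - (z - a)‖ := by congr 1; ring
    _ ≤ ‖z - ⟨0.5475, 0.4235⟩‖ + ‖z - a‖ := norm_sub_le _ _
    _ ≤ 0.001 := by linarith

lemma pow_near (a c : ℂ) (δ : ℝ) (h : ‖a - c‖ ≤ δ) (ha : ‖a‖ ≤ 1) (hc : ‖c‖ ≤ 1) (n : ℕ) :
    ‖a ^ n - c ^ n‖ ≤ n * δ := by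
  induction n with
  | zero => simp
  | succ n ih =>
    have e : a ^ (n + 1) - c ^ (n + 1) = a * (a ^ n - c ^ n) + (a - c) * c ^ n := by ring
    have h1 : ‖c ^ n‖ ≤ 1 := by rw [norm_pow]; exact pow_le_one₀ (norm_nonneg _) hc
    rw [e]
    calc _ ≤ ‖a * (a ^ n - c ^ n)‖ + ‖(a - c) * c ^ n‖ := norm_add_le _ _
      _ = ‖a‖ * ‖a ^ n - c ^ n‖ + ‖a - c‖ * ‖c ^ n‖ := by rw [norm_mul, norm_mul]
      _ ≤ 1 * (n * δ) + δ * 1 := by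
        have := (norm_nonneg _).trans h
        gcongr
      _ = _ := by push_cast; ring

lemma mk_mul (a b c d : ℝ) : (⟨a, b⟩ : ℂ) * ⟨c, d⟩ = ⟨a * c - b * d, a * d + b * c⟩ := rfl

/-- real parts of the powers of the exceptional root -/
lemma beta_bounds (a : ℂ) (h : ‖a - ⟨0.5475, 0.4235⟩‖ ≤ 0.001) : ‖a‖ ≤ 0.6935 ∧
    |(a ^ 1).re - 0.5475| ≤ 0.001 ∧ |(a ^ 2).re - 0.1204| ≤ 0.003 ∧
    |(a ^ 3).re + 0.1305| ≤ 0.004 ∧ |(a ^ 4).re + 0.2006| ≤ 0.005 ∧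
    |(a ^ 5).re + 0.1571| ≤ 0.006 ∧ |(a ^ 6).re + 0.0760| ≤ 0.007 ∧
    |(a ^ 7).re + 0.00788| ≤ 0.00701 ∧ |(a ^ 8).re - 0.0278| ≤ 0.009 := by
  set c : ℂ := ⟨0.5475, 0.4235⟩ with hc
  have hcn : ‖c‖ ≤ 0.6925 := by
    rw [Complex.norm_def]
    apply Real.sqrt_le_iff.2
    rw [hc, Complex.normSq_mk]
    norm_num
  have han : ‖a‖ ≤ 0.6935 := by
    calc ‖a‖ = ‖(a - c) + c‖ := by congr 1; ring
      _ ≤ ‖a - c‖ + ‖c‖ := norm_add_le _ _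
      _ ≤ _ := by linarith
  have key : ∀ n : ℕ, |(a ^ n).re - (c ^ n).re| ≤ n * 0.001 := fun n => by
    rw [← Complex.sub_re]
    exact (Complex.abs_re_le_norm _).trans (pow_near a c _ h (by linarith) (by linarith) n)
  have c2 : c ^ 2 = ⟨0.12040400, 0.46373250⟩ := by
    rw [pow_two, hc, mk_mul]; norm_num
  have c3 : c ^ 3 = ⟨-0.130469523750, 0.304884637750⟩ := by
    rw [pow_succ, c2, hc, mk_mul]; norm_num
  have c4 : c ^ 4 = ⟨-0.2005507083402500, 0.1116704958600000⟩ := by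
    rw [pow_succ, c3, hc, mk_mul]; norm_num
  have c5 : c ^ 5 = ⟨-0.15709396781299687500, -0.02379362849874587500⟩ := by
    rw [pow_succ, c4, hc, mk_mul]; norm_num
  have c6 : c ^ 6 = ⟨-0.075932345708396911000000, -0.079556306971867543125000⟩ := by
    rw [pow_succ, c5, hc, mk_mul]; norm_num
  have c7 : c ^ 7 = ⟨-0.0078808632727614042590625000, -0.0757144264746035716694375000⟩ := by
    rw [pow_succ, c6, hc, mk_mul]; norm_num
  have c8 : c ^ 8 = ⟨0.02775028697015774377017006250000, -0.04479119409085991019273000000000⟩ := by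
    rw [pow_succ, c7, hc, mk_mul]; norm_num
  have k1 := abs_le.1 (key 1)
  have k2 := abs_le.1 (key 2)
  have k3 := abs_le.1 (key 3)
  have k4 := abs_le.1 (key 4)
  have k5 := abs_le.1 (key 5)
  have k6 := abs_le.1 (key 6)
  have k7 := abs_le.1 (key 7)
  have k8 := abs_le.1 (key 8)
  have c1 : (c ^ 1).re = 0.5475 := by rw [pow_one, hc]
  rw [c1] at k1
  rw [c2] at k2
  rw [c3] at k3
  rw [c4] at k4
  rw [c5] at k5
  rw [c6] at k6
  rw [c7] at k7
  rw [c8] at k8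
  norm_num only at k1 k2 k3 k4 k5 k6 k7 k8
  refine ⟨han, ?_, ?_, ?_, ?_, ?_, ?_, ?_, ?_⟩ <;> rw [abs_le] <;> constructor <;>
    norm_num only <;> linarith

def bb1 (n : ℕ) : ℝ := [0, 0, 0, 0.14, 0.21, 0.17, 0.09, 0.02, 0].getD n 0
def bb2 (n : ℕ) : ℝ := [0, 0.549, 0, 0, 0.207, 0, 0.084, 0, 0].getD n 0

lemma beta_newman (a : ℂ) (h : ‖a - ⟨0.5475, 0.4235⟩‖ ≤ 0.001) (N : ℤ[X]) (hN : IsNewman N) :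
    aeval a N ≠ 0 ∧ aeval (-a) N ≠ 0 := by
  obtain ⟨h0, h1, h2, h3, h4, h5, h6, h7, h8⟩ := beta_bounds a h
  rw [abs_le] at h1 h2 h3 h4 h5 h6 h7 h8
  constructor
  · refine newman_ne a bb1 h0 ?_ ?_ ?_ N hN
    · intro n
      by_cases hn : n < 9
      · interval_cases n <;> norm_num [bb1]
      · obtain ⟨m, rfl⟩ := Nat.exists_eq_add_of_le (not_lt.1 hn)
        rw [Nat.add_comm]; exact le_refl _
    · intro i hi
      interval_cases i <;> norm_num only [bb1, List.getD_cons_succ, List.getD_cons_zero] <;>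
        norm_num only at h1 h2 h3 h4 h5 h6 h7 h8 <;> linarith
    · norm_num [Finset.sum_range_succ, bb1]
  · refine newman_ne (-a) bb2 (by rwa [norm_neg]) ?_ ?_ ?_ N hN
    · intro n
      by_cases hn : n < 9
      · interval_cases n <;> norm_num [bb2]
      · obtain ⟨m, rfl⟩ := Nat.exists_eq_add_of_le (not_lt.1 hn)
        rw [Nat.add_comm]; exact le_refl _
    · have e1 : ((-a) ^ 1).re = - (a ^ 1).re := by rw [← Complex.neg_re]; congr 1; ring
      have e2 : ((-a) ^ 2).re = (a ^ 2).re := by congr 1; ring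
      have e3 : ((-a) ^ 3).re = - (a ^ 3).re := by rw [← Complex.neg_re]; congr 1; ring
      have e4 : ((-a) ^ 4).re = (a ^ 4).re := by congr 1; ring
      have e5 : ((-a) ^ 5).re = - (a ^ 5).re := by rw [← Complex.neg_re]; congr 1; ring
      have e6 : ((-a) ^ 6).re = (a ^ 6).re := by congr 1; ring
      have e7 : ((-a) ^ 7).re = - (a ^ 7).re := by rw [← Complex.neg_re]; congr 1; ring
      have e8 : ((-a) ^ 8).re = (a ^ 8).re := by congr 1; ring
      intro i hi
      interval_cases i <;> norm_num only [bb2, List.getD_cons_succ, List.getD_cons_zero] <;>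
        norm_num only at h1 h2 h3 h4 h5 h6 h7 h8 <;> linarith
    · norm_num [Finset.sum_range_succ, bb2]

/-! ### Symmetries -/

def Pc (c : ℕ) : ℤ[X] := op 1 1 (pl c)

def Good (P : ℤ[X]) : Prop := (∃ N, IsNewman N ∧ P ∣ N) → ∃ L, IsLittlewood L ∧ P ∣ L

lemma Good_neg (P : ℤ[X]) (h : Good (-P)) : Good P := by
  rintro ⟨N, hN, hd⟩
  obtain ⟨L, hL, hl⟩ := h ⟨N, hN, (neg_dvd).2 hd⟩
  exact ⟨L, hL, neg_dvd.1 hl⟩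

lemma newman_reverse (N : ℤ[X]) (hN : IsNewman N) : IsNewman N.reverse := by
  refine ⟨fun i => by rw [coeff_reverse]; exact hN.1 _, ?_⟩
  rw [coeff_zero_reverse]
  have h0 : N ≠ 0 := by
    intro h
    have := hN.2
    rw [h] at this
    simp at this
  rcases hN.1 N.natDegree with h | h
  · exact absurd (leadingCoeff_eq_zero.1 h) h0
  · exact h

lemma littlewood_reverse (L : ℤ[X]) (hL : IsLittlewood L) : IsLittlewood L.reverse := by
  intro i hi
  have hi' := hi.trans L.reverse_natDegree_le
  rw [coeff_reverse, revAt_le hi']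
  exact hL _ (Nat.sub_le _ _)

lemma Good_rev (P R : ℤ[X]) (h1 : P.reverse = R) (h2 : R.reverse = P) (h : Good R) : Good P := by
  have hrev : ∀ A B : ℤ[X], A ∣ B → A.reverse ∣ B.reverse := by
    rintro A B ⟨Q, rfl⟩
    rw [reverse_mul_of_domain]
    exact dvd_mul_right _ _
  rintro ⟨N, hN, hd⟩
  obtain ⟨L, hL, hl⟩ := h ⟨N.reverse, newman_reverse N hN, h1 ▸ hrev _ _ hd⟩
  exact ⟨L.reverse, littlewood_reverse L hL, h2 ▸ hrev _ _ hl⟩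

lemma op_append_one (l : List ℕ) : op 1 1 (l ++ [1]) = op 1 1 l := by
  induction l with
  | nil => simp [op]
  | cons a l ih => simp [op, ih]

/-- remove leading ones -/
def strip (l : List ℕ) : List ℕ :=
  List.rec (motive := fun _ => List ℕ) []
    (fun a l ih => cond (Nat.beq a 1) ih (a :: l)) l

lemma strip_cons (a : ℕ) (l : List ℕ) :
    strip (a :: l) = cond (Nat.beq a 1) (strip l) (a :: l) := rfl

lemma strip_op (l : List ℕ) : op 1 1 (strip l).reverse = op 1 1 l.reverse := by
  induction l with
  | nil => rfl
  | cons a l ih =>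
    rw [strip_cons]
    cases h : Nat.beq a 1
    · rfl
    · rw [cond_true, ih, Nat.eq_of_beq_eq_true h, List.reverse_cons, op_append_one]

lemma strip_suffix (l : List ℕ) : strip l <:+ l := by
  induction l with
  | nil => exact List.suffix_refl _
  | cons a l ih =>
    rw [strip_cons]
    cases h : Nat.beq a 1
    · exact List.suffix_refl _
    · exact ih.trans (List.suffix_cons a l)

lemma strip_head (l : List ℕ) : ∀ a t, strip l = a :: t → a ≠ 1 := by
  induction l with
  | nil => intro a t h; cases h
  | cons b l ih =>
    intro a t h
    rw [strip_cons] at h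
    cases hb : Nat.beq b 1
    · rw [hb, cond_false] at h
      injection h with h1 h2
      subst h1
      exact Nat.ne_of_beq_eq_false hb
    · rw [hb, cond_true] at h
      exact ih a t h

lemma getD_reverse_aux (l : List ℕ) (i : ℕ) (h : i < l.length) :
    l.reverse.getD (l.length - 1 - i) 1 = l.getD i 1 := by
  rw [List.getD_eq_getElem?_getD, List.getD_eq_getElem?_getD,
    List.getElem?_reverse' (j := i) (by omega)]

lemma rev_op (a : ℕ) (t : List ℕ) (ha : a ≠ 1) :
    (op 1 1 (a :: t).reverse).reverse = op 1 1 (a :: t) := by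
  have hc : ∀ i ≤ t.length, (op 1 1 (a :: t).reverse).coeff (t.length - i)
      = (op 1 1 (a :: t)).coeff i := by
    intro i hi
    rw [coeff_op, coeff_op]
    have := getD_reverse_aux (a :: t) i (by simp; omega)
    simp only [List.length_cons, Nat.add_sub_cancel] at this
    rw [this]
  have hz : ∀ l : List ℕ, ∀ i, l.length ≤ i → (op 1 1 l).coeff i = 0 := by
    intro l i hi
    rw [coeff_op, List.getD_eq_getElem?_getD, List.getElem?_eq_none hi]
    simp
  have hd : (op 1 1 (a :: t).reverse).natDegree = t.length := by
    apply le_antisymm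
    · rw [natDegree_le_iff_coeff_eq_zero]
      intro i hi
      exact hz _ _ (by simp; omega)
    · apply le_natDegree_of_ne_zero
      have h1 := hc 0 (Nat.zero_le _)
      rw [Nat.sub_zero] at h1
      rw [h1, coeff_op]
      simp only [List.getD_cons_zero]
      omega
  ext i
  rw [coeff_reverse, hd]
  by_cases hi : i ≤ t.length
  · rw [revAt_le hi, hc i hi]
  · rw [revAt_eq_self_of_lt (by omega), hz _ _ (by simp; omega), hz _ _ (by simp; omega)]

def flip2 (l : List ℕ) : List ℕ :=
  List.rec (motive := fun _ => List ℕ) [] (fun a _ ih => Nat.sub 2 a :: ih) l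

lemma flip2_op (l : List ℕ) (h : ∀ a ∈ l, a < 3) : op 1 1 (flip2 l) = - op 1 1 l := by
  induction l with
  | nil => simp [flip2, op]
  | cons a l ih =>
    have e : flip2 (a :: l) = (2 - a) :: flip2 l := rfl
    have ha := h a List.mem_cons_self
    rw [e, op, op, ih fun b hb => h b (List.mem_cons_of_mem _ hb), neg_add, mul_neg, ← C_neg]
    congr 2
    push_cast [show a ≤ 2 by omega]
    ring

lemma flip2_lt (l : List ℕ) : ∀ a ∈ flip2 l, a < 3 := by
  induction l with
  | nil => intro a h; cases h
  | cons b l ih =>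
    have e : flip2 (b :: l) = (2 - b) :: flip2 l := rfl
    intro a h
    rw [e] at h
    rcases List.mem_cons.1 h with h | h
    · omega
    · exact ih a h

lemma flip2_len (l : List ℕ) : (flip2 l).length = l.length := by
  induction l with
  | nil => rfl
  | cons b l ih =>
    have e : flip2 (b :: l) = (2 - b) :: flip2 l := rfl
    rw [e, List.length_cons, List.length_cons, ih]

/-- code of a list, padded with ones -/
def cd (k : ℕ) (l : List ℕ) : ℕ :=
  Nat.rec (motive := fun _ => List ℕ → ℕ) (fun _ => 0)
    (fun _ ih l => List.rec (motive := fun _ => ℕ) (Nat.add 1 (Nat.mul 3 (ih [])))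
      (fun a l _ => Nat.add a (Nat.mul 3 (ih l))) l) k l

lemma cd_nil (k : ℕ) : cd (k + 1) [] = 1 + 3 * cd k [] := rfl
lemma cd_cons (k a : ℕ) (l : List ℕ) : cd (k + 1) (a :: l) = a + 3 * cd k l := rfl

lemma cd_op (k : ℕ) : ∀ l : List ℕ, l.length ≤ k → (∀ a ∈ l, a < 3) →
    op 1 1 (digs 3 k (cd k l)) = op 1 1 l ∧ cd k l < 3 ^ k := by
  induction k with
  | zero =>
    intro l hl _
    have : l = [] := List.length_eq_zero_iff.1 (by omega)
    subst this
    exact ⟨rfl, by simp [cd]⟩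
  | succ k ih =>
    intro l hl ha
    cases l with
    | nil =>
      obtain ⟨h1, h2⟩ := ih [] (by simp) (by simp)
      rw [cd_nil, digs_succ, show (1 + 3 * cd k []) % 3 = 1 by omega,
        show (1 + 3 * cd k []) / 3 = cd k [] by omega, pow_succ]
      refine ⟨?_, by omega⟩
      simp only [op] at h1 ⊢
      rw [h1]
      simp
    | cons a l =>
      obtain ⟨h1, h2⟩ := ih l (by simpa using hl) (fun b hb => ha b (List.mem_cons_of_mem _ hb))
      have h3 := ha a List.mem_cons_self
      rw [cd_cons, digs_succ, show (a + 3 * cd k l) % 3 = a by omega,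
        show (a + 3 * cd k l) / 3 = cd k l by omega, pow_succ]
      refine ⟨?_, by omega⟩
      rw [op, h1, op]

lemma digs_len (b k x : ℕ) : (digs b k x).length = k := by
  induction k generalizing x with
  | zero => rfl
  | succ k ih => rw [digs_succ, List.length_cons, ih]

lemma pl_len (c : ℕ) : (pl c).length = 9 := by
  rw [pl, List.length_cons, digs_len]

lemma pl_lt (c : ℕ) : ∀ a ∈ pl c, a < 3 := by
  intro a ha
  rcases List.mem_cons.1 ha with h | h
  · omega
  · exact digs_lt 3 8 c (by norm_num) a h

/-- code of the reversed polynomial, up to sign -/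
def rcode (n : ℕ) : ℕ :=
  forceL (strip (pl n).reverse) fun g =>
    cond (Nat.beq (hd g) 2) (cd 8 (tl g)) (cd 8 (tl (flip2 g)))

lemma rcode_good (n : ℕ) (h : Good (Pc (rcode n))) : Good (Pc n) := by
  rw [rcode, forceL_eq] at h
  set g := strip (pl n).reverse with hg
  have hP : Pc n = op 1 1 g.reverse := by
    rw [hg, strip_op, List.reverse_reverse, Pc]
  have hsuf : g <:+ (pl n).reverse := strip_suffix _
  have hlt : ∀ a ∈ g, a < 3 := fun a ha => pl_lt n a (List.mem_reverse.1 (hsuf.subset ha))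
  have hlen : g.length ≤ 9 := by
    have := hsuf.length_le
    rwa [List.length_reverse, pl_len] at this
  have hgne : g ≠ [] := by
    intro h0
    rw [h0] at hP
    have := congrArg (fun p => coeff p 0) hP
    simp [Pc, pl, op] at this
  obtain ⟨a, t, hat⟩ := List.exists_cons_of_ne_nil hgne
  have ha1 : a ≠ 1 := strip_head _ a t (hg ▸ hat)
  have hr1 : (Pc n).reverse = op 1 1 g := by rw [hP, hat]; exact rev_op a t ha1
  -- the reversed list starts with 2
  have hr2 : (op 1 1 g).reverse = Pc n := by
    obtain ⟨s, hs⟩ := hsuf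
    have hh : g.reverse ++ s.reverse = pl n := by
      rw [← List.reverse_append, hs, List.reverse_reverse]
    have hrne : g.reverse ≠ [] := by simpa using hgne
    obtain ⟨b, u, hbu⟩ := List.exists_cons_of_ne_nil hrne
    have hb : b = 2 := by
      rw [hbu, pl, List.cons_append] at hh
      exact (List.cons.inj hh).1
    have := rev_op b u (by omega)
    rw [← hbu, List.reverse_reverse] at this
    rw [this, hP]
  apply Good_rev _ _ hr1 hr2
  have ha3 := hlt a (by rw [hat]; exact List.mem_cons_self)
  have hcode : ∀ u : List ℕ, u.length ≤ 8 → (∀ a ∈ u, a < 3) →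
      Pc (cd 8 u) = op 1 1 (2 :: u) := by
    intro u h1 h2
    rw [Pc, pl, op, (cd_op 8 u h1 h2).1, ← op]
  have hlt' : t.length ≤ 8 := by
    have := hlen
    rw [hat, List.length_cons] at this
    omega
  cases hb : Nat.beq (hd g) 2
  · have ha2 : a ≠ 2 := by
      have := Nat.ne_of_beq_eq_false hb
      rwa [hat] at this
    have ha0 : a = 0 := by omega
    rw [hb, cond_false, hat, ha0] at h
    have e : tl (flip2 (0 :: t)) = flip2 t := rfl
    rw [e, hcode _ (by rw [flip2_len]; exact hlt') (flip2_lt t)] at h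
    have e2 : 2 :: flip2 t = flip2 g := by rw [hat, ha0]; rfl
    rw [e2, flip2_op _ hlt] at h
    exact Good_neg _ h
  · have ha2 : a = 2 := by
      have := Nat.eq_of_beq_eq_true hb
      rwa [hat] at this
    rw [hb, cond_true, hat] at h
    have e : tl (a :: t) = t := rfl
    rw [e, hcode _ hlt' (fun b hb' => hlt b (by rw [hat]; exact List.mem_cons_of_mem _ hb'))] at h
    rw [hat, ha2]
    exact h

lemma exists_code (P : ℤ[X]) (hP : IsBorwein P) (h0 : P.coeff 0 = 1) (hd : P.natDegree ≤ 8) :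
    ∃ c < 6561, P = Pc c := by
  set u : List ℕ := List.ofFn (fun i : Fin 8 => (P.coeff (i + 1) + 1).toNat) with hu
  have hc : ∀ i, P.coeff i = -1 ∨ P.coeff i = 0 ∨ P.coeff i = 1 := fun i => by
    simpa using hP.1 i
  have hul : u.length = 8 := by simp [hu]
  have hlt : ∀ a ∈ u, a < 3 := by
    intro a ha
    rw [hu, List.mem_ofFn] at ha
    obtain ⟨i, rfl⟩ := ha
    rcases hc (i + 1) with h | h | h <;> simp [h]
  obtain ⟨h1, h2⟩ := cd_op 8 u hul.le hlt
  refine ⟨cd 8 u, by simpa using h2, ?_⟩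
  rw [Pc, pl, op, h1, ← op]
  ext i
  rw [coeff_op]
  cases i with
  | zero => simp [h0]
  | succ i =>
    rw [List.getD_cons_succ]
    by_cases hi : i < 8
    · have e : u.getD i 1 = (P.coeff (i + 1) + 1).toNat := by
        rw [List.getD_eq_getElem _ _ (by omega)]
        simp only [hu, List.getElem_ofFn]
      rw [e]
      rcases hc (i + 1) with h | h | h <;> simp [h]
    · rw [List.getD_eq_getElem?_getD, List.getElem?_eq_none (by omega)]
      rw [coeff_eq_zero_of_natDegree_lt (by omega)]
      simp

/-! ### Positive real roots -/

lemma newman_nonneg (y : ℝ) (hy : 0 ≤ y) (Q : ℤ[X]) (hQ : ∀ i, Q.coeff i ∈ ({0, 1} : Set ℤ)) :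
    0 ≤ aeval y Q := by
  rw [aeval_eq_sum_range]
  refine Finset.sum_nonneg fun i _ => ?_
  rw [zsmul_eq_mul]
  have : (0 : ℝ) ≤ (Q.coeff i : ℝ) := by
    rcases hQ i with h | h <;> rw [h] <;> simp
  positivity

lemma newman_pos (y : ℝ) (hy : 0 ≤ y) (N : ℤ[X]) (hN : IsNewman N) : 0 < aeval y N := by
  have h2 : aeval y N = y * aeval y N.divX + 1 := by
    conv_lhs => rw [← divX_mul_X_add N, hN.2]
    simp [mul_comm]
  have := newman_nonneg y hy N.divX (fun i => by rw [coeff_divX]; exact hN.1 _)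
  rw [h2]
  positivity

lemma pos_root (F : ℤ[X]) (h0 : 0 < F.coeff 0) (x : ℝ) (hx : 0 ≤ x) (h : aeval x F ≤ 0)
    (N : ℤ[X]) (hN : IsNewman N) : ¬ F ∣ N := by
  rintro ⟨Q, rfl⟩
  have hc : ContinuousOn (fun y : ℝ => aeval y F) (Set.Icc 0 x) :=
    (Polynomial.continuous_aeval F).continuousOn
  have h1 : (0 : ℝ) ≤ aeval (0 : ℝ) F := by
    rw [← coeff_zero_eq_aeval_zero']
    simp only [eq_intCast]
    exact_mod_cast h0.le
  obtain ⟨y, hy, hy0⟩ := intermediate_value_Icc' hx hc ⟨h, h1⟩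
  have := newman_pos y hy.1 _ hN
  rw [map_mul] at this
  simp only at hy0
  rw [hy0, zero_mul] at this
  exact lt_irrefl _ this

/-- weighted sum -/
def dw (w l : List ℕ) : ℕ :=
  List.rec (motive := fun _ => List ℕ → ℕ) (fun _ => 0)
    (fun a _ ih l => Nat.add (Nat.mul a (hd l)) (ih (tl l))) w l

def geo (x : ℝ) : ℝ → List ℕ → Prop
  | _, [] => True
  | t, a :: w => (a : ℝ) = t ∧ geo x (t * x) w

lemma dw_eval (x : ℝ) (w : List ℕ) : ∀ (t : ℝ) (l : List ℕ), geo x t w → w.length = l.length →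
    t * aeval x (op 1 1 l) = (dw w l : ℝ) - (w.sum : ℝ) := by
  induction w with
  | nil =>
    intro t l _ hl
    have : l = [] := List.length_eq_zero_iff.1 hl.symm
    subst this
    simp [op, dw]
  | cons a w ih =>
    intro t l hg hl
    cases l with
    | nil => simp at hl
    | cons b l =>
      have e : dw (a :: w) (b :: l) = a * b + dw w l := rfl
      obtain ⟨h1, h2⟩ := hg
      have h3 := ih (t * x) l h2 (by simpa using hl)
      have e3 : ((((b : ℤ) - ((1 : ℕ) : ℤ)) : ℤ) : ℝ) = (b : ℝ) - 1 := by push_cast; ring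
      rw [e, op, List.sum_cons, map_add, map_mul, map_pow, aeval_X, aeval_C, Nat.cast_add,
        Nat.cast_mul, Nat.cast_add, h1, eq_intCast, pow_one, e3]
      linear_combination h3

lemma pos_code (c : ℕ) (x t : ℝ) (w : List ℕ) (hx : 0 ≤ x) (ht : 0 < t) (hg : geo x t w)
    (hw : w.length = 9) (h : Nat.ble (dw w (pl c)) w.sum = true) : Good (Pc c) := by
  rintro ⟨N, hN, hd⟩
  refine absurd hd (pos_root (Pc c) ?_ x hx ?_ N hN)
  · simp [Pc, pl, op]
  · have h1 := dw_eval x w t (pl c) hg (by rw [hw, pl_len])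
    have h2 : (dw w (pl c) : ℝ) ≤ w.sum := by exact_mod_cast Nat.le_of_ble_eq_true h
    have h3 : t * aeval x (Pc c) ≤ 0 := by rw [Pc, h1]; linarith
    by_contra! h4
    have := mul_pos ht h4
    linarith

def posChk (c : ℕ) : Bool :=
  forceL (pl c) fun l =>
  cond (Nat.ble (dw [1, 1, 1, 1, 1, 1, 1, 1, 1] l) 9) true <|
  cond (Nat.ble (dw [1, 2, 4, 8, 16, 32, 64, 128, 256] l) 511) true <|
  cond (Nat.ble (dw [65536, 49152, 36864, 27648, 20736, 15552, 11664, 8748, 6561] l) 242461) true <|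
  cond (Nat.ble (dw [6561, 8748, 11664, 15552, 20736, 27648, 36864, 49152, 65536] l) 242461) true <|
  cond (Nat.ble (dw [390625, 312500, 250000, 200000, 160000, 128000, 102400, 81920, 65536] l) 1690981) true <|
  cond (Nat.ble (dw [65536, 81920, 102400, 128000, 160000, 200000, 250000, 312500, 390625] l) 1690981) true <|
  cond (Nat.ble (dw [5764801, 4117715, 2941225, 2100875, 1500625, 1071875, 765625, 546875, 390625] l) 19200241) true <|
  cond (Nat.ble (dw [390625, 546875, 765625, 1071875, 1500625, 2100875, 2941225, 4117715, 5764801] l) 19200241) true <|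
  false

lemma posChk_sound (c : ℕ) (h : posChk c = true) : Good (Pc c) := by
  rw [posChk, forceL_eq] at h
  cases h1 : Nat.ble (dw [1, 1, 1, 1, 1, 1, 1, 1, 1] (pl c)) 9
  swap
  · exact pos_code c (1 / 1) 1 _ (by norm_num) (by norm_num) (by norm_num [geo]) rfl h1
  rw [h1, cond_false] at h
  clear h1
  cases h1 : Nat.ble (dw [1, 2, 4, 8, 16, 32, 64, 128, 256] (pl c)) 511
  swap
  · exact pos_code c (2 / 1) 1 _ (by norm_num) (by norm_num) (by norm_num [geo]) rfl h1
  rw [h1, cond_false] at h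
  clear h1
  cases h1 : Nat.ble (dw [65536, 49152, 36864, 27648, 20736, 15552, 11664, 8748, 6561] (pl c)) 242461
  swap
  · exact pos_code c (3 / 4) 65536 _ (by norm_num) (by norm_num) (by norm_num [geo]) rfl h1
  rw [h1, cond_false] at h
  clear h1
  cases h1 : Nat.ble (dw [6561, 8748, 11664, 15552, 20736, 27648, 36864, 49152, 65536] (pl c)) 242461
  swap
  · exact pos_code c (4 / 3) 6561 _ (by norm_num) (by norm_num) (by norm_num [geo]) rfl h1
  rw [h1, cond_false] at h
  clear h1
  cases h1 : Nat.ble (dw [390625, 312500, 250000, 200000, 160000, 128000, 102400, 81920, 65536] (pl c)) 1690981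
  swap
  · exact pos_code c (4 / 5) 390625 _ (by norm_num) (by norm_num) (by norm_num [geo]) rfl h1
  rw [h1, cond_false] at h
  clear h1
  cases h1 : Nat.ble (dw [65536, 81920, 102400, 128000, 160000, 200000, 250000, 312500, 390625] (pl c)) 1690981
  swap
  · exact pos_code c (5 / 4) 65536 _ (by norm_num) (by norm_num) (by norm_num [geo]) rfl h1
  rw [h1, cond_false] at h
  clear h1
  cases h1 : Nat.ble (dw [5764801, 4117715, 2941225, 2100875, 1500625, 1071875, 765625, 546875, 390625] (pl c)) 19200241
  swap
  · exact pos_code c (5 / 7) 5764801 _ (by norm_num) (by norm_num) (by norm_num [geo]) rfl h1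
  rw [h1, cond_false] at h
  clear h1
  cases h1 : Nat.ble (dw [390625, 546875, 765625, 1071875, 1500625, 2100875, 2941225, 4117715, 5764801] (pl c)) 19200241
  swap
  · exact pos_code c (7 / 5) 390625 _ (by norm_num) (by norm_num) (by norm_num [geo]) rfl h1
  rw [h1, cond_false] at h
  clear h1
  cases h

/-! ### Special codes -/

lemma good_6138 : Good (Pc 6138) := by
  rintro ⟨N, hN, hd⟩
  have h1 : (1 - X ^ 2 - X ^ 3 : ℤ[X]) ∣ Pc 6138 := by
    refine ⟨(1 - X ^ 2 - X ^ 3) * (1 - X + X ^ 2), ?_⟩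
    simp [Pc, pl, op, digs_succ, digs_zero]
    ring
  refine absurd (h1.trans hd) (pos_root _ ?_ 1 zero_le_one ?_ N hN)
  · simp [coeff_X_pow, coeff_one]
  · simp

lemma good_4854 : Good (Pc 4854) := by
  rintro ⟨N, hN, Q, hd⟩
  obtain ⟨a, ha, hn⟩ := beta_exists
  have h1 : aeval a (Pc 4854) = 0 := by
    rw [← ha]
    simp [Pc, pl, op, digs_succ, digs_zero]
    ring
  refine absurd ?_ (beta_newman a hn N hN).1
  rw [hd, map_mul, h1, zero_mul]

lemma good_6134 : Good (Pc 6134) := by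
  rintro ⟨N, hN, Q, hd⟩
  obtain ⟨a, ha, hn⟩ := beta_exists
  have h1 : aeval (-a) (Pc 6134) = 0 := by
    rw [← ha]
    simp [Pc, pl, op, digs_succ, digs_zero]
    ring
  refine absurd ?_ (beta_newman a hn N hN).2
  rw [hd, map_mul, h1, zero_mul]

/-! ### Bit masks -/

def mask (l : List ℕ) : ℕ :=
  List.rec (motive := fun _ => ℕ) 0 (fun a _ ih => Nat.lor (Nat.pow 2 a) ih) l

def bitc (M c : ℕ) : Bool := Nat.beq (Nat.mod (Nat.div M (Nat.pow 2 c)) 2) 1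

lemma mask_sound (l : List ℕ) (c : ℕ) (h : bitc (mask l) c = true) : c ∈ l := by
  have h1 : (mask l).testBit c = true := by
    rw [Nat.testBit_eq_decide_div_mod_eq]
    exact decide_eq_true (Nat.eq_of_beq_eq_true h)
  clear h
  induction l with
  | nil => simp [mask] at h1
  | cons a l ih =>
    have e : mask (a :: l) = 2 ^ a ||| mask l := rfl
    rw [e, Nat.testBit_lor, Bool.or_eq_true] at h1
    rcases h1 with h | h
    · rw [Nat.testBit_two_pow] at h
      have : a = c := by simpa using h
      rw [this]; exact List.mem_cons_self
    · exact List.mem_cons_of_mem _ (ih h)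

def cov (M c : ℕ) : Bool :=
  force c fun c => cond (bitc M c) true (cond (bitc M (rcode c)) true (posChk c))

lemma cov_sound (l : List ℕ) (hl : ∀ c ∈ l, Good (Pc c)) (c : ℕ) (h : cov (mask l) c = true) :
    Good (Pc c) := by
  rw [cov, force_eq] at h
  cases h1 : bitc (mask l) c
  · rw [h1, cond_false] at h
    cases h2 : bitc (mask l) (rcode c)
    · rw [h2, cond_false] at h
      exact posChk_sound c h
    · exact rcode_good c (hl _ (mask_sound l _ h2))
  · exact hl _ (mask_sound l c h1)

def allN (n : ℕ) (p : ℕ → Bool) : Bool :=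
  Nat.rec (motive := fun _ => Bool) true (fun k ih => cond (p k) ih false) n

lemma allN_sound (n : ℕ) (p : ℕ → Bool) (h : allN n p = true) : ∀ k < n, p k = true := by
  induction n with
  | zero => intro k hk; omega
  | succ n ih =>
    have e : allN (n + 1) p = cond (p n) (allN n p) false := rfl
    rw [e] at h
    intro k hk
    cases hp : p n
    · rw [hp] at h; cases h
    · rw [hp, cond_true] at h
      rcases Nat.lt_succ_iff_lt_or_eq.1 hk with h1 | h1
      · exact ih h k h1
      · rw [h1, hp]

def covAll (l : List ℕ) : Bool :=
  force (mask l) fun M => allN 81 fun i => allN 81 fun j => cov M (Nat.add (Nat.mul 81 i) j)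

lemma covAll_sound (l : List ℕ) (hl : ∀ c ∈ l, Good (Pc c)) (h : covAll l = true) :
    ∀ c < 6561, Good (Pc c) := by
  intro c hc
  rw [covAll, force_eq] at h
  have h1 := allN_sound _ _ (allN_sound _ _ h (c / 81) (by omega)) (c % 81) (by omega)
  have e : Nat.add (Nat.mul 81 (c / 81)) (c % 81) = c := Nat.div_add_mod c 81
  rw [e] at h1
  exact cov_sound l hl c h1

lemma borwein_of_codes (hall : ∀ c < 6561, Good (Pc c)) (P : ℤ[X]) (hP : IsBorwein P)
    (hd : P.natDegree ≤ 8) : Good P := by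
  have h0 : P.coeff 0 = -1 ∨ P.coeff 0 = 1 := by
    have h1 := hP.1 0
    have h2 := hP.2
    simp only [Set.mem_insert_iff, Set.mem_singleton_iff] at h1
    rcases h1 with h | h | h
    · exact Or.inl h
    · exact absurd h h2
    · exact Or.inr h
  rcases h0 with h | h
  · apply Good_neg
    obtain ⟨c, hc, e⟩ := exists_code (-P) ⟨fun i => by
        have := hP.1 i
        simp only [Set.mem_insert_iff, Set.mem_singleton_iff, coeff_neg] at this ⊢
        omega, by rw [coeff_neg]; omega⟩ (by rw [coeff_neg]; omega) (by rwa [natDegree_neg])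
    rw [e]; exact hall c hc
  · obtain ⟨c, hc, e⟩ := exists_code P hP h hd
    rw [e]; exact hall c hc

/-! ### Tables -/

/-- pairs (code, bits of a Littlewood multiple) -/
def litTab : List (ℕ × ℕ) := [
  (3280, 3), (3281, 7), (3282, 13), (3283, 31), (3284, 15), (3288, 251), (3289, 127), (3291, 29),
  (3292, 250), (3293, 31), (3300, 53), (3304, 115), (3306, 65494), (3307, 511), (3309, 32565),
  (3310, 127), (3312, 57), (3313, 32251), (3314, 59), (3316, 65514), (3317, 8182), (3318, 61),
  (3319, 32594), (3320, 63), (3342, 3923769798), (3345, 109), (3354, 3992834725),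
  (3358, 4092807987), (3360, 4126707), (3361, 1981), (3363, 534195626), (3367, 8012),
  (3369, 2110233994), (3370, 4290174171), (3372, 4177097949), (3373, 8191), (3376, 3874199381),
  (3377, 115), (3378, 3993402325), (3379, 501771114), (3381, 117), (3382, 3900072679),
  (3384, 4276997398), (3385, 2144282518), (3386, 4116436516), (3387, 501), (3388, 4176810),
  (3389, 511), (3390, 4015507453), (3391, 1996356991), (3393, 121), (3395, 123),
  (3397, 533706130), (3398, 4275437147), (3399, 125), (3400, 4289723218), (3401, 127),
  (3450, 7918), (3462, 213), (3468, 15651384851001368051), (3471, 33554431), (3474, 217),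
  (3477, 7890271773078124518), (3480, 221), (3498, 3796717), (3502, 60891),
  (3504, 17144885850182434669), (3507, 2301020576296102989), (3514, 967), (3516, 63341),
  (3520, 30950), (3522, 18446703390530457190), (3523, 8191), (3525, 9211465285546981101),
  (3528, 64729), (3529, 8426231481256361686), (3531, 536631142), (3532, 1023), (3534, 65389),
  (3538, 64435), (3540, 17916011218923928793), (3541, 7763897202020922956),
  (3543, 2304430510055346901), (3544, 63281), (3546, 3466390), (3547, 499), (3549, 8722479442745),
  (3550, 32716), (3552, 4192565), (3553, 511), (3556, 53529), (3559, 9145600822654917862),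
  (3562, 65380), (3566, 227), (3568, 59189), (3570, 229), (3574, 3923158),
  (3575, 526713607368452), (3577, 9031946924872690570), (3580, 3699120), (3582, 233),
  (3583, 2090965491325757476), (3584, 235), (3585, 8625905642905452277), (3586, 61033),
  (3588, 237), (3589, 2125836766117934362), (3592, 17428067159905070819),
  (3593, 8789182435723129267), (3594, 8101), (3595, 506222261), (3596, 7918),
  (3601, 8654333868019), (3603, 1894201), (3604, 18437454123729936042), (3605, 2029006),
  (3607, 8696049362906), (3612, 7946), (3613, 528389266), (3614, 8016),
  (3615, 8336343708052191341), (3616, 18434832735076740693), (3619, 2195502262098797766),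
  (3620, 243), (3621, 8839751051493951193), (3622, 65269), (3623, 8660256273200686924),
  (3624, 245), (3626, 247), (3628, 4127654), (3629, 32817331), (3631, 9223149797999357557),
  (3632, 18402190547151189964), (3634, 4188490), (3635, 33554431), (3636, 249),
  (3637, 2265846498803561077), (3638, 251), (3640, 65426), (3641, 9213078881437146331),
  (3642, 253), (3643, 2305137935393986026), (3644, 255), (3798, 17326606998591205102212823865),
  (3801, 438325), (3846, 80652911078531920264127104087865), (3849, 1879036930),
  (3855, 36864799665748341662454486241769681350), (3867, 437), (3873, 28405), (3879, 441),
  (3885, 445), (3930, 338529992003366080111342957949275024306),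
  (3948, 316273081639727997450556836607113942485), (3952, 81043904490762433726038326953528),
  (3954, 19477001515706900789693513203), (3957, 166765858180101900277006210064370347583),
  (3960, 339949608920237784367192068675635983014), (3961, 7606), (3963, 143344081960615748),
  (3984, 8740222588293), (3988, 328559776739826551966064849430193527651), (3990, 66427109275),
  (3993, 8502588071245), (4002, 339844483303770096023875519271365680037), (4009, 32767),
  (4011, 2305654820074601325), (4015, 42528634719257933435125387500524993356), (4017, 2143926253),
  (4020, 340095331050385492553810210854463662381), (4027, 33396167), (4029, 8656321494990),
  (4032, 7508208002985), (4033, 169453841091424506669811670690928516595),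
  (4035, 42366909392501096365238597072698068646), (4038, 8759407524778), (4041, 7611752604121),
  (4042, 339543407591992195727930789750313056553), (4044, 68512854133), (4045, 33554431),
  (4054, 334953760833453992593449694434609282915), (4057, 8047),
  (4060, 81086629667968150541216699816092), (4062, 19685425419321879927361320598),
  (4065, 161923797212289011144153108530157166445), (4069, 8155), (4071, 137131777330347366),
  (4072, 338090707574449637539712631320443088347), (4078, 66261594774603994219695724035891),
  (4080, 337587116939137987745043985152492878057),
  (4081, 165275027574570100004623653400350219982), (4083, 38047866647104200126643606),
  (4084, 79819327217596667191248872592687), (4087, 2078953),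
  (4089, 170098244287037118687839184843579804454), (4090, 19801241481590622021553462998),
  (4092, 340198385593452300653445466560184168234), (4093, 1834306),
  (4101, 38449167998981998153102957), (4111, 7960),
  (4117, 42025716168839008530938401647981651754), (4119, 169474235339860606369666198268541389798),
  (4120, 81109094904142833293816250359176), (4126, 335608777444622897300456521559163818619),
  (4129, 8128), (4138, 314260117271289084700671682508036386096),
  (4144, 338598656965379932359220679717252544399), (4153, 8776138079647), (4155, 461),
  (4160, 313825215327879806848473283380212899724), (4162, 8242485378391),
  (4168, 316353501417481854820848370295141756749), (4169, 1995304411),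
  (4170, 75854938767972334683250772879269), (4171, 2140756618724969813),
  (4174, 318248522286170601207534114216776535994),
  (4176, 334876350907246622276563410232666585321),
  (4177, 157633727730991129932304361874048115858), (4179, 39474927557811453708983960047902886986),
  (4180, 8647370700512), (4187, 467), (4191, 469),
  (4192, 311160908273816421669551561278401763136), (4197, 29913),
  (4198, 317238850159130522808876573386351006131),
  (4200, 309082635490573313202143837323554168490), (4203, 473),
  (4204, 313836654809418018718452004749707871756), (4205, 475),
  (4206, 18531358066730315993426386489), (4207, 8240695836703), (4209, 477),
  (4214, 19800990036493058544839062371), (4216, 65411199461), (4217, 495559),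
  (4222, 337239502971661835328949621736387093910), (4225, 2121989365),
  (4228, 338565072449646231403585318998077589967), (4233, 502741),
  (4240, 19722899710591185286325714062), (4241, 25033),
  (4242, 333546401492796363209237163482741133910), (4243, 41826542267051784606618541013944106446),
  (4244, 338599980204650596335575414060872910047), (4245, 29157),
  (4246, 19395958330791343525790182282), (4250, 80903506383999403369219238446307), (4251, 8149),
  (4252, 340171598317740088978597756854462042770), (4253, 8191),
  (4255, 167468641290841734771562263845340691642), (4257, 32473),
  (4258, 19647086967198421655425734924), (4259, 32436),
  (4261, 42482943980937304271272288763152560109), (4263, 32594),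
  (4264, 19787578198392213981060962245), (4272, 18523991317330385976771133173),
  (4273, 134693158022799651), (4276, 332713653487593924453928581615489641894),
  (4277, 38859133910142661676084623518474168214), (4278, 315809163907280125335108272087302601401),
  (4279, 2103352285), (4280, 334624997202969638526544819644484262367),
  (4281, 39291755577720264852728552376501425994), (4282, 316252066780784949998992730898799979434),
  (4285, 144093384656114101), (4288, 68432883626), (4289, 524287), (4291, 141678521586384341),
  (4294, 338903716972805121171662697354291818902), (4295, 483), (4297, 8500759353829),
  (4298, 18857994844797648337728429724), (4299, 485), (4301, 487), (4305, 31717), (4307, 31644),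
  (4311, 489), (4313, 491), (4317, 493), (4321, 169964277727293330519541672172367377893),
  (4322, 334794988818815368551684699716174099379), (4323, 42357330624980980077588539298047298281),
  (4324, 8654333866438), (4325, 42402830180258138429608838241261171793),
  (4328, 332755723359228596245704870824512540551), (4333, 2305378395443017126),
  (4336, 338692771842042923466233009046653675162), (4337, 2078209981), (4342, 8493275098070),
  (4343, 41987406180351152298972356356824012196), (4345, 164462398798050138277510427537462636320),
  (4347, 497), (4349, 499), (4353, 501), (4355, 503), (4357, 38361922509704026615501510),
  (4359, 32582), (4360, 339855553989074712101098103573600377362), (4361, 32716),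
  (4363, 38524288650725032078049106), (4364, 339948416943722960843462788989380283528),
  (4365, 505), (4367, 507), (4369, 8795911220710), (4370, 19806372998088949025921026892),
  (4371, 509), (4372, 340276747100760452195108524606162202621), (4373, 511), (4608, 825),
  (4764, 2233785414875873288), (4770, 3788577429501145), (4800, 56173),
  (4818, 72344883590794617880527781),
  (4824, 368495775808171631746428848302175806792536551148563157410723177254), (4827, 28806674),
  (4842, 7693367489686),
  (4908, 414664587252419501774572136685728893327345849320867012275575455616), (4920, 853),
  (4926, 3752422119259059), (4932, 857), (4956, 260063), (4962, 8795284557004), (4983, 8191),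
  (4998, 7623415889749), (5001, 3065736337724278469212069042157019756279257582353190963209136458),
  (5007, 36226398828784194796809153086296098598), (5010, 244821), (5028, 869),
  (5034, 3852031173223273),
  (5037, 2827601730294866167695005772465601527927751053868832347995521189), (5040, 873),
  (5046, 877),
  (5064, 100355960401763202581142286402191920700393517614120565626697354135341605789781),
  (5073, 1902902529826), (5082, 885), (5094, 889), (5100, 893),
  (5226, 410552501545125828419828496158873730243442219932100253883691677010), (5232, 3997149),
  (5244, 114585965223563233604923944701098176384461674224124584165480693623904497563925),
  (5248, 1843), (5259, 40511425986986270835483285769560723346),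
  (5280, 76122181574923504061865733), (5284, 3897724), (5286, 75859945289056766757018450),
  (5289, 53817607656074383148127930634300104467405139817232928432248340376038941761453),
  (5298, 2092628341),
  (5302, 115196591612345873114592115036347083340636597875985120334719473506314007989916),
  (5307, 141482389531504106), (5310, 1989319446), (5311, 135120386380), (5316, 1942404653),
  (5320, 4181838),
  (5325, 52287790218932377903490862611879390825809989075386662077676087347384446041013),
  (5331, 2304401487097848757),
  (5337, 54072098839807285776208740039770057883109491539186346129925594146559239509689),
  (5338, 3921275), (5388, 18441955526584109645),
  (5392, 115074242023098160399492657964490086285789489075564725751003486970418674922559),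
  (5394, 113491480804024676385341120901605462022320684423380555969424176127170252852885),
  (5404, 260799), (5406, 77275824468519658095881645), (5410, 18373347205683527455),
  (5418, 76853526035513890995944665), (5419, 41106582109546148987979397326184725376),
  (5421, 8744241249170), (5440, 7951), (5442, 65311), (5448, 4497468976747882),
  (5451, 38563454560033310249378221), (5464, 2147480380), (5467, 131071),
  (5475, 38678901550987498137605290), (5484, 4488265362765582),
  (5487, 38560151095804119249939829), (5490, 65305), (5491, 536809267), (5494, 7918),
  (5496, 65514), (5502, 4502478611097574), (5512, 259015), (5518, 18371024006165478755),
  (5530, 261097),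
  (5536, 99487599312143407860181231919472097750837364432646590931563129264150279814499),
  (5544, 18319779887083146510), (5547, 2653181135844658141789688054700239526),
  (5550, 18434037887213982037),
  (5554, 115666221567521150331927998637946734811049411123545529038562712132195201442473),
  (5557, 2017603012344202306), (5563, 36854258573808333834190674119059861205),
  (5572, 15987595581889378105), (5581, 36864799665748341662454481652015398162), (5584, 244966),
  (5596, 4087631),
  (5602, 113938622305794765292356646574233315696182657003532087527719146299390567912688),
  (5622, 2141188918), (5623, 132059738071),
  (5628, 113302596307780072802620596454657746668463504524927951696494477531663864296293),
  (5629, 192276914672000304007611120538460584548569902641382846060), (5631, 140814713006737426),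
  (5646, 77344939537737159249130905), (5647, 42357125551330975760366987614090020787),
  (5650, 4029012), (5655, 2195502262098362254),
  (5656, 110243702444795095209313544230848816154022547780904855530072522009154835434419),
  (5658, 77199602023531803301494122), (5662, 3982963), (5674, 18292740482986409743), (5680, 1987),
  (5682, 414458194712570940361597600991329053161655567428444033663226409558), (5683, 536084431),
  (5686, 1999),
  (5689, 56977280634766747523101252283377415366980965151689525473484500203005648549811),
  (5691, 41811719381997511115238060717942627285), (5692, 18157349177032041673), (5700, 4192709),
  (5704, 114885571138006309643831184714226780397630373630907440678088213803094711399352),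
  (5710, 2147482828), (5712, 420801744990999911211730149748141119316379528851658530394621189418),
  (5718, 4127545),
  (5721, 14247612512446346326686552001450765749611080262420094715297778220484078515538),
  (5727, 42359597241562894860118719219724708630), (5728, 18372222264733576947), (5734, 2035),
  (5736, 420399797913395056753142725771761943574053193345225846711110546630), (5737, 536818444),
  (5740, 2047), (5746, 18410077481549621299),
  (5761, 49669316317575732494412353398070855302880810877841699212806043260175025797526),
  (5763, 2287493083355110166),
  (5764, 94984792557890201765436379599164504016627663130384836475147919610813664755614),
  (5772, 77252305515621731668548409), (5776, 4071450),
  (5790, 114204680647661449828652820990552869523467993837523279873129426920898043439302),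
  (5791, 193824357371141833377771568381945522616333256938800003897),
  (5794, 114844587778856100410770117753649424700806298726406120633999013506408297088565),
  (5799, 1968230515148939013574), (5802, 2143941229), (5803, 137438953471), (5806, 3566809),
  (5818, 99486293085680268454719266704751265914192638839000312401545501970889084518284),
  (5821, 57665569306583052816375937622919754318849506828979234544870454430270977804981),
  (5827, 42241924639758779180561756185215840998), (5830, 4194049), (5856, 909),
  (5872, 413554713994425556676674486958584342325248322916727484037512583103), (5888, 915),
  (5892, 917), (5904, 921),
  (5907, 14097306304150876976510744010863519300974461982212003660040966494918413667949),
  (5908, 75516090371347007010374066), (5910, 925), (5920, 71816928782940255546185007),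
  (5924, 244027), (5926, 61199),
  (5929, 183416591679232815981085589692583498672749721458505267551),
  (5942, 107620182355528479273920391903826152007881149110689653905914670957595665513103),
  (5944, 17081219643209599850),
  (5950, 391082720386768088245012595828613081944669777385915222806133855590), (5951, 7579),
  (5952, 107634173581065732069294647830847273572728886739899128288331332679066073080745),
  (5953, 53811076406872924203543521482978530093579153079013477318604335063272963801045),
  (5955, 7274),
  (5961, 53468070275670962755177675296593130385366394471231309419791655732742589103981),
  (5962, 17244286131809920338), (5976, 243113), (5978, 256740), (5980, 60778), (5982, 230677),
  (5985, 3059578386843010141042208127415499116754725617232492924955761369),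
  (5986, 71910986187801216888992932),
  (5989, 14186870235781655484472453462277357447068722658924752188574225891299219189311),
  (5996, 931), (6000, 933), (6006, 4096419391270309), (6007, 35150268566517369173762204),
  (6009, 3004093585766288335710173974215420515645860863564316932883237930),
  (6010, 104949793672313876961944321240658391520351510902942125930695802063634249186544),
  (6012, 937), (6014, 939), (6016, 71192818468298905600395055), (6018, 941),
  (6033, 182386376147305400440140739702875339224351430299645016889),
  (6034, 393204896226297156668202339914178716852277113245626544504092561127),
  (6037, 13549021683578629668225006144548927055767502974823934197153195234027430034869),
  (6040, 1947342811),
  (6041, 3886540653731055314368390120830587677490860401099821895418932965226047496234012028907718045365131),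
  (6042, 384893494151827010220548845926493518866522391395089168429271867238),
  (6043, 52857366429114178492244742438988427123226008356510255816835127087827561983935),
  (6045, 2052409401901), (6050, 947), (6054, 949), (6061, 36156419295200766340884199),
  (6066, 953), (6068, 955), (6070, 72416728766255003052541888), (6072, 957), (6080, 61895),
  (6082, 76269416433825597302944933), (6086, 8761578676868), (6088, 4503182670412397),
  (6091, 42451680613201826918399887490282747589), (6096, 65101), (6097, 8252149281298),
  (6104, 415900337602159594657678984674156656402624069369762384210107930227),
  (6106, 114887178562524471543235895284366195780052559327885832301315283367915293108949),
  (6107, 33252832), (6109, 2108089078776482757119), (6112, 4187318),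
  (6113, 55901549252021640739639885946221966476663436193050009155481971815753371753552),
  (6118, 4159429), (6121, 2282384599741384965805),
  (6124, 115339744620514489931441631416664964260123200623778001438292247266520968288429),
  (6139, 41988100457342560683408265158110555981), (6140, 8427082015171),
  (6141, 57426334041000514297669123914680071692362775849006614921040801693357116524389),
  (6142, 4463432267721685), (6144, 7856243126866),
  (6147, 13977894097557547373013055230540989059044606600944002426270156033082240530137),
  (6148, 74706176306145304289595355), (6150, 64714), (6151, 8749509708626),
  (6158, 4480392936655260), (6163, 2246942572838320501),
  (6166, 413918262731462883163148983528220492658850584180673947854731140035), (6170, 2113756443),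
  (6181, 2267844500224998853), (6186, 70054749743637228727209385),
  (6187, 2651964152201512986962624557627657699),
  (6190, 104499278970075830008596092786141722117732054735073518434209873711524132338631),
  (6194, 115309004806886584037137733555701996665989517854685346508425880660686962970395),
  (6196, 18445946847605992149),
  (6199, 57741758206948156027026104500108182008850236085849351297311970287772945779413),
  (6201, 195338709421444483501602590635870695107702220061986698518), (6211, 2272414491656666894),
  (6212, 4467429548862707), (6222, 1939662649), (6224, 1993593723527976285),
  (6226, 416860051810605529906010320935425365761082375798800295208428730080),
  (6229, 2302023286482947686), (6230, 4477606429381764),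
  (6231, 56505664463957166242187305124745716765284278282096319862054588011377626165621),
  (6235, 2301020576295982157),
  (6249, 53800593024946683978594567079221053772003663750819556328286640044762741713686),
  (6250, 4185526613275078), (6259, 7798083605028), (6260, 61276), (6269, 560294708324488),
  (6274, 3895529), (6276, 75659314909018474836655270), (6277, 38071083163924509353470777),
  (6278, 75859204924440362622800540),
  (6279, 51104259425681290227947329530129341067613384468082137849535900088925173918133),
  (6280, 3889845), (6285, 32849830),
  (6286, 107649480444749928195556775450539672013314023890382257967421953447557263088164),
  (6287, 31185883), (6289, 2321253182202000920479),
  (6301, 42366909374203721585614692813263221081), (6302, 8605177658404), (6304, 4474828936533802),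
  (6306, 7940000101258), (6307, 38526507515261697082213382150621195957), (6313, 8759040411682),
  (6314, 64435), (6316, 77018692256174554987769605), (6320, 963),
  (6322, 76910226692936671937043034), (6324, 965), (6326, 967),
  (6331, 36847899775933488948243669), (6332, 4228514862437104), (6338, 971), (6342, 973),
  (6346, 2079824473),
  (6349, 57577093337403064699653663694007371882526580329922615746282484704438876207829),
  (6352, 2027228757), (6353, 2123198700151),
  (6361, 14406313308758820822299448829881232281960003106770456989622026868287599045306),
  (6374, 979), (6378, 981), (6380, 983), (6390, 985), (6392, 987), (6396, 989),
  (6401, 3289264472610687352735003616198602622044839267131782477579983004), (6404, 8795284557004),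
  (6407, 3254859730140132677883907776400842489839682686847896515247466744),
  (6409, 194955010535558012068026210131054678329322005553723251621), (6412, 65389),
  (6416, 261360),
  (6421, 13774953244055940497693322359722140645087927753983006670165121352744190974677),
  (6427, 144040936073945961),
  (6429, 57708503403094579183537093189727443115497149068325303904121730843323330634390),
  (6433, 143647756776225771),
  (6434, 115638149882691991525794282843431473272336522766072495795372087912155102308488),
  (6435, 8137), (6436, 419281611431235620560360527488280616372526718767538637354668324665),
  (6437, 8155), (6441, 8173),
  (6442, 421203047021305739864403112106621678767640423233465901648260157605), (6443, 8191),
  (6445, 9881385940569699659332481450949433), (6448, 17562701308113049874),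
  (6449, 57523153103704290276606939043502893321955865987266565157957961793541385481385),
  (6451, 135874337295485061), (6456, 8717168180953), (6462, 261097), (6466, 65194),
  (6467, 42321761940272237400281698607281843596), (6468, 258485), (6470, 261841),
  (6474, 8261873858617),
  (6475, 14409022133933062663577169000934944191111402545623909624886778072736942710340),
  (6476, 8502926373443), (6478, 77325459938792556149376493), (6482, 995), (6486, 997),
  (6488, 999), (6493, 38046722941613361166433686), (6494, 4429679708250467),
  (6497, 3237856577830395616055313529116854522212902417877967058700769560), (6498, 1001),
  (6500, 1003), (6504, 1005), (6506, 1007), (6508, 2130393945), (6509, 2179940598028),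
  (6512, 417752368703220607484279581351739900877279560911150687345092304170),
  (6513, 1986213910726),
  (6523, 14466543754798739663830964091521528101677891789543851229943179406061059973461),
  (6530, 420694170030285807874154647243593395432429648554341943584599098916), (6532, 2147183829),
  (6533, 1923410023426), (6534, 1009),
  (6535, 57217238538682160173111201296377399970345053783349660666939119341032884170553),
  (6536, 1011), (6540, 1013), (6542, 1015),
  (6544, 115311236726486152938941241331878939295046409268117211306329105370464451359430),
  (6548, 4501839336701670),
  (6550, 115557890276745651606752172937879074497975516088949607967561272307246114828040),
  (6552, 1017), (6554, 1019), (6558, 1021), (6560, 1023),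
  (3792, 266412828613936426563145834208572009556), (3828, 16613143548858598089792377170),
  (3840, 334980626564591634824919474870921566909),
  (3936, 305756102862678303323014982903021013631),
  (4000, 256020017705086312760432547789337451056), (4006, 16556616961863401268382200500),
  (4008, 323999242959464379499649906320240181458),
  (4036, 335959937750547643154388880614699143709), (4063, 41622577444338665761850526198490288466),
  (4099, 160090766135491986560139996021332763023),
  (4249, 170079488403673167688349560265686130635), (4334, 76688059507112854261715215668555),
  (4974, 115071260469461190800619884953650721063775920796910169684506892099034258455356),
  (4980, 96210855391077851545692636682211594614284171660874367579809748106511400032826),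
  (4989, 53200864322295424925741878392190436197299814165847722282236173798341241852275),
  (5043, 12524020500187885355625451344709773957295921119449355469401699181934131684851),
  (5250, 381600979820353610219856187477318922382790790810822766706650963691),
  (5256, 93338941926999901230147908949978458123771883857573267101276292579742424889372),
  (5304, 104067229071552785251624999049048798934193110354311173017182318079989887843275),
  (5313, 2068718635130410899208),
  (5329, 57680420526386499292608689607328360493819377405665479523206844424861823872363),
  (5412, 418318989251104433127897805537226282446784217150767224000952106414),
  (5415, 12870074967855320982493204706817483053658618840428368939829730561657730877293),
  (5446, 110243991682048482092902965296854756293053643017348001581544680549534058342639),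
  (5458, 414729801383970922328026038993082035714004587393125511939470035729),
  (5460, 337965302911622873046618375829422076951394051933877274355995345384),
  (5466, 18158772357602246539),
  (5469, 57670718328477116928347916897702289530514691562562654204575924160544740506621),
  (5473, 192312171120630026878043942276118389940073720959437384365),
  (5482, 100269196967417145793400249065721149467012426958115489855949047261396750827576),
  (5485, 57889887733221657871398613675728797419504213889693578814838787510721753739263),
  (5493, 43754379540855174730951891404253640226090194558772793190327131722742571728569),
  (5500, 110952215828106324067587722154119066065330550099473176300350275598431749055587),
  (5521, 43604466250192583210288201550088070527227564074334949342718600537841744818593),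
  (5523, 14387373585221239528061039546766977573070805946478111775359507436474307784631),
  (5529, 8783475117517), (5532, 77283852056610365592967786),
  (5545, 2811043179667933934613195372086382832576753753408789986651698278),
  (5548, 414871232691155511557225119255230899894507405002426403156946744404),
  (5575, 53535623377753669967740466871753955133078569253911732695906488400554953597638),
  (5620, 115759043641122270851822098401392109271314728541967932559880365803486619938583),
  (5649, 54677278081053166377787245344482626081282362861143877286807448943695933959770),
  (5701, 2815655383501618738368023405311729135092446345204823354496007733),
  (5703, 12980258635408790342014894441702879331868747694678654573612539544003859718091),
  (5713, 32444686), (5719, 3099428699279786862625090158168860611831154360178797701675168560),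
  (5730, 113984443860469523110102005895761224779217794681402667086184777542596139433145),
  (5731, 57005187702941449637304591774016207974237848645030542508169816564930801542350),
  (5739, 195398895754639580675573705448097435440607672564852425979),
  (5773, 41311497977392372279586968363200002386), (5793, 144050816037414041),
  (5800, 96757554655635147011735575803675606339094697487725535521551762261927750545176),
  (5881, 51438042941083049929715319570429458599155117240323410239968221793142446806093),
  (5896, 91074937236402518136911757264307704759300696246117967838837879112853389823911),
  (5905, 56204365770532983279231485510700864311559503109106711470503634371649916006612),
  (5969, 2884843093319966510819140674724365929208420708591840390974445454),
  (5977, 171785638745281990155913199055629191711626228008593138531),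
  (6115, 38651575231562547767679361),
  (6160, 371183383029406093495235157794584309264582605563312012005770004385),
  (6161, 56620505981760649713397297570300406878885624430418456312578046028329611319394),
  (6169, 54871920160590106399092996330544207527067390362313492555049361866026540034482),
  (6172, 413434391640421844195116028049574396124140542798582780683652202719),
  (6185, 178268943324104937847936272113138129693292736016910125833),
  (6188, 77076616651027471037837148),
  (6193, 57646463579691865450634147159573418888231250442805406598185499656483034554315),
  (6197, 427522771), (6205, 2637837712593341952619940538858052621),
  (6208, 112966931073854265878104467436987400430819022799903493390390914214037806986874),
  (6220, 414773203232594015275554706986163088478044437561235342710756327601),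
  (6221, 40761546941332117860138793472080251049),
  (6223, 51739664978727068998081970284673813461467241388139496301401676744381427353327),
  (6232, 419805829685977097592063087374402216976441998765348979072088381174),
  (6253, 37851962205478160240231345424407880811),
  (6293, 14256088553480002370727565383691411870001337292003348857747194591943037337038),
  (6305, 45663239997152006314578111103226600987072106880162601721831932333524421490073),
  (6323, 13674424964996948096138629283820535296119082279266918348730413834997585337671),
  (6403, 14445521601671470285315602117862128399178649211507560832170567337154982117556),
  (6413, 35285657794515869535655664891506076521), (6430, 18440133118506319795),
  (6431, 57404842828636498910855424026468643311837452098527850242609799851840162053495),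
  (6439, 54525827940705946866977853967193942664376084551060483967356340165148285470695),
  (6440, 96597723176495270777501380441505158583130245961097595359478176608841412285805),
  (6469, 176913023705055358707632749574939446517204771197899888621),
  (6520, 414705614813325478532090068715109406120727086265631964994701892620),
  (6521, 163272651404933751192314457732137051922102044063361693622),
  (6524, 112817578139689375518253520818527237781513265921439218938614411902353469679104),
  (6529, 55072445306039841917802272700905201069743674834443998430367909518559282245875),
  (6547, 38137421710128798279781357),
  (6551, 3288369047420875342818902374828790702279101235790668482360976675),
  (6556, 76775826863724533901591510),
  (6557, 10902081563051837385926509641597556905913388026562823282213465340718730000292),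
  (6559, 54692700661145530871563655840205446967639828094357711114665717838118096367915)]

set_option maxRecDepth 100000 in
theorem litTab_ok : List.all litTab (fun e => litChk e.1 e.2) = true := by decide +kernel

/-- certificate record -/
structure Cert where
  c : ℕ
  F : ℕ
  O : ℕ
  G : ℕ
  k : ℕ
  e : ℕ
  w : ℕ
  lo : ℕ
  hi : ℕ
  m : ℕ
  j : ℕ
  X : ℕ

def Cert.chk (x : Cert) : Bool :=
  nonChk x.c x.F x.O x.G x.k x.e x.w x.lo x.hi x.m x.j x.X

def nonTab0 : List Cert := [
  ⟨3315, 23325, 5, 365, 3, 5, 13, 1, 2, 9, 2, 17693092732673⟩,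
  ⟨3366, 183005, 5, 14061, 3, 6, 14, 2, 1, 9, 3, 9060179214984959⟩,
  ⟨3394, 187109, 5, 5, 4, 7, 21, 0, 0, 18, 3, 162261135844827534126236128903167⟩,
  ⟨3396, 187165, 5, 14053, 3, 6, 14, 1, 0, 10, 2, 575884047617080833⟩,
  ⟨3555, 1465053, 5, 117613, 7, 10, 139, 2, 4, 134, 4, 1161731959748268017810986326679609812602707064892791037639900394185507471330111471556879486938399259305272839408671951915777651796894389221348124410738490001309022178651565954396050450865738489793302516228437119380173994854252062221039085602985447006572639282421372377552141856800769⟩,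
  ⟨3558, 1465117, 5, 23405, 5, 8, 38, 3, 4, 33, 2, 1725436587300242134585114657812063609140075024398835790807107494739969⟩,
  ⟨3561, 1465181, 5, 5, 3, 6, 14, 1, 1, 10, 2, 592037040355691431425⟩,
  ⟨3571, 1488741, 5, 121565, 7, 10, 139, 2, 2, 134, 2, 1161731959748268017810986326679609812602707064892791037639899841651646017914771982540448635664938066702833076752887066221277754021315434001132021315116869721620056026034133815017666035870547881742484550385848587231996736133107716102054323770053958741676171416505612072677134804451329⟩,
  ⟨3576, 1489181, 5, 45, 4, 7, 20, 1, 3, 16, 4, 2596267534764327601993312751550465⟩,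
  ⟨3467, 1431789, 5, 22365, 4, 7, 23, 1, 2, 18, 2, 42535782719092911835757229873435115521⟩,
  ⟨3597, 1492829, 5, 45, 3, 6, 15, 0, 1, 11, 4, 75668248298544632425473⟩,
  ⟨3542, 1464109, 5, 22365, 5, 8, 38, 3, 3, 33, 2, 1725436587300242134585114657812063609140075024398835790807107494739969⟩,
  ⟨3600, 1493213, 5, 112429, 3, 6, 13, 4, 3, 9, 2, 4638830651000615681⟩,
  ⟨3602, 1493229, 5, 22365, 5, 8, 35, 3, 3, 30, 3, 822752277894464380153134540822203962236361144590854767389966335⟩,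
  ⟨3470, 1431853, 5, 357, 4, 7, 21, 0, 1, 17, 2, 332314607074595484782028778992238593⟩,
  ⟨3609, 182613, 45, 5, 4, 7, 21, 0, 1, 17, 2, 2535281949862286656025852182529⟩,
  ⟨3610, 1493733, 5, 14109, 4, 7, 22, 2, 1, 18, 3, 42535135202089190790733302497276461055⟩,
  ⟨3611, 1493741, 5, 349, 4, 7, 24, 6, 7, 19, 3, 5444507601242190290788792530515667976191⟩,
  ⟨3545, 1464173, 5, 5, 3, 6, 14, 1, 1, 10, 2, 592037040355691431425⟩,
  ⟨3627, 1497309, 5, 45, 2, 5, 10, 3, 4, 6, 2, 2299476522849⟩,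
  ⟨3630, 1497373, 5, 112421, 4, 7, 22, 1, 0, 17, 2, 332314607074595484782028778992238593⟩,
  ⟨3633, 23325, 357, 365, 3, 5, 13, 1, 2, 9, 2, 17693092732673⟩,
  ⟨3639, 1497885, 5, 5, 3, 6, 14, 0, 0, 11, 2, 75668453616950544677889⟩,
  ⟨3852, 11455197, 5, 936157, 5, 8, 40, 2, 0, 36, 3, 248661618215748828070996570708758099158170356722793281084206312001643071012709179850751⟩,
  ⟨3750, 11418461, 5, 181997, 4, 7, 24, 2, 3, 19, 3, 2854511718290585367731408242773902071374282751⟩,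
  ⟨3870, 11458781, 5, 964397, 4, 7, 25, 4, 4, 20, 5, 730752910176158393408934547146513245896407777279⟩,
  ⟨3858, 11455325, 5, 45, 5, 8, 37, 2, 3, 32, 3, 57896044659097990529533598820410786203840173701356121632214099962756742512639⟩,
  ⟨3882, 175445, 365, 5, 4, 7, 24, 1, 2, 20, 3, 664615899959228009363202999627284479⟩,
  ⟨3912, 11647837, 5, 181997, 3, 6, 15, 1, 2, 10, 2, 603880091583684430833153⟩,
  ⟨3939, 11651933, 5, 181997, 3, 6, 15, 2, 3, 10, 2, 603880109689237021414913⟩,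
  ⟨3966, 11656029, 5, 182061, 4, 7, 24, 12, 14, 19, 2, 2854489945681511592264609376121433523118407681⟩,
  ⟨4014, 11684573, 5, 903469, 4, 7, 21, 4, 4, 16, 3, 170148969093958099097879262358874587135⟩,
  ⟨3910, 11647781, 5, 22749, 3, 6, 13, 1, 1, 9, 3, 2374919203107892754687⟩,
  ⟨4026, 11687709, 5, 898797, 5, 8, 36, 4, 1, 31, 4, 226156424186322274506380053856472433958818434688529666821336849513569058817⟩,
  ⟨4047, 11688797, 5, 182573, 5, 8, 38, 2, 2, 34, 2, 3794275179907521212566049241093888041113839782017849958872420747310871839443517441⟩,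
  ⟨3814, 11450213, 5, 229, 4, 7, 22, 2, 2, 17, 3, 43557139691699833997764493081157705727999⟩,
  ⟨4068, 11713245, 5, 14621, 4, 7, 24, 1, 0, 20, 3, 730752909608231473484036287958652401235061637119⟩,
  ⟨3868, 11458405, 5, 2789, 4, 7, 22, 1, 2, 17, 2, 43555811021382032425537899203671916609537⟩,
  ⟨4086, 11716829, 5, 932141, 4, 7, 22, 5, 5, 18, 3, 11150500228034898499475208444339865050284031⟩,
  ⟨4095, 11717341, 5, 932077, 3, 6, 16, 2, 1, 11, 3, 154969954980778556644088831⟩,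
  ⟨4096, 11717349, 5, 116509, 3, 6, 14, 2, 1, 10, 3, 606236692493090900429311⟩,
  ⟨4098, 11717405, 5, 23405, 4, 7, 22, 3, 4, 17, 3, 43557139940124764685916025159800286019583⟩,
  ⟨4105, 1435421, 45, 116461, 3, 6, 15, 2, 1, 10, 4, 592029527413875019265⟩,
  ⟨4107, 11720477, 5, 898861, 4, 7, 25, 2, 1, 20, 4, 730750121467405139264254077715243576940081709057⟩,
  ⟨3994, 11680613, 5, 229, 4, 7, 23, 1, 1, 19, 3, 2854511720720609535204732920724172917261467647⟩,
  ⟨3832, 11451237, 5, 22365, 4, 7, 22, 1, 1, 17, 3, 43557140178506135510139989485069578076159⟩,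
  ⟨4113, 1435477, 45, 112493, 5, 8, 41, 9, 9, 34, 2, 220855883135864691980676868806376807091249497686755306221592765670621185⟩,
  ⟨3940, 11651941, 5, 181997, 5, 8, 37, 2, 2, 32, 2, 57896044605178113019793587606267639909582374577977996655978673996119664492545⟩,
  ⟨4116, 179029, 365, 357, 3, 6, 14, 3, 5, 9, 2, 8988741342209281⟩,
  ⟨4122, 11721437, 5, 365, 3, 6, 17, 5, 6, 12, 3, 39643220766374806581029992447⟩,
  ⟨4123, 11721445, 5, 365, 5, 8, 42, 1, 1, 38, 3, 16296287810853745334606795521684223862225835326720634237793078081535165749690653196968525823⟩,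
  ⟨4125, 1435541, 45, 45, 4, 7, 25, 3, 5, 19, 2, 5444549018317086873961192846139005861889⟩,
  ⟨4128, 11721565, 5, 5, 4, 7, 23, 1, 1, 19, 2, 2854489941028991761114319356537269646535688193⟩,
  ⟨4146, 11909469, 5, 181989, 4, 7, 24, 2, 2, 19, 4, 2854489969377550254301615448321299550973984769⟩,
  ⟨4147, 11909477, 5, 181997, 5, 8, 38, 4, 4, 32, 2, 57896044605181097386195508943484851177990178923964720429443471258150798098433⟩,
  ⟨3944, 11654893, 5, 29, 4, 7, 22, 3, 3, 17, 2, 43555811178666263836928863363303801552897⟩,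
  ⟨4152, 11909917, 5, 45, 4, 7, 22, 1, 3, 17, 4, 43555810453555973584379677746759177535489⟩,
  ⟨4156, 11909989, 5, 186093, 4, 7, 24, 1, 1, 19, 2, 2854489941714467247411945004884980255941722113⟩,
  ⟨3818, 11450605, 5, 1431389, 5, 8, 38, 2, 4, 32, 3, 57896044659098006900206013395670413733646283828609849207190341721936405463039⟩,
  ⟨4061, 11712749, 5, 1431389, 7, 10, 122, 8, 9, 116, 3, 1134503866941667986143541334648056498587955512084920286057356634358436524601712705367993277315515500051304764251776991561889392231576115261567211191243575282876154979333068013816463555210013968576770796792449004094889839888978010910817520383736528539282736010468531036886575087615⟩]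

set_option maxRecDepth 100000 in
theorem nonTab0_ok : List.all nonTab0 Cert.chk = true := by decide +kernel

def nonTab1 : List Cert := [
  ⟨3845, 11454701, 5, 1431389, 5, 8, 38, 1, 2, 33, 3, 14821387427552782723491336047514548662728638530435682012745276026844530432016383⟩,
  ⟨3872, 11458797, 5, 121117, 6, 9, 71, 5, 5, 66, 3, 439347050248359021776704439629446207350686437199932630735919516218478626081803938540188681549874198053475590925594681632920558093353166841455383336145861476351⟩,
  ⟨4183, 11914085, 5, 1460005, 8, 11, 251, 3, 3, 245, 2, 52210939214740143335476805131187665393659594978484856277538835312305594078318948587882870436304138130251407745511077783309763718040455620459037176810621008924543525546338192212667026326490212222728288006589943330116720133068674196686721060919468317918813813766735711982698957738413179507578100146927372809261726038348485671490364685741184768785955829794466548016693582230583499217121670535899672035438398999180306938522700207047795920512782588420716509540440151700943028573611610452361030586339956700345194411635911288832453830377406729634201406251719017884913998772169841968974991370223617⟩,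
  ⟨3908, 11647725, 5, 1885, 3, 6, 16, 2, 2, 11, 3, 154968774962855089696750591⟩,
  ⟨3746, 11418349, 5, 1431389, 6, 9, 71, 5, 6, 65, 3, 1716199415032652428885028234835103920447689071476980857408837819909634357582073642365191405439501924321298089770624786325644077170452667576248564724308901887⟩,
  ⟨3989, 11680493, 5, 1431389, 7, 10, 132, 7, 8, 127, 3, 351111940402796075728379920075981393290952080236415329592859605149705470120319750514510267064176763731391584457752616274551581254878799277314965801542299093499864400007743695325061896692576729261548979625239631144717482384900814282874081250805358831341957909907919969303956235035511695597752992164848074751⟩,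
  ⟨4194, 11917533, 5, 903469, 4, 7, 25, 5, 5, 19, 4, 2854490271774243284391959765296357686083584001⟩,
  ⟨3935, 11651821, 5, 14685, 4, 7, 23, 4, 4, 17, 3, 43557140021246665462943221403002544259071⟩,
  ⟨4178, 11913965, 5, 178525, 6, 9, 70, 4, 4, 65, 3, 1716199415032652428885028234832206520907083367724656410377870088570093091939367807934552733557603826937615275785709674114509377093649322455125977952545669119⟩,
  ⟨4097, 11717357, 5, 22365, 5, 8, 39, 19, 20, 34, 3, 3794275180790944718575746432671847992537511176930352224788940358373117045600419839⟩,
  ⟨4124, 11721453, 5, 1464669, 4, 7, 24, 2, 2, 20, 3, 730752909310479615721326687758499833686741483519⟩,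
  ⟨4218, 11941725, 5, 229, 3, 6, 16, 1, 1, 11, 4, 154668235471166058432285697⟩,
  ⟨4219, 11941733, 5, 969437, 6, 9, 67, 2, 2, 62, 4, 102293456496754433415730820474245888693961611138876415563098323578805410977702613260913954025672584090840531662713618747967211852848438688869295063041⟩,
  ⟨4223, 186029, 357, 29, 5, 8, 36, 4, 4, 30, 3, 766247772573774897632758814603014376116905208438587391⟩,
  ⟨4224, 11942173, 5, 903973, 4, 7, 22, 2, 2, 18, 4, 11150330117666421208222463404708293042372609⟩,
  ⟨3839, 11454253, 5, 178973, 4, 7, 25, 1, 2, 21, 3, 187072477197974645658921572977467208514005669773311⟩,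
  ⟨4230, 11942621, 5, 903469, 4, 7, 24, 5, 5, 19, 5, 2854511713645963004854493706842177816846139391⟩,
  ⟨3947, 11654957, 5, 178525, 4, 7, 24, 2, 3, 19, 2, 2854489948838145863028987760053762183619411969⟩,
  ⟨4232, 11942637, 5, 1431389, 6, 9, 81, 4, 5, 75, 5, 2074757784440496479256368686989424380650904347571342219363331396266983343555812485589420951814068395826781539408344273898571505569593547551521254878253975147979170523041427328335871⟩,
  ⟨4028, 11687725, 5, 178525, 4, 7, 22, 2, 3, 17, 2, 43555810519449924126025593820405849587713⟩,
  ⟨3866, 11458349, 5, 178973, 5, 8, 44, 1, 1, 39, 3, 4171849679555793154808245606582239227268470877172697870901696166474530457016008359761860886527⟩,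
  ⟨4237, 1460125, 45, 121565, 6, 9, 70, 2, 2, 65, 2, 46517678354918840998939316299621921398939800666011305517829954969137866780426163309264954933250924875620090738715099918159260654405419009⟩,
  ⟨3848, 11454765, 5, 1885, 4, 7, 23, 1, 1, 18, 3, 11150500213429107441634275548437857224228863⟩,
  ⟨4260, 11946781, 5, 23405, 6, 9, 63, 1, 3, 58, 4, 23817051317718446506888246436603272970279059245715479264705672813830724973911861882233537398676073760768435114391677695859090139330421719041⟩,
  ⟨4267, 11949797, 5, 112357, 4, 7, 25, 2, 0, 20, 4, 730750123523762183111775582124347194367434817537⟩,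
  ⟨4154, 11909933, 5, 22757, 4, 7, 25, 2, 2, 20, 3, 730752909117755528284917974227904305607420149759⟩,
  ⟨4269, 11949853, 5, 899437, 5, 8, 39, 2, 2, 33, 4, 14821387420657806239538837403514314583865870314568122160624744148299537136484353⟩,
  ⟨3992, 11680557, 5, 1431389, 4, 7, 23, 2, 2, 18, 3, 11150500193633754115022332308078919279837183⟩,
  ⟨4271, 11949869, 5, 182621, 5, 8, 43, 2, 3, 38, 4, 16296287810616604592834599737022480169661851710716267922277216417369150628540714417901273089⟩,
  ⟨4275, 11950301, 5, 903469, 6, 9, 73, 9, 9, 67, 4, 112472844863579909569501317050875858496506511875904078909265651375081955142954392363599932878298851576416653154621815017949341107486726635376255598703397895667713⟩,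
  ⟨4284, 11950813, 5, 45, 3, 6, 15, 2, 3, 10, 2, 603874380047474520270337⟩,
  ⟨4286, 11950829, 5, 349, 5, 8, 39, 2, 2, 34, 3, 3794275180790944594468719723127354319129350941589582373168537856861411315804012543⟩,
  ⟨4287, 11950877, 5, 22893, 5, 8, 38, 1, 2, 34, 2, 3794275179907523645573087316013450323213829672288729882957841267680201442334867457⟩,
  ⟨4290, 191269, 349, 14125, 4, 7, 20, 2, 2, 16, 2, 39613493367063614718850138113⟩,
  ⟨4296, 11974429, 5, 14629, 4, 7, 24, 1, 1, 20, 4, 730750121330440712124669588416738345991907311617⟩,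
  ⟨4058, 11712365, 5, 2781, 5, 8, 45, 1, 1, 40, 3, 1067993517963369044500615868641443304808446626591260450071924988362779861223414999502212258856959⟩,
  ⟨4303, 186533, 357, 1757, 4, 7, 22, 2, 0, 17, 3, 2535359184019511744882799083519⟩,
  ⟨4304, 11974893, 5, 1885, 4, 7, 24, 6, 6, 19, 3, 2854511712434827400720625537233988455774289919⟩,
  ⟨4004, 11683693, 5, 29, 3, 6, 14, 3, 3, 9, 2, 2356652987057872694017⟩,
  ⟨4308, 11975005, 5, 45, 4, 7, 27, 0, 1, 23, 4, 12259962864977872278871733133869900200905077957874155521⟩,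
  ⟨4085, 1434981, 45, 22365, 5, 8, 40, 0, 1, 36, 2, 3618502788824099515009585429201689867723430458019716175470849609786651049985⟩,
  ⟨3950, 11655021, 5, 1456869, 4, 7, 26, 6, 7, 21, 2, 187072120446705654151803776426874877695318522068993⟩,
  ⟨4314, 11975453, 5, 365, 3, 6, 16, 1, 2, 11, 5, 154966373933517185302367231⟩,
  ⟨4031, 11687789, 5, 29, 3, 6, 15, 2, 2, 11, 2, 154667867891196324665543681⟩,
  ⟨4316, 11975469, 5, 22365, 6, 9, 78, 10, 11, 73, 5, 31658291388557380359754378546462342683124236608702297419531497751702144580339636933490655366288355552260700327817814604858223883043753167906013613213539172092489267221094203391⟩,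
  ⟨4112, 11720557, 5, 1460973, 5, 8, 44, 1, 2, 40, 2, 1067993517959483706671406637099176292280952295981928059549456813465702623619236088377512587952129⟩,
  ⟨4326, 11978589, 5, 365, 3, 6, 16, 1, 2, 11, 4, 154666618821411210530925569⟩,
  ⟨4067, 11712877, 5, 29, 5, 8, 38, 1, 1, 34, 3, 3794275180790944688031074314234650102584568503810535791506028858127531433766420479⟩,
  ⟨4329, 1464149, 45, 14565, 4, 7, 23, 2, 1, 18, 2, 42535782606438857039613627127734861825⟩,
  ⟨4330, 11978981, 5, 899437, 5, 8, 36, 1, 1, 31, 3, 226156424607569931243238202858752959450380210875335917029327760678268698623⟩,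
  ⟨4331, 11978989, 5, 1829, 4, 7, 23, 1, 1, 19, 3, 2854511718332123781607261055234093062041632767⟩,
  ⟨4332, 11979037, 5, 965477, 9, 12, 472, 5, 6, 466, 2, 868548030157859051277028752571508538813712016011002343038797816812249153796701325878011496522491766095277043672355596109619846911885081271501945525235861073576505040677406543824749958769411112901396041313051624292131212658726550809139249723439835928328334315569096641295446897734392330700988689692827644858215443509939181387759179723044314516886890963196665260603598556432916702925761981584203091334035437533135696483425978063543193732060954468470302622586345025211204995781787375784701371541885521472956014786005141707965716926512331002360077080985907095329466915580453755859194635904599709974440623545252471408807265585321836616724424495199771457807997477208598763686878291817787505810990723167085253058949771681480715019954533458337604901529450285415465800637224703054256787401295428341163848433904934238080919229970912271350711536003086027239633673433155911476930929046307492198089130179207334223333280733491648968965880380428722322150468585312653750318117497531383131003491233881013075260307223131481023687640471036841668191716794948856487016393964497666034373210997607305943497349558466663317957483567461078858203137⟩,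
  ⟨3851, 11454829, 5, 29, 3, 6, 15, 1, 1, 11, 3, 154969291541933059836214271⟩,
  ⟨4338, 11979485, 5, 898861, 3, 6, 17, 3, 2, 12, 3, 39642970545667644543597393919⟩,
  ⟨4339, 11979493, 5, 112413, 4, 7, 25, 3, 2, 20, 3, 730752908942305082204532737647820701455476064255⟩,
  ⟨4340, 11979501, 5, 349, 4, 7, 26, 5, 6, 21, 3, 187072477172794810545693666403904337892137673687039⟩,
  ⟨4341, 1464213, 45, 23405, 6, 9, 70, 2, 5, 64, 2, 363419362147803445333764913235390293676866254314061535495931405561377812828547104813233761894410292524261482787848694944608893855072257⟩,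
  ⟨4344, 11979613, 5, 935789, 5, 8, 43, 2, 2, 37, 4, 63657374259989521973816828919790650881425899487958850579080578190962574213792875413504001⟩,
  ⟨4348, 11982565, 5, 365, 4, 7, 24, 1, 2, 19, 4, 2854489944372487179876266268995000653260783617⟩,
  ⟨4350, 182613, 365, 5, 4, 7, 21, 0, 1, 17, 2, 2535281949862286656025852182529⟩]

set_option maxRecDepth 100000 in
theorem nonTab1_ok : List.all nonTab1 Cert.chk = true := by decide +kernel

def nonTab2 : List Cert := [
  ⟨3995, 11680621, 5, 22813, 4, 7, 23, 1, 2, 19, 3, 2854511719723659065892311592137256326473187327⟩,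
  ⟨4238, 11942765, 5, 22749, 5, 8, 42, 1, 1, 38, 3, 16296287810853745343412129456341824401970365672028665092660690383937512625387878278328483839⟩,
  ⟨4076, 11713389, 5, 22877, 4, 7, 23, 1, 2, 18, 3, 11150500192983262534101481100265404451651583⟩,
  ⟨4356, 11983069, 5, 45, 4, 7, 24, 2, 2, 20, 2, 730750121718647083684977718690135154272664813569⟩,
  ⟨4358, 11983085, 5, 112357, 5, 8, 40, 1, 1, 35, 3, 971334446197673195841891519505971899218074758004209410704433960180903191660441108479⟩,
  ⟨4362, 11983197, 5, 899373, 8, 11, 244, 3, 3, 238, 2, 724572335668862467998274716918067703176059498860817846243293429035836533139716955174515865327310532619277864280523335864717744792462121465148963437799473998195882760946526303088024952380390936313244696159048749962144945597376615268780195918349823831978353814996361175055063396495770569847636215257647551257959922754476874179264273116939360603263469304078571889488317517004452106104214330149551855969272943542886347402060747252457638614390517172813925050491820553702774572682490837577370672924474651866683352547215040045614396362830808062169002941390275042480989907846168577⟩,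
  ⟨4366, 11983589, 5, 365, 2, 5, 10, 1, 2, 6, 3, 147435018393503⟩,
  ⟨4368, 11983645, 5, 365, 3, 6, 16, 2, 2, 11, 2, 154667499999003802937064449⟩,
  ⟨4692, 91347741, 5, 1455917, 4, 7, 23, 3, 4, 18, 4, 2923036723015131473614799212652570907673639124993⟩,
  ⟨4773, 91380509, 5, 45, 6, 9, 70, 2, 3, 65, 4, 63316582777114760724637243626132206536480815464435465876204108976702096371205767462982848101192369755024485725884296420721212926807358188273026646632178958969148647083379523585⟩,
  ⟨4611, 91151133, 5, 1455917, 5, 8, 44, 7, 8, 39, 4, 2293498616002587061083872208756484361978160483585375334550502755070448819121627190145778186951552206372865⟩,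
  ⟨4935, 91609885, 5, 178925, 5, 8, 40, 1, 2, 35, 4, 33374797439178223271813663792411897925826682856943690843391351829930425396899391734863672377345⟩,
  ⟨4986, 91638493, 5, 357, 4, 7, 23, 3, 5, 18, 4, 2923036729310572406177946671490337409625293717505⟩,
  ⟨5004, 91642077, 5, 14061, 4, 7, 25, 3, 1, 20, 4, 766249962804597882049270641578180325362123794214813697⟩,
  ⟨5013, 91642589, 5, 5, 4, 7, 27, 1, 1, 23, 4, 102844071611853072408027670901167710094791922625187831596711937⟩,
  ⟨5016, 91642653, 5, 45, 4, 7, 25, 2, 3, 20, 4, 766249962436617471684191234712671096143703408800956417⟩,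
  ⟨5052, 91670301, 5, 113005, 8, 11, 294, 5, 6, 288, 4, 930505116240366842946708581325500394925502225177898179609179600913386438018773481038148290747857113502844652197827696184936133558444871075035940470962071020913729804521292746003497096988941723794941222592417438746331046148708962453509055549245603731256813754367270866232411369379736040720272744899339340838637629972918335738893430453727910267254333083617771942077708984193794750073228418188884539321092749563727954223189376726866535555138410138728718930667461840365592499204087999656948262865198545553485913900300206091311697193977806768626021362669269543054813834391303315531840739724219444383704261113138524840787438702162819723980058680289072750057042734492032472312773639617603516162452968229259965332769849486605978739473760359553050876629747602272548312864240260642731196417⟩,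
  ⟨4911, 91605853, 5, 181997, 5, 8, 44, 2, 3, 38, 4, 4479489484404497284963986070920398352580904306513844141486265472149738353363399765262263363096478220289⟩,
  ⟨5058, 91670749, 5, 14637, 6, 9, 78, 10, 11, 73, 6, 299004108316488185848962797225339456029731610228753176251176330224358365380892152350072662320571761232558950181572602379846891890477735169987315456890175839474449690141110254100931407318895470575617⟩,
  ⟨4749, 91376477, 5, 1455917, 5, 8, 39, 6, 7, 33, 2, 127314748565369529295404234250878930218471072092454590264351119473241749809413695066865665⟩,
  ⟨5067, 91671261, 5, 365, 5, 8, 46, 3, 4, 41, 4, 601226901190921525395270279470435448483016803715315262899790155122003559467302615412257260410770777992276738049⟩,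
  ⟨4830, 91409245, 5, 1455845, 7, 10, 134, 3, 3, 129, 4, 15660115838168849784840292792116666063207799734699557487706824846630743059895451470438209944427376462709516459400461060747897977610037056662475922265550026361014262094268876650668882560439094905033093200284953845757438931538620757042556874927992345117977821804223583617216930925459605839263962510038505104499895814365015128377252091690386213692243969⟩,
  ⟨4695, 91347805, 5, 112429, 6, 9, 86, 9, 8, 80, 4, 2757826131550993649364370947376383331097228669637828408395396093090955127399128239303291121309314420796762421505218024590693151901142769733734680035171231542275487331523162372251804186758470607861640804717715198574593⟩,
  ⟨5085, 91674845, 5, 112493, 7, 10, 169, 4, 4, 164, 4, 1045306387854636870253908275374199688241601463566283245306996776775115410273787308877519346868755184958528365103510939055309348544058646130107837150592062996619075386353927251884533107504252712999949201427247397210279730402955565314023185706384242728219117079320531897531194714083455153042828389716445117583727152529039592868159374518551536322915830982331792987283453273593835200274575832735059906817796923454853120678972173276736474922977591297⟩,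
  ⟨4776, 91380573, 5, 365, 5, 8, 44, 6, 8, 39, 2, 2293498616002587061591181877982745347010070761806254774952719233927810893908369118606154679768771876356097⟩,
  ⟨5019, 91642717, 5, 365, 5, 8, 44, 3, 4, 39, 4, 2293498616002587061048357664821645154632333872878435403988036118902588717098808852944587090744497112350721⟩,
  ⟨5097, 91675421, 5, 1497965, 6, 9, 88, 2, 3, 83, 4, 370149157595803483760113708983022576840292711919716642339159164995050073193059053475728530660480810615332957005124992444155903382175402186055172613664730582173650445794971748627679713666527356856801582171782189345931213668353⟩,
  ⟨5154, 93178717, 5, 181989, 4, 7, 25, 2, 2, 20, 2, 766249962661009019367755732958687623828707423553060865⟩,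
  ⟨5172, 93182301, 5, 1455917, 6, 9, 72, 1, 2, 67, 4, 16598062275523971834387049989355393615222728758585652196844108297338451235391498680526944106604241916650667629042523213795690763234281281785216441318688337322796780153456380493168641⟩,
  ⟨5178, 93182749, 5, 1455917, 4, 7, 21, 3, 4, 15, 2, 21780065101905834183760949892375231053825⟩,
  ⟨5181, 93182813, 5, 14061, 5, 8, 46, 2, 1, 41, 2, 601226901190921525361425690771806357446008575167910885015125343233063721018343974658975788641362582919847084033⟩,
  ⟨5208, 93207389, 5, 1455853, 5, 8, 40, 1, 1, 35, 2, 33374797439178223366855898596476619268859395067831388815724494812936563847448402439273868951553⟩,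
  ⟨5235, 93211485, 5, 1488621, 4, 7, 24, 3, 4, 19, 2, 1496586239922449209462781227439738317665572555063297⟩,
  ⟨5253, 93215069, 5, 1488685, 5, 8, 39, 1, 2, 34, 4, 65185151254086379885103870470417705765023030785149667641891256843358504796753602306621046785⟩,
  ⟨5262, 93215581, 5, 1488621, 6, 9, 83, 11, 12, 77, 2, 20547405865423334012660524643978985876935609768266423970728104424723737630182282924215161296219278228843822962221905785722705080024431463670511749068607635326898306906770654105314279336969472447211215039496193⟩,
  ⟨5322, 93247261, 5, 15077, 4, 7, 24, 1, 1, 19, 4, 1496586239356248718979914370577090573622597601984513⟩,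
  ⟨5328, 93247709, 5, 14125, 4, 7, 22, 6, 6, 17, 4, 5709121435598331443051222361678993813383348225⟩,
  ⟨5334, 93247837, 5, 22765, 4, 7, 24, 1, 2, 20, 4, 766249962633135265184050411912440558816153719994318849⟩,
  ⟨5340, 93248285, 5, 365, 6, 9, 74, 4, 5, 69, 4, 4351082437154956072487219649160761679808234554709244271790069485087445599527908324962284125479919187822050863826728293580354145430491050206131271868158819574880932258070858675566011219969⟩,
  ⟨5343, 93248349, 5, 14701, 4, 7, 28, 2, 3, 22, 4, 200867399206445490164520093141679198952712842934014162501633⟩,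
  ⟨5370, 93436765, 5, 1459949, 4, 7, 24, 4, 5, 19, 2, 1496586240946082475417294958309666299727649511833601⟩,
  ⟨5397, 93440861, 5, 22245, 5, 8, 41, 1, 1, 36, 2, 17087896288113265523968176069594363809376907365669489722628583671770730249749678276736720102752257⟩,
  ⟨5424, 93444957, 5, 1837, 4, 7, 25, 5, 6, 20, 2, 766249962658221305258739420679892571839258637603700737⟩,
  ⟨5472, 93473501, 5, 23341, 8, 11, 184, 13, 16, 178, 4, 88924832954188089240033628131034728631638469024275679335150377937890532317008738971037974106715013744081236481540087868449041411755119586954471784000525697335412909819207566831381244396595665832851907474731831485263574029367129721628304956111684429875550782121566229662592316468499996683919061143288908014762866685138354116881325847094869158891655414586202057455367709038838034586755847857694377566595096796017679122646453514953865927673529142066385028618416780127688663744789872641⟩,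
  ⟨5478, 93473629, 5, 1460525, 4, 7, 21, 2, 4, 16, 2, 11150883066949304255712283896694304867188737⟩,
  ⟨5499, 93477597, 5, 1497965, 6, 9, 66, 5, 10, 60, 4, 1799565517817278557806838228548660882506180692037310657555198288719609012520315098154198472455635550151471744195981848650337022272653361711296865706983002111737857⟩,
  ⟨5505, 93477725, 5, 1460589, 4, 7, 23, 1, 2, 19, 2, 1496586240162004693656701474037536316264929039220737⟩,
  ⟨5514, 93501277, 5, 936237, 4, 7, 22, 2, 3, 17, 4, 5709121426294379177936204637968295666451152897⟩,
  ⟨5520, 93501725, 5, 1497965, 7, 10, 82, 7, 14, 75, 4, 78382132970517478991171830695779555161709653725599838738210486430008606139864336571998917188331472737546659435890391601633344158152042266226251966894159984910145961677425225393363385925095298558282694657⟩,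
  ⟨5526, 93502173, 5, 903469, 4, 7, 24, 5, 5, 18, 3, 2922992128755683457603884015501772839544940265471⟩,
  ⟨5527, 93502181, 5, 931613, 6, 9, 63, 4, 2, 58, 3, 6864797660130609691164849520874056376568201062454399450662227165746997806303986998692069672687740131695414588551810682744672010298146625514845832180504985599⟩,
  ⟨5538, 93505309, 5, 112941, 4, 7, 23, 3, 3, 18, 4, 2923036721739189413191645796043349510933778923521⟩,
  ⟨5539, 93505317, 5, 112861, 6, 9, 62, 3, 2, 57, 4, 13407807929942597378680095126753751029552411991333502378926351443871877320181900932855437697600512771461734343744756304794467583672700459456996633883967489⟩,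
  ⟨5541, 93505373, 5, 117029, 5, 8, 37, 1, 1, 32, 4, 248661618378581423889290554669399621479269240400494552597411929553564244166854276284417⟩,
  ⟨5553, 11454805, 45, 45, 3, 6, 14, 7, 9, 9, 2, 2356561965099469122817⟩,
  ⟨5556, 93506333, 5, 1493869, 5, 8, 30, 1, 3, 25, 2, 26959949077558496377182600931115595022879514302413841689641016623105⟩,
  ⟨5559, 93506397, 5, 182573, 5, 8, 32, 3, 4, 26, 2, 13803493310646124273354281599332891357661218555872453877117940775518209⟩,
  ⟨5565, 93509405, 5, 14189, 4, 7, 26, 2, 2, 21, 4, 392319419689089970620482789561422092391221047759907848193⟩,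
  ⟨5566, 93509413, 5, 112925, 4, 7, 22, 2, 2, 17, 4, 5709121447566164682828313305963372634544078849⟩,
  ⟨5568, 93509469, 5, 2797, 4, 7, 25, 1, 2, 20, 4, 766249962702824837392027676170512573428106598184124417⟩]

set_option maxRecDepth 100000 in
theorem nonTab2_ok : List.all nonTab2 Cert.chk = true := by decide +kernel

def nonTab3 : List Cert := [
  ⟨5571, 93509853, 5, 14125, 7, 10, 133, 2, 2, 128, 2, 30586163746423534736016196859602863404837560841949746911257094430042028596688519840599918895648275207225357846899978929293743427241635890223196420111569144232671170118849889118776834591933968444522439829031931178935707029774487112113593470638668657358184036693607785641665270318873365570016001572690938679080916467696507497886226196301603525361665⟩,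
  ⟨5574, 93509917, 5, 23405, 5, 8, 39, 3, 4, 33, 4, 127314748565369539472026306814922339526406964729189678583603723318629812557082581849341953⟩,
  ⟨5577, 93509981, 5, 5, 5, 8, 36, 1, 1, 32, 4, 248661618378581459368577596031356243591147269811706791647149897719786648694540438863873⟩,
  ⟨5580, 93510365, 5, 45, 4, 7, 24, 4, 5, 19, 2, 1496586240597649282110557216202571615721871974858753⟩,
  ⟨5583, 93510429, 5, 365, 5, 8, 40, 1, 2, 35, 2, 33374797439178223500401270806927767855453216195149268618867610097368039596434410382238114906113⟩,
  ⟨5586, 93510493, 5, 365, 6, 9, 78, 3, 4, 72, 2, 583992399055640987986440961131846946269598517275122435688768655488248384685055415615735398199061046175686296151279025539020385211352244974930752644269146057905299229620217726419324820572986146817⟩,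
  ⟨4948, 91633509, 5, 121565, 6, 9, 76, 1, 1, 71, 4, 1140610154405548804661742102996204222802049661540148601771347706074083094928341667995415842369723141988867967924086684974119911125547659724066547202424417582390768580031462279105015990580150273⟩,
  ⟨5272, 93239141, 5, 1456861, 4, 7, 23, 3, 3, 18, 2, 2923036728714695953027895483217624833334746677249⟩,
  ⟨4786, 91404133, 5, 1428189, 5, 8, 41, 4, 4, 36, 2, 17087896288113265514465987691058368352450604839639370200431395487139595222069512692862735320350721⟩,
  ⟨5515, 93501285, 5, 1456869, 8, 11, 266, 2, 3, 261, 4, 65830904014680532237061270996101124772158086235237145448469478944828705853215922329313919021363615702155349559872541929587883761150126194348296088932714746590452278129484711244730070731384491761647349732113955381341145314815358188165342518434353786951163850744148458673932454579324190250478278054574337642896105780256325136517735971934054263569325273467889285449219361593010320313480405264372955614794366407702259838193095793675605562434261988659912497061386454533846898381763003039931442358474506027518390085784207820673183067071190016369163751714913565018022617083886425683435527440372884472721834728785890612355236092903482407226683315823036213073576577130030601760024284895282907080311351542847029379073⟩,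
  ⟨5029, 91666277, 5, 121565, 7, 10, 150, 9, 9, 144, 4, 682094244309526058233052550094132709858689918395362005391997555046002674355990687543919239253721190220453147488814284681061654493995718021355566835679417833627797630124035395449455425037319529208161789966783208146213517157393742237832440811024097702867981233172311990218172637048285101292058612286795307278941777169743361639560482422314664516276559742099952263276679454953287761250396143617⟩,
  ⟨5218, 93210469, 5, 1427741, 5, 8, 36, 2, 2, 31, 4, 485667223734901199919578888678456416384234627611186292249151839021129309187169320961⟩,
  ⟨5634, 1496741, 349, 112429, 4, 7, 23, 2, 1, 18, 4, 42535782382765554617328779145180741633⟩,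
  ⟨5299, 93243237, 5, 15133, 6, 9, 69, 1, 1, 64, 2, 123665200736552267050362972404736395639687979204336363890232772067187501709050129840191063933872630657692203136889272504656902234750394078301107974100944346560987816953643009⟩,
  ⟨4813, 91408229, 5, 1428253, 4, 7, 22, 2, 3, 17, 2, 5709121436261784024004355607409333842932989953⟩,
  ⟨5542, 93505381, 5, 1428253, 6, 9, 67, 3, 4, 62, 4, 471745303102692669337074692113800874533148026992131284789520458535758568688438157565949049282266300761936705393812482431144069674631989526318247317444224088256439910401⟩,
  ⟨5640, 22941, 22757, 5, 3, 5, 13, 0, 1, 9, 2, 17697001318145⟩,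
  ⟨5644, 93705957, 5, 932589, 4, 7, 26, 3, 3, 20, 4, 766249962688893173329234844814611308891533973974941697⟩,
  ⟨5652, 93706461, 5, 902893, 4, 7, 26, 5, 2, 20, 4, 766249962320947078397784822163395295438873395518242817⟩,
  ⟨5245, 93214565, 5, 1424157, 5, 8, 41, 1, 1, 37, 4, 8749002899323019825787239004286720073362369944683214415623244533973105087416107599102140234592157697⟩,
  ⟨5661, 93706973, 5, 5, 5, 8, 46, 1, 1, 41, 4, 601226901190921525322594693219986950414044359988739109538234924915827395432109624448394447285087876753733451777⟩,
  ⟨4840, 91412325, 5, 117469, 6, 9, 67, 2, 2, 62, 2, 471745303102692669337074692113740506415872604655584313173475772812717932673989006469683734977997450489625943482807103885313940550707717407610302042208673164444846522369⟩,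
  ⟨5569, 93509477, 5, 1428253, 6, 9, 69, 4, 4, 64, 4, 123665200736552267050362972404737211581571486178864049902039134906295522833414400963289121506307797225359222983497907568925974287882147989117494418803538689778025321136652289⟩,
  ⟨5667, 93707101, 5, 1492781, 7, 10, 141, 4, 5, 135, 4, 282107567413424138126415916172126379762992917645748837497039191620661929645062182748082068015185401715631155053457037481179252594432948389303167129712274905793805584197003590046305464705094113939837356027332296637484844974716478700008192386668869757924552989999545540542967949531002812943950648094793953976158539302233567600721177522620505917611392963849515058593793⟩,
  ⟨5676, 93730653, 5, 112941, 4, 7, 24, 2, 2, 19, 4, 1496586238746551526659415864865675365181201490640897⟩,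
  ⟨5677, 93730661, 5, 121565, 6, 9, 70, 4, 4, 64, 4, 123665200736552267050362972404624633664111318297798612993302592561168478808357275144002137599943412002548351616578499127912375260866060434569546275272554870386200584109686785⟩,
  ⟨4957, 91634021, 5, 229, 5, 8, 39, 1, 1, 34, 4, 65185151254086381374114242179351913990841210172907170355655653561259172743634579562797465601⟩,
  ⟨5688, 93731549, 5, 903405, 6, 9, 66, 3, 2, 61, 4, 921377545122446620398349729632771039077954589134110092834325864992836998620849141354148003331905143767523082182619341388305578624373280682018715786641661808542220289⟩,
  ⟨5038, 91666789, 5, 121565, 6, 9, 74, 2, 2, 69, 4, 4351082437154956072487219649160755859935484002905149639308726574672775272177448277612128878285423149488842561818412759589105280408486602085994829553358625140332621562445017525673625911297⟩,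
  ⟨5698, 93734629, 5, 899437, 5, 8, 35, 2, 2, 30, 4, 948568797682370528149712235488503583870112107477350317035763787899916378796195841⟩,
  ⟨5707, 93735141, 5, 932133, 5, 8, 34, 1, 0, 31, 4, 485667223734901553768806520832787841606527579050307547552250065876602556117640282113⟩,
  ⟨5709, 93735197, 5, 23405, 7, 10, 94, 3, 5, 89, 2, 6668014432879854274079851823039532776257965182642687176467292323456324992731563590786765749118184982524127154413730426107171173933069333232117927380538213538360342822243885476663885305444144963266974267156817479382199670051784916366864154625⟩,
  ⟨5715, 93735645, 5, 45, 4, 7, 24, 3, 4, 19, 4, 1496586240619437220156461121170982795072458143301633⟩,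
  ⟨5716, 93735653, 5, 22885, 6, 9, 64, 1, 2, 59, 4, 3514776401986872192362228621020523442629399890257342995801507270259831653113008665435134633288624787296835632263681123232417907077810880008757238508331387060225⟩,
  ⟨5725, 93738725, 5, 112485, 4, 7, 24, 2, 1, 19, 4, 1496586239094913938416449545692730806744272520609793⟩,
  ⟨5733, 93739229, 5, 112429, 4, 7, 25, 3, 2, 20, 4, 766249962621984568164795258772844843920136432499818497⟩,
  ⟨5742, 93739741, 5, 365, 4, 7, 27, 4, 5, 22, 4, 200867399202426330738757592487577696411093372617527373332481⟩,
  ⟨5743, 93739749, 5, 357, 4, 7, 24, 1, 1, 19, 4, 1496586239094913938416449545692730806744272520609793⟩,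
  ⟨5745, 93739805, 5, 1497965, 6, 9, 72, 4, 5, 67, 4, 16598062275523971834387049989355380934241121485087369201820535050675101906028261513276537702827243030411467369162621471266107483144704562595005876769540721313738863529154774204153857⟩,
  ⟨5748, 93739869, 5, 1497453, 5, 8, 37, 2, 3, 32, 2, 248661618378581462765534234147130412447211166117083055142065420635324914356970131030017⟩,
  ⟨5752, 93763301, 5, 899437, 4, 7, 23, 4, 4, 18, 6, 2923036747794206172935678845340657801673801596929⟩,
  ⟨5754, 93763357, 5, 112941, 4, 7, 25, 5, 5, 20, 4, 766249963034574837714271238362658698403199986018287617⟩,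
  ⟨5371, 93436773, 5, 1455845, 8, 11, 266, 3, 2, 261, 4, 65830904014680532237061270996101124772158086235237145448469478944828705853215922329313919021363615702155349559872541929587883761150126194348296088932714746590452278129484711244730070731384491761647349732113955381341145314815358188165342518434353786951163850744148458673932454579324190250478278054574337642896105780256325136517735971934054263569325273467889285449219361593010320313480405264372955614794366407702259838193095793675605562434261988659912497061386454533846898381763003039931442358474506027518390085784207820673183067071190016369163751714913565018022617083886425683435527440372884472721834728785890612355236092903482407226683315823036213073576577130030601760024284895282907080311351542847029379073⟩,
  ⟨5757, 93763421, 5, 5, 4, 7, 27, 1, 1, 23, 4, 102844071613457804941161380618360238321795674031271356563193857⟩,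
  ⟨5758, 93763429, 5, 22757, 5, 8, 46, 1, 2, 41, 4, 601226901190921525320012591093687449057477740903958705378556442642416261301153013191777493951956463728073900033⟩,
  ⟨4966, 91634533, 5, 15077, 5, 8, 40, 1, 1, 35, 4, 33374797439178223378785650164901484471724600829928103236909492325338952232857881690207856623617⟩,
  ⟨5695, 93731685, 5, 186093, 6, 9, 70, 4, 4, 64, 4, 123665200736552267050362972404624633664111318297798612993302592561168478808357275144002137599943412002548351616578499127912375260866060434569546275272554870386200584109686785⟩,
  ⟨5769, 11483477, 45, 932133, 4, 7, 23, 4, 3, 17, 3, 43557139823496848763705017760337992941567⟩,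
  ⟨5770, 93764325, 5, 932197, 5, 8, 40, 1, 1, 35, 3, 33374797435292885551421010180105694328984107414104769818695132181023945456332443979097133023231⟩,
  ⟨5047, 91667301, 5, 1432293, 4, 7, 22, 2, 3, 17, 4, 5709121424298098452284896943769944444002172929⟩,
  ⟨5779, 93767397, 5, 365, 6, 9, 69, 1, 2, 64, 6, 123665200736552267050362972408412414701607673374056483021655237342956409788175650544243460520217807489679616497986360265731307382986619703833629226295880336123241940949925889⟩,
  ⟨5781, 93767453, 5, 112493, 5, 8, 42, 2, 2, 37, 4, 8749002899323019830267004357173500034312728755241844718595740087081730076794356506782801146650034177⟩,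
  ⟨5398, 93440869, 5, 1492781, 6, 9, 67, 3, 4, 62, 4, 471745303102692669337074692113800874533148026992131284789520458535758568688438157565949049282266300761936705393812482431144069674631989526318247317444224088256439910401⟩,
  ⟨5784, 93767517, 5, 45, 4, 7, 25, 1, 1, 20, 4, 766249962750218720753999556877662113946779168605208577⟩,
  ⟨5785, 93767525, 5, 1460957, 4, 7, 25, 2, 3, 20, 4, 766249962906342110383529661672014248643399801018777601⟩,
  ⟨5787, 93767901, 5, 1497965, 7, 10, 139, 46, 48, 132, 4, 2101865168015838698494552941412675229930348187386776136104554447182525326035053451115557197676232194497731776933629623633545938042793304281657067883669202690535969410238864499734788324213224104323860410547160386009199501366439908681296874365235159873189908797263813207260825888242601139701182848434920357971790355859003263998977167866289229711362491273969665⟩,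
  ⟨5236, 93211493, 5, 1455917, 5, 8, 36, 2, 3, 31, 4, 485667223734901199919578888678456416384234627611186292249151839021129309187169320961⟩,
  ⟨5796, 93768413, 5, 45, 5, 8, 43, 2, 3, 38, 4, 4479489484404497284802847946787472979400394826534575511325929307240044364770805743090714829024751779841⟩,
  ⟨5797, 11483933, 45, 22885, 4, 7, 22, 1, 2, 17, 3, 43557139559865216607155855013249812725759⟩,
  ⟨5805, 93771485, 5, 365, 7, 10, 147, 28, 30, 140, 4, 9925777620949172098088493659366689241996082925073723810070960837287441969215410862203600209471432497108768698587251634454062833200053236834555611954654168081423732957367551689006081188104600290105725126847605110592566250456569090088315124929441820299342952135130671264708864287242103082135566061487724530390819372353519237811994377243976405921908118507625335258277927659887394817⟩]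

set_option maxRecDepth 100000 in
theorem nonTab3_ok : List.all nonTab3 Cert.chk = true := by decide +kernel

def nonTab4 : List Cert := [
  ⟨5808, 93771549, 5, 365, 4, 7, 25, 3, 5, 21, 4, 392319419631644765338147470151891574372843085569157234689⟩,
  ⟨5425, 93444965, 5, 1492781, 6, 9, 69, 3, 4, 64, 4, 123665200736552267050362972404737211581571486178864049902039134906295522833414400963289121506307797225359222983497907568925974287882147989117494418803538689778025321136652289⟩,
  ⟨5811, 93771613, 5, 2861, 4, 7, 26, 1, 2, 21, 4, 392319419658760942607174862793776523516083798362385547265⟩,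
  ⟨5812, 93771621, 5, 1460509, 5, 8, 43, 1, 1, 38, 4, 4479489484404497284167781165740534419852512113320630597019818890176667676943583585492511342233345064961⟩,
  ⟨5814, 93771997, 5, 1497965, 5, 8, 44, 11, 14, 39, 4, 2293498616002587061319071623762610444841308224916251993688032595966945602571147203407366789890085866176513⟩,
  ⟨5815, 93772005, 5, 365, 5, 8, 41, 1, 1, 37, 4, 8749002899323019822252340651834528823784634984674554053721168595401540880829886052278874806276849665⟩,
  ⟨5817, 93772061, 5, 1497965, 6, 9, 72, 3, 4, 67, 2, 16598062275523971834387049989355349366278371913159060684599768645424963756978199202755024706938216568759584812929707440615031278282659815989475545647172190493738145912956141977993217⟩,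
  ⟨5820, 93772125, 5, 932717, 6, 9, 66, 4, 5, 60, 4, 1799565517817278557806838228547679503649465538841192336240375203256174571557059012854139641643007053223797232539597326320343595901187058024728047548729148221423617⟩,
  ⟨5823, 93772509, 5, 45, 5, 8, 48, 1, 1, 44, 4, 80695308690229654418449932287072177848770917576696230648957500449585218641183135246554402440570150996638544627295584257⟩,
  ⟨5824, 93772517, 5, 365, 5, 8, 44, 1, 1, 40, 4, 1174271291390120594522746697227143618043903042497038505913536916285962150223777085912218680258281822366990337⟩,
  ⟨5826, 93772573, 5, 117613, 6, 9, 79, 3, 3, 74, 2, 153090103458041951154644638611587649724346060593917877897970638257733764966594202642883249036260890109798026810002033512598016930221229737947690348480371219108649720351753492112594251298983031890509825⟩,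
  ⟨5829, 93772637, 5, 5, 4, 7, 23, 1, 1, 19, 2, 1496586240662913318673996834728006877980983514890241⟩,
  ⟨5848, 95271269, 5, 181989, 6, 9, 66, 2, 2, 61, 4, 921377545122446620398349729696026944172679516390055335974538624176046553536278164683474870772604858204967393565988220026553637405204458162476965491112735457302020097⟩,
  ⟨5854, 95271717, 5, 22749, 5, 8, 41, 2, 2, 35, 3, 33374797435293063564174681499087178520057164356700327553552181620408006995108940948584515239935⟩,
  ⟨5857, 11650973, 45, 1829, 5, 8, 40, 1, 1, 36, 2, 248661618201274888360295945307138932915433220021716484702427923793984787160028212625409⟩,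
  ⟨5618, 93701869, 5, 1885, 5, 8, 43, 4, 4, 38, 4, 4479489484404497284802847946787472979400394826534575511325929307240044364770805743090714829024751779841⟩,
  ⟨5874, 95275357, 5, 1488621, 7, 10, 137, 3, 4, 131, 6, 4105205406280934957997173713696631308459973324941694806147560682407005646334984204929092608952408870018987665557179624540552293856048601418846319160331054912700466452744960353073366262680600001130608227000283204680397789109196258065480968576930679349987692017278955017029447511972934482384314177278909924325462741474854849633677531718939445178350520238081⟩,
  ⟨5699, 93734637, 5, 1821, 5, 8, 41, 2, 2, 36, 4, 17087896288113265565523064254578785890647784552391212667232255249403301712732092653971983986327553⟩,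
  ⟨5294, 93243117, 5, 2781, 6, 9, 68, 3, 3, 62, 3, 471745303102692668927900866128272826647413130895885087219675682687239993847565270239742230173560051084754747077480507236404095261752510751390091747491345497536994476031⟩,
  ⟨5880, 95275805, 5, 181989, 6, 9, 67, 1, 1, 62, 4, 471745303102692669337074692114338911087292531385834128008322646152090328120670548092804198836397638263597720924528168013228976955194929597298683688487235378374363840513⟩,
  ⟨5883, 95275869, 5, 1488621, 5, 8, 45, 3, 4, 39, 2, 2293498616002587060550305928352268421267894549490259816729399334047869481492617777154528419112224603242497⟩,
  ⟨5884, 1452893, 365, 22757, 4, 7, 22, 1, 2, 18, 2, 42535782747559558205524116159061164033⟩,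
  ⟨5402, 93443821, 5, 178461, 5, 8, 42, 2, 2, 36, 2, 17087896288113265559950569767606847780152221658513735958011043875112565160441688676550528328531969⟩,
  ⟨5645, 93705965, 5, 1885, 5, 8, 49, 1, 1, 44, 4, 80695308690229654418449932287072177848770917576696230648957500449585218641183135246554402440570150996638544627295584257⟩,
  ⟨4754, 91379437, 5, 120669, 5, 8, 39, 2, 2, 34, 2, 65185151254086380203577948965646682373732705046262893758549809241017845502877520400094330881⟩,
  ⟨5483, 93476589, 5, 1460061, 6, 9, 66, 5, 6, 60, 4, 1799565517817278557806838228548660882506180692037310657555198288719609012520315098154198472455635550151471744195981848650337022272653361711296865706983002111737857⟩,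
  ⟨4997, 91641581, 5, 969437, 7, 10, 152, 6, 6, 147, 2, 91549139753101516292836007778240678447716551127366702613783396477065712686574728739717881666964473233398445300234159625954709603974705048180956639991124681570491805681734319072663071656726363437913979294789294688080809510492082900170067034139100256246131060872786594396250147097947880979000343021960046384319078751725120403058893055105421378911970750698308760557231097474718419055476083811632021505⟩,
  ⟨5726, 93738733, 5, 349, 5, 8, 48, 1, 1, 43, 4, 157608024785631670722915531226869605261863584206592270072576801453358751430073422229290686979249930263337164364316673⟩,
  ⟨5911, 95279973, 5, 14125, 5, 8, 46, 1, 1, 41, 4, 601226901190921525360094605148004516476677165469067238875277381966052302862997394237273256260083496395024105473⟩,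
  ⟨4952, 91633901, 5, 968989, 6, 9, 70, 4, 4, 65, 4, 63316582777114760724637243626118571056712623505232834553545728186620217241826142221558874436182364640607955800219811563699514925213183214520145850549232457840937463810459959297⟩,
  ⟨5276, 93239533, 5, 120669, 4, 7, 24, 3, 3, 19, 3, 1496574831261782089301287967094948159427295592579071⟩,
  ⟨4790, 91404525, 5, 29, 4, 7, 24, 3, 3, 19, 3, 1496574821886437190293074670280059457403642758037503⟩,
  ⟨5519, 93501677, 5, 22301, 5, 8, 39, 43, 43, 34, 5, 65185151238909282476545059229527200069766616021559052668049507486984187974461108253597106175⟩,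
  ⟨5033, 11250405, 45, 972573, 7, 10, 146, 8, 8, 139, 3, 27817953874931422193200157252797783625799673735580700462038382268349848586840620743776902937506779143399842953068188431563754776262979309859724948429337884315809516792544440604668654077931258582800347214913935487244839255628686785646161498395235065705848218414050924874787678557385827568813866716983077501191223527866949678553452511231⟩,
  ⟨5762, 93763821, 5, 968989, 5, 8, 42, 7, 7, 37, 5, 8749002899068390320241652013355168178864660995423715310753394028468293291844467444514113043373752319⟩,
  ⟨5946, 95307613, 5, 1773, 4, 7, 24, 1, 1, 19, 6, 1496586249280297459658886189486353226944354970238977⟩,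
  ⟨5627, 93702381, 5, 1431389, 8, 11, 269, 6, 7, 263, 4, 17257176502024413442752189824001933252272609358050006256443583088513176267185424264009999952922069618528643603216447157310057938100783709243866108174658598157627538853428258755202058540216407288986893943291722613741404903953248272287171099782181824662334185782470684509574638578216287044500661588847611176144872239423937161572403745179788036875783041455823921010039012876901101030904074013034575969255466688502542829529849062089701576057886864381856653803167870798167697345342993466100658625352773884104305502801168972731454185045665151517900010749955918708313639008021730236344828564207514030283978647302162098455899433800961675428390439722498918222708513860641038829922360923672467421955296283691677169854971905⟩,
  ⟨5708, 93735149, 5, 116573, 6, 9, 71, 3, 3, 65, 4, 63316582777114760724637243626127603845447233742397159159337031459460200678617988064191684813884794456802292037823407092604170498804069099765072283718117429250468292406580084737⟩,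
  ⟨4574, 91146477, 5, 939869, 5, 8, 39, 13, 13, 33, 3, 127314748506084005294193565990441148299595983718420597340883993464160903804683949698973695⟩,
  ⟨5303, 93243629, 5, 22301, 5, 8, 38, 4, 4, 32, 3, 248661618146999130723735645313911299941840914760118390479683040878729583931780998627327⟩,
  ⟨5964, 95308637, 5, 1492781, 5, 8, 40, 11, 12, 35, 2, 33374797439178076864929706650977100227801187337682904363589406128258889557176334223504278814721⟩,
  ⟨5789, 11483877, 45, 22365, 5, 8, 38, 2, 3, 33, 3, 14821387427552788440184648230355047922462629802044523582401815949149875269009407⟩,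
  ⟨5968, 95311589, 5, 121581, 5, 8, 38, 3, 5, 32, 4, 248661618378581176855536407681652238229310225342077624109186670829853212303474626134017⟩,
  ⟨5970, 1524965, 349, 14125, 3, 6, 15, 2, 2, 10, 4, 592057771878023436801⟩,
  ⟨5411, 93444333, 5, 349, 7, 10, 133, 2, 3, 128, 2, 30586163746423534736016196859602863404837560841949746911257094430042028596688519840599918895648275207225357846899978929293743427241635890223196420111569144232671170118849889118776834591933968444522439829031931178935707029774487112113593470638668657358184036693607785641665270318873365570016001572690938679080916467696507497886226196301603525361665⟩,
  ⟨4925, 91609325, 5, 349, 4, 7, 25, 2, 2, 21, 2, 392319419670000473095863808717135596345507848835581345793⟩,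
  ⟨5654, 93706477, 5, 1431389, 5, 8, 44, 9, 10, 39, 4, 2293498616002587061319071623762610444841308224916251993688032595966945602571147203407366789890085866176513⟩,
  ⟨4763, 91379949, 5, 120669, 5, 8, 37, 2, 2, 32, 2, 248661618378581430656234763404267639267850749250995954893555369688632986932995839492097⟩,
  ⟨5735, 93739245, 5, 349, 4, 7, 25, 2, 3, 20, 4, 766249962621984568164795258772844843920136432499818497⟩,
  ⟨4844, 1399973, 365, 22365, 5, 8, 34, 3, 4, 27, 2, 392318867230690895920592690723721589676351081316962271233⟩,
  ⟨5991, 95312733, 5, 1460077, 5, 8, 45, 5, 6, 39, 4, 2293498616002587059593298706841094158837759047721861018374499953019271120571251671249804604239791328854017⟩,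
  ⟨5992, 95312741, 5, 181989, 4, 7, 25, 2, 2, 20, 4, 766249962715378142448602600265366827451412504566562817⟩,
  ⟨5366, 93436653, 5, 14685, 4, 7, 24, 4, 4, 19, 3, 1496574823051546859088551073016076696205956665311231⟩,
  ⟨5609, 11476197, 45, 1431389, 6, 9, 73, 6, 8, 66, 3, 439347050248359021776704439629274607779685835556166434988393184884287176400205025315192105506197488776005000750915437817252750613603509745928468757564685811711⟩,
  ⟨5204, 93207277, 5, 120669, 5, 8, 42, 6, 6, 36, 3, 17087896287118619988818466091214509465254412684856796438413410693486586559339271779239347659735039⟩,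
  ⟨5933, 95304429, 5, 1431389, 4, 7, 26, 4, 5, 20, 3, 766247064909257108883860369842600330804762420744552447⟩,
  ⟨5285, 93240045, 5, 120669, 5, 8, 41, 26, 26, 35, 3, 33374797435293008344408427727082265778024315823029354446295116233981270670562661307078705938431⟩,
  ⟨4799, 91405037, 5, 22365, 4, 7, 25, 6, 7, 19, 3, 1496574822583344450026857570734206133611161601179647⟩,
  ⟨5771, 93764333, 5, 22365, 5, 8, 43, 5, 6, 38, 3, 4479489484339312133469081783162685513237143483014950871420872480260101747442901484638678157679315124223⟩,
  ⟨5150, 93178605, 5, 29, 4, 7, 25, 3, 3, 21, 3, 392318671381340449769398337557835262063868903610586759167⟩]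

set_option maxRecDepth 100000 in
theorem nonTab4_ok : List.all nonTab4 Cert.chk = true := by decide +kernel

def nonTab5 : List Cert := [
  ⟨5879, 95275757, 5, 29, 4, 7, 27, 7, 7, 22, 3, 200867207666082748493281735979945333302352156739866512588799⟩,
  ⟨6024, 95340317, 5, 112861, 5, 8, 43, 3, 0, 38, 4, 4479489484404491446597041926063972713512745771130736292221455617255151855105832011697285012399954329601⟩,
  ⟨5393, 11447525, 45, 1431389, 5, 8, 39, 1, 2, 34, 3, 3794275180790944900583993909167317234797205201290206479181952078750600839919828991⟩,
  ⟨4907, 91605741, 5, 349, 5, 8, 41, 5, 6, 36, 2, 17087896288113265513756761108493648722337718667238880032154593529915836207384077471465059037216769⟩,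
  ⟨5636, 93702893, 5, 1431389, 7, 10, 139, 6, 7, 132, 4, 2101865168015838698494552941412675229930348187386776136104554789461230949209832735762134194661905124642441609768710720859436548229551612289669217779756576596911521796665591526477046189467898090480160126407087418655008739439210212451648199628313094740976490520584878033135051611848145146128903691382914332659512414367639601947596159189607398483677192017412097⟩,
  ⟨5231, 93211373, 5, 349, 5, 8, 41, 1, 2, 36, 3, 17087896287118619120754122326784255042834356823368477135491494296324135276653705664796093002547199⟩,
  ⟨5960, 95308525, 5, 1431389, 5, 8, 43, 5, 6, 37, 3, 8749002899068448046152498879976915327813191757346839794595580947396807160844195020224896405285634047⟩,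
  ⟨4988, 91638509, 5, 964957, 4, 7, 23, 5, 5, 17, 2, 5709121445567531056563172858944668060368961537⟩,
  ⟨6039, 95341277, 5, 936229, 4, 7, 25, 2, 2, 20, 3, 766247077598396577747575237920619612095820039324172287⟩,
  ⟨5798, 93768429, 5, 5, 5, 8, 42, 1, 1, 37, 3, 8749002899068390324313833320219882660744992833721531921523160543466183622377055459228536010870620159⟩,
  ⟨6049, 11659037, 45, 117021, 4, 7, 24, 1, 0, 20, 4, 730750126390869788473129438555352308622856552449⟩,
  ⟨6051, 95344413, 5, 932133, 4, 7, 28, 2, 1, 23, 4, 102844071611210047295633671950666729606433902947298984291467265⟩,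
  ⟨5420, 93444845, 5, 29, 5, 8, 43, 1, 1, 39, 4, 2293498616002587060598614635597336425422570638891231189703515137982312801643183002303215913242392547819521⟩,
  ⟨5663, 93706989, 5, 349, 8, 11, 285, 10, 10, 279, 4, 384847896017716432571763117027723780984562229001480885305880411937005241854297813541778927195484736024924922617039526250455653063599682262535193529722327227663001658054012978717955242993505587593000052204853389256756196520988401844943042403778011866379484435700403176347726427742074592605583914917759467773509615011655223622929033857449817465361941974701272133421564655972909352660065646231864348896800495519355106224675723390810500342172988430811573251423000817524249022089119246286286318183581921894086202626114312668511812431258680075904587616350663834075760148084268666822713713516225479175170918816881578270384820320664719570686203126332949934079819281064863132641099870548995595491246503132563023790934225474213506456317265847693851814465307651604481⟩,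
  ⟨6057, 11659093, 45, 935725, 4, 7, 27, 7, 7, 21, 4, 187072120902008943675192354570151822996768463781889⟩,
  ⟨5258, 93215469, 5, 940317, 3, 6, 15, 6, 6, 10, 3, 618363801450974110075674111⟩,
  ⟨5987, 95312621, 5, 121117, 5, 8, 41, 4, 4, 35, 3, 33374797435293241750785802505595434200637708888097857165752735277032880416419958582564876189695⟩,
  ⟨4772, 91380461, 5, 29, 5, 8, 43, 2, 2, 38, 4, 4479489484404497285985357543422843385684738134970903826951911882654169906575922224494015951082245586945⟩,
  ⟨5015, 91642605, 5, 349, 4, 7, 24, 3, 3, 18, 2, 2923036724205884491365146776115821603585037565953⟩,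
  ⟨5744, 93739757, 5, 349, 5, 8, 41, 8, 8, 35, 4, 33374797439178223269156335248169631105266437468116088027762044724061828343267193499624497217537⟩,
  ⟨5339, 93248237, 5, 120669, 6, 9, 73, 7, 7, 67, 3, 16598062275523971833937158609902529265809421023574774345939649957645610411534445731635552142025717455184594695701530580783771599131200614589382523346575374258421647655220676682317823⟩,
  ⟨4853, 11222245, 45, 22365, 5, 8, 41, 3, 4, 35, 3, 971334446197673165016732411001307420432045018914415210486088475829339464029934977023⟩,
  ⟨5825, 11484389, 45, 22365, 4, 7, 25, 1, 2, 20, 3, 730752909258633840726017936305073450141406986239⟩,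
  ⟨6090, 95533405, 5, 1773, 5, 8, 45, 1, 1, 40, 4, 1174271291390120594486918054795641052139140631570757317182065333908292504126283163890407458572835900379627521⟩,
  ⟨5270, 93239085, 5, 14685, 4, 7, 25, 2, 2, 20, 3, 766247039958791238235260573498705071438808171465408511⟩,
  ⟨6095, 95533805, 5, 972573, 8, 11, 331, 6, 6, 324, 3, 31800749842360049015103299284790617698890483905547984275644170402206803561656429906225752320496450440442675960316901191798156638762810418094927510579147627852759261941988712727019696843543594058452705638455448468981925235126525172907402309871522302327005489242065031655926198416333756480645508559467812128364677150705995648266443350732220967783332156344169408314701271870885749889588414325462362005412135676150904706298447023608672972612402270124949188266041378340563181028076416288838201418387106615260868082785600383322318628814198679195283794394318711569524612858592827407612846402701872260192680073887146844967502886940072805496633776325906622692490238023478513435511996625346230660374345473418501480683908033978326856252753493887226297006553958636350905372877161644100216811434377459877527738406650822579405895975044846060114108609929397167866613915653541921954990716354559⟩,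
  ⟨6099, 95533917, 5, 186085, 5, 8, 47, 2, 2, 42, 4, 307828173409541844915432510534175623994254185999918436583616056163833519718513046134823609826749302913647807299585⟩,
  ⟨6100, 95533925, 5, 1492717, 5, 8, 41, 3, 4, 36, 2, 17087896288113265514465987691058368352450604839639370200431395487139595222069512692862735320350721⟩,
  ⟨4892, 91604781, 5, 940381, 9, 12, 518, 7, 8, 512, 2, 7001482763077572417277652726342607186433041444455607409705049281583182196715169852477158423380441208710302002294402586354834475239721865900551271264370058084838471841759533911398761601198371184785855064791363122325737098274674015815437688917112130925431342460076628184616327609432902966945130279686119079936110071913303347063506107554254930329547549949135432333029744935956948516348616446223682461630324020481494094344488491170355157051423808688055145970887763194450459346065215524863125934283478399460017354367776080358897687982408802849075109984364881421739264837860788232979484936546113557729896568497216076979643968625065820925701629120908045430074485733716868143534831206438178929755903230359281156854670790970256018846452313417302054131513523394287204160524918084259506847782650489403168189347764477837669178239955460372761140934336415008771318593658963703556587491936522963569158138577993378669827645265446440167827468182821574720678033389519392059073598506983966074803146856011513348235777500732913634159654388103169803228421388543687386522715441212307187653726850564560642760154418258027011889579355532748913857975345927410020915144912865876059467692521041578400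936618327001691028863376752763384550951795181175444669133687754467092263906373852936545507233369902787213889698155591693163625014743823938575701705179964258636881837925334801333528993261314252678781750680716591497217⟩,
  ⟨6114, 95537437, 5, 899373, 4, 7, 22, 4, 2, 17, 4, 5709121436266327666134419741966021576855846913⟩,
  ⟨6117, 95537501, 5, 1492717, 5, 8, 41, 1, 2, 37, 4, 8749002899323019837274741103597841089248723142012732877850878138235977442560717379625723553279639553⟩,
  ⟨6120, 95537885, 5, 903469, 4, 7, 22, 10, 10, 17, 4, 5709121526671821776398627354531057774569914369⟩,
  ⟨6122, 95537901, 5, 1456477, 8, 11, 298, 3, 4, 293, 3, 32739238240362938904566838293590675677512633659509149396495240784390770523345413202664641970489757347680608815845976466976738022662453168328130501841820511136409492993242043252715027589137143022227956969589879999030195292185667116247576359237802772018429943341667575866675991522988500623399224366820663802467026412484006150486122781994985812385378986656348909531710722593206473740694787957972317851284019880685118072070217832483405839903332736848059431066880951669529270726357474251368306005075893489313161270289509682749060356712525183445013269055406151245851349651859987393401537821174248292115357437568027952609891476707192643324730991946282722463676414849721603793300563749753903191605244892356593269170052351088004126495959731681706139121109307147958827018171108396323072327242892789678079⟩,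
  ⟨6123, 95537949, 5, 1773, 5, 8, 40, 1, 1, 35, 4, 33374797439178223342939858389080959132381511577114912963635489131301467013582938732374236594177⟩,
  ⟨6126, 95538013, 5, 22757, 6, 9, 81, 1, 2, 76, 4, 40131652080904949243478383902260681941570719639327430851024089172361421759602317128502386669534550737034343599573291498303275016702404395597184731148926932675341684664719300340611749839063656624952879087617⟩,
  ⟨6127, 95538021, 5, 1492781, 4, 7, 22, 2, 3, 17, 2, 5709121436261784024004355607409333842932989953⟩,
  ⟨5162, 93181741, 5, 349, 6, 9, 74, 4, 5, 69, 4, 4351082437154956072487219649160761679808234554709244271790069485087445599527908324962284125479919187822050863826728293580354145430491050206131271868158819574880932258070858675566011219969⟩,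
  ⟨5891, 95278893, 5, 1456925, 6, 9, 81, 1, 2, 76, 4, 40131652080904949243478383902260682066773920167490790343073357042296762694384936369503479701394630658210416909678029261052022438319090772548231561700259947439458212185172361002498315783879077370302845419521⟩,
  ⟨6132, 95541021, 5, 903461, 4, 7, 23, 2, 1, 19, 6, 1496586248124725187776463733698153610996422765445121⟩,
  ⟨5405, 93443885, 5, 1431389, 5, 8, 40, 1, 2, 35, 2, 33374797439178223500401270806927767855453216195149268618867610097368039596434410382238114906113⟩,
  ⟨6135, 95541085, 5, 1773, 5, 8, 44, 1, 1, 39, 6, 2293498616002587050058349828284391227780274038965321279236990592911223694181135847694695640960414053826561⟩,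
  ⟨5648, 93706029, 5, 1431389, 6, 9, 79, 1, 2, 74, 2, 153090103458041951154644638611587649724346060593917877897970638257733764966594202642883249036260890109798026810002033512598016930221229737947690348480371219108649720351753492112594251298983031890509825⟩,
  ⟨5729, 93738797, 5, 1431389, 6, 9, 72, 4, 4, 67, 4, 16598062275523971834387049989355380934241121485087369201820535050675101906028261513276537702827243030411467369162621471266107483144704562595005876769540721313738863529154774204153857⟩,
  ⟨6149, 11680997, 45, 1431389, 7, 10, 133, 3, 3, 128, 3, 89884656743115795386465259539451236681691290743818826506233892482764858270318422349960304972673474715430342596177253671923143563665694926653127112877514876135834621387214739115982842052421508254992046659642542283470790376606169802804458843287910160277721363636326471902849276662015026058916480663650691973119⟩,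
  ⟨6153, 95542109, 5, 1464109, 8, 11, 289, 5, 6, 282, 2, 51653410229078147328047242521659198895317545451194473061183853929888922685774359568805609011935909841828541876142370384690948527786215064629920901049649676422852038611226608448556491335124488931427545064352458478628646645048165902628217178649952617463785956082562172882231216369973805087983499792640982104032835292249978372287152181277141064284005500904029580810396811730734749407985700838288752151721710247576469543181974130225648540752603843591452102869545486039493559286140459635101008688619018905389189257197599118834317809343158089762714195157263440106349475806930951292460574616653152404000920436795540009816393409623057042071408239557696161112155898880579004746664099689245167443044713739943443443092797196770453715977845260794314903842478956656296449802241⟩,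
  ⟨6154, 95542117, 5, 181997, 6, 9, 67, 2, 2, 62, 2, 471745303102692669337074692113740506415872604655584313173475772812717932673989006469683734977997450489625943482807103885313940550707717407610302042208673164444846522369⟩,
  ⟨6162, 95565661, 5, 899437, 5, 8, 41, 3, 3, 35, 4, 33374797439178224586348276189215972081488090505703191403033939649540262856008993758984372486145⟩,
  ⟨6167, 95566061, 5, 1431389, 6, 9, 69, 3, 3, 63, 3, 241533595188578646517272368769201706518870012257721326693222736404308248907111453102549258845853862363968522037703529097624488620718975657577283995845540628332865887666175⟩,
  ⟨6168, 95566109, 5, 899437, 4, 7, 22, 3, 3, 17, 4, 5709121462847702596585228497757888920668274689⟩,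
  ⟨6171, 95566173, 5, 14061, 5, 8, 43, 2, 1, 38, 4, 4479489484404497284629852718387091468310876126645990542980806840655725149748093928519559245690212188161⟩,
  ⟨6174, 95566557, 5, 936229, 4, 7, 25, 5, 5, 21, 5, 392318671503189135665974982070325284244766586375345537023⟩,
  ⟨6175, 95566565, 5, 898917, 5, 8, 44, 2, 1, 39, 5, 2293498615985899674263676317344258005906828468958807607269808688473071924329931363193093824468004200513535⟩,
  ⟨6176, 95566573, 5, 1431389, 6, 9, 81, 2, 2, 75, 5, 78382132970517478991163531664642069651541318473957926804987427786253334473584576455446720010973869685211736288565097002063468708328546662964154468571441341008122140409769533610036073264752029060455989247⟩,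
  ⟨6177, 11683733, 45, 45, 4, 7, 24, 2, 3, 18, 4, 11150330148493391396965501168469304385077249⟩,
  ⟨5522, 93501741, 5, 29, 5, 8, 38, 2, 2, 33, 3, 127314748506083993067751497143685876164895106987168013047672340134867106917083829569060863⟩,
  ⟨6180, 95566685, 5, 1492717, 4, 7, 26, 2, 3, 21, 4, 392319419678920806309297118931395221208207343892617494529⟩,
  ⟨6184, 95569637, 5, 903533, 6, 9, 46, 4, 5, 40, 4, 1174271291390120594503640548622446436594397211473944136256598219953881713996033794249409212280151599753461761⟩,
  ⟨4901, 91605293, 5, 22365, 4, 7, 22, 2, 3, 17, 2, 5709121426958977926022157247864859683056451585⟩,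
  ⟨6195, 95570205, 5, 23405, 5, 8, 34, 2, 4, 29, 4, 1852673438149711550693880596230417356406259225210537702993207687726872561451009⟩,
  ⟨4982, 91638061, 5, 22365, 5, 8, 38, 1, 2, 33, 4, 127314748565369538578250008721996512976340055901057491152160674037932211654819108278501377⟩]

set_option maxRecDepth 100000 in
theorem nonTab5_ok : List.all nonTab5 Cert.chk = true := by decide +kernel

def nonTab6 : List Cert := [
  ⟨5306, 93243693, 5, 15133, 5, 8, 37, 2, 2, 32, 3, 248661618146997614711999529756823236900141668563358444475305406888428047378947839623167⟩,
  ⟨6203, 95570669, 5, 349, 6, 9, 74, 2, 3, 69, 5, 4351082437154956072457735567717115702450356088556516353254358891129957419270465076699431034623760520398238697424609236154321907859784918254529695516865237498278446804098368310719172050943⟩,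
  ⟨6204, 95570717, 5, 365, 5, 8, 37, 1, 2, 32, 4, 248661618378581439175577109529316263113550523134663002659993357046976931153269785362433⟩,
  ⟨6207, 95570781, 5, 1493229, 5, 8, 42, 2, 3, 37, 4, 8749002899323019823916965144368848232815784696264358163874398811929022726368135200982518711288070145⟩,
  ⟨6213, 95573789, 5, 936237, 5, 8, 41, 2, 2, 36, 4, 17087896288113266055881070737342026969125109236628304958277328022407047156667443089612696648155137⟩,
  ⟨5414, 93444397, 5, 349, 5, 8, 38, 2, 2, 33, 4, 127314748565369539472026306814922339526406964729189678583603723318629812557082581849341953⟩,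
  ⟨6215, 95573805, 5, 349, 6, 9, 71, 3, 3, 65, 4, 63316582777114760724637243626132206536480815464435465876204108976702096371205767462982848101192369755024485725884296420721212926807358188273026646632178958969148647083379523585⟩,
  ⟨4928, 91609389, 5, 935773, 5, 8, 41, 2, 2, 36, 2, 17087896288113265513901501232936205326638455105954888472001385596630685195471378645570118972604417⟩,
  ⟨5657, 93706541, 5, 1431389, 6, 9, 72, 3, 3, 67, 2, 16598062275523971834387049989355349366278371913159060684599768645424963756978199202755024706938216568759584812929707440615031278282659815989475545647172190493738145912956141977993217⟩,
  ⟨6219, 95574237, 5, 45, 5, 8, 37, 1, 2, 32, 2, 248661618378581430656234763404267639267850749250995954893555369688632986932995839492097⟩,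
  ⟨5009, 91642157, 5, 22365, 6, 9, 67, 2, 3, 62, 2, 471745303102692669337074692113797133381020428523352926432326634880128746114232750093714369477190531517678180954143532400336023429131862793762916475986970682255451619329⟩,
  ⟨6228, 95574749, 5, 45, 5, 8, 39, 2, 2, 34, 2, 65185151254086380203577948965646682373732705046262893758549809241017845502877520400094330881⟩,
  ⟨6234, 95574877, 5, 1493805, 8, 11, 263, 6, 7, 256, 4, 1871026825446066716183999886769161229612964411763787934673629221857388127239618558243069191582915579503383668949839112196129241018676335347142098768684320172034905756292202396742223764191719854403374574586116314008934493655122692063501615397640303587116331784648938481763355561800752268730771678185996439034126485229133263518870875983987917034261285435425243764160168570892840183503352270328332952682026405632377809585920283486499342317471812329033787435853366941289538902986277378702012499208903780819560014083718645701889093634984946585913343952460609165511637096573513735931443627192877277159967969513434554902457982943569447769844683937083138187530114860011801754033067385668090626893152257⟩,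
  ⟨6238, 95598309, 5, 899437, 4, 7, 24, 3, 3, 19, 5, 1496574836086234028442395394057275034966077627170815⟩,
  ⟨6239, 95598317, 5, 112485, 5, 8, 46, 2, 1, 41, 5, 601226901189827900844553062990385314906838485665859710966198329882578463253287059830872869693793629244489727999⟩,
  ⟨6241, 11687261, 45, 116973, 5, 8, 37, 2, 2, 32, 4, 57896044605180261357808318764024122400805876434088928191717473395352826544129⟩,
  ⟨6098, 95533869, 5, 22757, 5, 8, 43, 2, 2, 39, 3, 2293498615985899661989590700101483936859230485955473313427875751712476116859623881092643629926816522698751⟩,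
  ⟨6243, 1489181, 357, 45, 4, 7, 20, 1, 3, 16, 4, 2596267534764327601993312751550465⟩,
  ⟨6244, 95598437, 5, 1460965, 5, 8, 43, 1, 2, 38, 4, 4479489484404497285028725896569344521847232723179608691929765897966939848473998587918380813945189433345⟩,
  ⟨5207, 93207341, 5, 940381, 6, 9, 72, 4, 5, 66, 5, 32418090381882757487938839384858007973735225043867884949336033682937146733055175348026638686282837730310885532867272337567177915720206584852462451624261754334224575328454401064959⟩,
  ⟨6248, 1457317, 365, 29, 5, 8, 41, 1, 1, 37, 3, 463168356945895437799765906434687695857828847521919335937947443946593728856063⟩,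
  ⟨6179, 95566637, 5, 22365, 5, 8, 39, 2, 3, 34, 3, 65185151238909518276863251590589686002857312088350041086258020586419780498955112548753473535⟩,
  ⟨6252, 95598941, 5, 14045, 5, 8, 40, 2, 1, 35, 4, 33374797439178211763504831920102429723957699161557858414291309271393102133713984520132222779393⟩,
  ⟨6255, 95599325, 5, 932589, 5, 8, 47, 4, 4, 42, 3, 307828173409261877413415550298867164573248127098097818475368377033519998675140306293616923282363601347826180685823⟩,
  ⟨5288, 93240109, 5, 120669, 5, 8, 43, 17, 17, 37, 5, 8749002899068391309658193028337446772280829245936523439419775668500668063103046576154008359614283775⟩,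
  ⟨6257, 95599341, 5, 1431389, 5, 8, 44, 3, 3, 38, 3, 4479489484339316622020141871525714882362660059385524910355212494447528625275793527044926659254804283391⟩,
  ⟨6258, 95599389, 5, 357, 5, 8, 42, 1, 1, 38, 5, 4479489484339313161431544270796184776311102176303339563135560120528745053188021910514191028577762279423⟩,
  ⟨6261, 11687381, 45, 5, 5, 8, 43, 1, 1, 38, 4, 16296287810616604523806352598322018030569888800864822857679793589923771781568985178467991553⟩,
  ⟨5774, 93764397, 5, 22365, 7, 10, 131, 15, 16, 124, 3, 445087261998902755091202516044764537991864961278487270449320764232204020452780989532794699193615827883982515470724538233766849395867167767904734116789344527212409301730776584742380147838842376260655483205270084283991242568524963136055107666162690750470973586839951843705242306391014206671604543443990537651098231106178047599368436973567⟩,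
  ⟨6265, 11687709, 45, 898797, 5, 8, 36, 4, 1, 31, 4, 226156424186322274506380053856472433958818434688529666821336849513569058817⟩,
  ⟨5882, 95275821, 5, 186085, 5, 8, 41, 1, 2, 36, 3, 17087896287118620526477321679162870977683083689614191435855059936118947218506665828556423229865983⟩,
  ⟨6267, 95602461, 5, 936301, 4, 7, 25, 4, 5, 19, 4, 1496586241806428201608868756370858757562760597078017⟩,
  ⟨6268, 95602469, 5, 116973, 5, 8, 39, 1, 1, 35, 4, 33374797439178223212221447276674366721550701566486025113351802045926978154981873227711492653057⟩,
  ⟨4910, 91605805, 5, 931677, 7, 10, 133, 4, 3, 127, 4, 59738601067233466281281634491411842588100028930037293549641582706105910509232018370655743256935375852195218778399865866343830565185674978350486242975965737665706597788343170650312709208515266499631297024567891043695656561989654491175621970346198187742217875419089814218184639493052513822234248137552330905809666819854033532511088842617380667393⟩,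
  ⟨6271, 95602533, 5, 1456861, 5, 8, 42, 2, 2, 37, 4, 8749002899323019828833961232281460203973308941420642443078907864587756392942689160391520828600090625⟩,
  ⟨6273, 11687765, 45, 1829, 5, 8, 38, 2, 2, 33, 2, 14821387420651094873663573943607929891600499655486131971111049998822263664672769⟩,
  ⟨6275, 95602925, 5, 1431389, 5, 8, 41, 20, 21, 35, 3, 33374797435292957922325125693738780313790190149861926505204206728583928074639424088287119147007⟩,
  ⟨6282, 95603421, 5, 936237, 4, 7, 26, 2, 2, 22, 3, 200867207672522505659371550565565123279010556041251960913919⟩,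
  ⟨6283, 95603429, 5, 22885, 5, 8, 41, 1, 1, 36, 3, 17087896287118643995348245862873412454883605817438246350881575310749766461447633371934946595176447⟩,
  ⟨6284, 95603437, 5, 120669, 4, 7, 25, 7, 7, 20, 3, 766247043068367104324318272708117101705413312806125567⟩,
  ⟨6288, 95603549, 5, 365, 4, 7, 23, 2, 3, 17, 4, 5709121356524309881036797869460923333429886977⟩,
  ⟨6291, 95606493, 5, 14125, 2, 5, 12, 11, 11, 7, 4, 4719545904601914561⟩,
  ⟨6292, 95606501, 5, 45, 4, 7, 23, 0, 1, 19, 4, 1496586239759118138278743233566715006241854006231041⟩,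
  ⟨6294, 95606557, 5, 5, 4, 7, 27, 1, 1, 23, 4, 102844071611718619940215545214752639098100731751449878268477441⟩,
  ⟨6295, 95606565, 5, 2853, 4, 7, 25, 1, 1, 21, 4, 392319419656799122281101755955458143366553394008093097985⟩,
  ⟨6296, 95606573, 5, 112861, 6, 9, 74, 2, 1, 68, 4, 8498207885068273579119790449694727465563215854982553925459894806512398140085197689606824617415779417424025603124974722999042579613105665957798464843911794137579776905765882685477093377⟩,
  ⟨4937, 91609901, 5, 349, 5, 8, 45, 1, 2, 41, 4, 601226901190921525363303334652710221740884861517348263665670250497246486674126395985951247354576760997299617793⟩,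
  ⟨6298, 95606629, 5, 1461021, 5, 8, 45, 1, 1, 40, 4, 1174271291390120594416624526483353416748892150803062692837232366502615997717953465212775969319351165665673217⟩,
  ⟨6300, 1457429, 365, 229, 3, 6, 15, 2, 2, 10, 2, 592032561176330662401⟩,
  ⟨6303, 95607069, 5, 183149, 5, 8, 42, 2, 3, 36, 4, 17087896288113265584751789626955669105839998977769729571145595306130221896263909558890172688367617⟩,
  ⟨6309, 11688277, 45, 5, 4, 7, 24, 1, 2, 20, 2, 730750121948607911779818919153070752595370835969⟩,
  ⟨6310, 95607525, 5, 898781, 5, 8, 41, 2, 1, 36, 3, 17087896287118620172254848274270195900404716404283357377807254649009017130644504249986359532453887⟩,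
  ⟨6311, 95607533, 5, 29, 4, 7, 25, 8, 8, 19, 3, 1496574829552322672636040097516475376316444195946495⟩,
  ⟨6312, 95607581, 5, 187245, 4, 7, 23, 1, 2, 19, 2, 1496586240804487834994808105038605374213193333473281⟩,
  ⟨6315, 95607645, 5, 183085, 5, 8, 39, 2, 3, 34, 2, 65185151254086379802504885072607914365926790290647560877911928991668065212599838421003796481⟩,
  ⟨6325, 95795045, 5, 181989, 5, 8, 38, 2, 2, 33, 4, 127314748565369539710136297886131839051112772683528423691302063847654795248087495067303937⟩,
  ⟨6328, 95795429, 5, 14053, 5, 8, 39, 2, 0, 35, 6, 33374797439178234239963209513608922539341058377905174789128176026410799188545730978340828872705⟩,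
  ⟨5921, 11654501, 45, 1456869, 6, 9, 73, 1, 2, 68, 2, 28793048285076456849889891837783576821367984521861416822421363295394282104609139311221569334973095500420336121202946998345345038311058005147595028687433055504171009⟩,
  ⟨6330, 95795485, 5, 903469, 4, 7, 26, 2, 2, 21, 4, 392319419607206648900381228242816398168186891355263336449⟩,
  ⟨6333, 95795549, 5, 1765, 4, 7, 28, 1, 0, 24, 4, 52656155249782100744854516716595331848537551993022547870158422017⟩]

set_option maxRecDepth 100000 in
theorem nonTab6_ok : List.all nonTab6 Cert.chk = true := by decide +kernel

def nonTab7 : List Cert := [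
  ⟨5678, 93730669, 5, 121565, 6, 9, 74, 2, 2, 69, 4, 4351082437154956072487219649160719454618379387867449640837341783750962507613236204999077122534209152666804635006891861955716554542519425852675552053571345898679723315401290385514815291393⟩,
  ⟨5273, 11425125, 45, 349, 4, 7, 25, 0, 1, 20, 2, 730750121827643435795189053451668507587311566849⟩,
  ⟨4787, 91404141, 5, 121573, 5, 8, 47, 2, 2, 42, 4, 307828173409541844915432510534175623994254185999918436583616056163833519718513046134823609826749302913647807299585⟩,
  ⟨5516, 93501293, 5, 1460957, 4, 7, 24, 4, 5, 19, 2, 1496586240946082475417294958309666299727649511833601⟩,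
  ⟨6245, 11687269, 45, 1431781, 8, 11, 287, 3, 3, 282, 4, 6647222596164918386506314671070900706741342431498466448664534389427374091637439628974424879763130490480983320937535652565876287616698331495947502489045132891208363064665215519990746035849945407342865634080387175343440121896880975583530212018880900178418510714397284362734736666016295087984610032063462022630241059603749953944749778026634567209205868386234174027482133149929242809507553745407957323144791989079052466965628920489838328926108729517821585231399988569704664641551278871791980214036893958719889796022826262077510482708342304197660732522580181208575528366524538130771403148590622130129193924462894009369592101604368488620287080611653972578162246900086167755732084064257⟩,
  ⟨6343, 95796069, 5, 186093, 7, 10, 150, 9, 9, 144, 4, 682094244309526058233052550094132709858689918395362005391997555046002674355990687543919239253721190220453147488814284681061654493995718021355566835679417833627797630124035395449455425037319529208161789966783208146213517157393742237832440811024097702867981233172311990218172637048285101292058612286795307278941777169743361639560482422314664516276559742099952263276679454953287761250396143617⟩,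
  ⟨5867, 95274861, 5, 1456413, 5, 8, 46, 2, 2, 41, 4, 601226901190921525352667580055717878866699315398306799994244067511496127731284874062955993411597454618696613889⟩,
  ⟨6110, 95537005, 5, 1456869, 7, 10, 134, 3, 3, 129, 4, 15660115838168849784840292792116666063207799734699557487706824846630743059895451470438209944427376462709516459400461060747897977610037056662475922265550026361014262094268876650668882560439094905033093200284953845757438931538620757042556874927992345117977821804223583617216930925459605839263962510038505104499895814365015128377252091690386213692243969⟩,
  ⟨6351, 95799133, 5, 14061, 4, 7, 25, 2, 1, 20, 4, 766249962681919979538526076501992340844918621859217409⟩,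
  ⟨5219, 93210477, 5, 1424093, 4, 7, 24, 4, 3, 19, 2, 1496586239922449209462781227439738317665572555063297⟩,
  ⟨5948, 95307629, 5, 15141, 7, 10, 149, 2, 2, 144, 2, 682094244309526058233052550094132709858689918395362005391997555044641534575395953989060885272253555623742328127242573482399839856714342663828900154391103654943807420000097465209960138466359414875181853553440209173936384182932689758292557430155215259422797610590847072561012358845698260235573722456834703852883801622270498580078090122903753894012522197485082933642496361206923722272943374337⟩,
  ⟨6357, 95799581, 5, 365, 5, 8, 41, 2, 3, 37, 4, 8749002899323019838721682365504479728515245830338122629562224325216327435393152590809009823399542785⟩,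
  ⟨5462, 93472621, 5, 1460509, 4, 7, 21, 3, 3, 16, 2, 11150883066949304255712283896694304867188737⟩,
  ⟨6191, 95569773, 5, 1460509, 5, 8, 38, 5, 5, 33, 2, 127314748565369529295404234250878930218471072092454590264351119473241749809413695066865665⟩,
  ⟨6360, 95799645, 5, 365, 4, 7, 26, 1, 2, 21, 4, 392319419674996226756809131421949535286116748337387405313⟩,
  ⟨6363, 95800029, 5, 907501, 5, 8, 44, 2, 2, 39, 6, 2293498616002587068049984228254404944818330375173031937482029374683217123485003563703211233052852450492417⟩,
  ⟨5300, 93243245, 5, 117477, 4, 7, 25, 2, 2, 20, 2, 766249962661009019367755732958687623828707423553060865⟩,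
  ⟨6365, 11709669, 45, 1431389, 4, 7, 26, 1, 2, 21, 5, 187072477301527854680995370677544782627737225396223⟩,
  ⟨4814, 91408237, 5, 121565, 6, 9, 82, 2, 2, 76, 4, 40131652080904949243478383902260681941570719639327430851024089172361421759602317128502386669534550737034343599573291498303275016702404395597184731148926932675341684664719300340611749839063656624952879087617⟩,
  ⟨5543, 93505389, 5, 117469, 5, 8, 41, 1, 1, 36, 2, 17087896288113265523968176069594363809376907365669489722628583671770730249749678276736720102752257⟩,
  ⟨6272, 95602541, 5, 1428253, 8, 11, 294, 4, 4, 288, 4, 930505116240366842946708581325500394925502225177898179609179600913386438018773481038148290747857113502844652197827696184936133558419263946611609753226795151300242861429010185021758749100004069607529800022312317771197419866466763331006875624249973063403149156506485667069654894453639052337814097264677860377657034608022010870516126783910729448459576580897729203688820436566807436458170055250017881937760136115528844364924954758449622465863370268358101284354070056660034046022971955511775288641778465068506387611527389845395518717784321364507193477073358504263834958577177043458815319966126342807553121887219508304014723422173332086317489086548994477239124112732583320381554667490940182821878878293134146575747177858988689290127247495777874764025747403060825825498522478334670012417⟩,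
  ⟨6369, 95800157, 5, 186093, 5, 8, 48, 1, 1, 43, 4, 157608024785631670723407658750870766795975715986661867519915066825504333906249739302123488187677443806995492701732865⟩,
  ⟨6370, 23461, 22757, 365, 3, 5, 13, 0, 1, 9, 2, 17697940838657⟩,
  ⟨5165, 93181805, 5, 14621, 4, 7, 28, 3, 2, 22, 4, 200867399206445490164520093141679198952712842934014162501633⟩,
  ⟨6375, 95803165, 5, 903469, 5, 8, 40, 3, 3, 34, 6, 65185151254086348901362031830048968715857340004190786541261317661063839533364401264520069121⟩,
  ⟨5408, 93443949, 5, 14621, 6, 9, 78, 4, 3, 72, 2, 583992399055640987986440961131846946269598517275122435688768655488248384685055415615735398199061046175686296151279025539020385211352244974930752644269146057905299229620217726419324820572986146817⟩,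
  ⟨6137, 95541101, 5, 178525, 6, 9, 88, 3, 3, 83, 4, 370149157595803483760113708983022576837172713473753574181065242349033643950700249039310430696861953005087710693477012840216018241823187004558627581385265383672517964340451910370954848843206013529289107575766189995599186624513⟩,
  ⟨5651, 93706093, 5, 1464157, 4, 7, 24, 1, 2, 19, 2, 1496586240662913318673996834728006877980983514890241⟩,
  ⟨6381, 95803613, 5, 903405, 5, 8, 45, 5, 4, 39, 4, 2293498616002587060503015885347680042757205962927132490228518066174404600540961607489533583750358001254401⟩,
  ⟨5246, 93214573, 5, 1424093, 6, 9, 83, 12, 11, 77, 2, 20547405865423334012660524643978985876935609768266423970728104424723737630182282924215161296219278228843822962221905785722705080024431463670511749068607635326898306906770654105314279336969472447211215039496193⟩,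
  ⟨5975, 95311725, 5, 179037, 7, 10, 169, 4, 5, 164, 4, 1045306387854636870253908275374199688241601463566283245306996776775115410268832057060841648081772163620153301162236932414027817630140494370639283827385234508604470418158660614584934488427321890438423967421014983941824295613780861298824809132174588804244456298103851997523507019802896004430895609908726802415666481656320124737780476200097458822486246958598094734814066334224897880858425589191595951919236805273796426400940645224390207981324599297⟩,
  ⟨6384, 95803677, 5, 23405, 8, 11, 263, 6, 7, 256, 4, 1871026825446066716183999886769161229612964411763787934673629221857388127239618558243069191582915579503383668949839135179845587498113258794231807668091843644424416380997168129164492549694286283047637088912810377643872226522619479039350773953743300754797535388930370311472412123735642767071222754511595124974007982050049108794062366949342453472943559906953214071927125391572338779312304358380204330765610709709294251152995603275944176972163934390700136043421324356802772723259417135076795775363440785856645144897379549477531249620475882607994033318640417860949955348693694262875964101121951459608395047371478674799909905107321324723368233824808129568566840464310249001453045085515884130851618817⟩,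
  ⟨5489, 93476717, 5, 5, 4, 7, 23, 1, 1, 19, 2, 1496586240162004693656701474037536316264929039220737⟩,
  ⟨6218, 95573869, 5, 178973, 5, 8, 44, 7, 8, 39, 2, 2293498616002587061591181877982745347010070761806254774952719233927810893908369118606154679768771876356097⟩,
  ⟨6387, 95803741, 5, 181997, 4, 7, 25, 1, 2, 19, 4, 1496586239606675148572521622165626135251302648381441⟩,
  ⟨5732, 93738861, 5, 22813, 5, 8, 37, 2, 2, 32, 2, 248661618378581462765534234147130412447211166117083055142065420635324914356970131030017⟩,
  ⟨6391, 95804133, 5, 357, 5, 8, 46, 1, 1, 41, 6, 601226901190921524994398992875077324876071698417664369876252681445578669900612150552011066576436636203517739009⟩,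
  ⟨6393, 95804189, 5, 23405, 8, 11, 288, 3, 4, 282, 6, 51653410229078147328047242521659198895317545451194473061183853929888922685774359568805609011935909841828541876142370384690948521989644374733026509769861721917271103351484664191950844744594880101972475857055133726316781022234282916545853424315196043577492006880587686679992218750412111743095079533552329773746729446373938455955878505174837838852066898562579648006452157821651857467533490709700552377340291499362916278151220807266087211304366353009036344001292498014878634871405584832519373729324231368825079911618324448101493110178466479091573852867527652320445089448710028632201016012826380428663565445456135523098109351221600904679910741420054594747960647036967613827542446546112203103127059585712549695561927453704740476848837735543504603390517792091711681331201⟩,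
  ⟨5570, 93509485, 5, 29, 5, 8, 43, 1, 1, 38, 2, 4479489484404497284483891687916469801581406078160819207050378233692023379351944574570344032230203981825⟩,
  ⟨6299, 95606637, 5, 1428253, 6, 9, 85, 7, 7, 80, 4, 2757826131550993649364370947376383331097228669637828408395396093090955127399128239303291121309314420796762421505218024590693151901142769733734680035171231542275487331523162372251804186758470607861640804717715198574593⟩,
  ⟨5813, 93771629, 5, 121565, 7, 10, 141, 4, 4, 135, 4, 282107567413424138126415916172126379762992917645748837497039191620661929645062182748082068015185401715631155053457037481179252594432948389303167129712274905793805584197003590046305464705094113939837356027332296637484844974716478700008192386668869757924552989999545540542967949531002812943950648094793953976158539302233567600721177522620505917611392963849515058593793⟩,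
  ⟨6400, 95827685, 5, 45, 7, 10, 87, 6, 9, 81, 4, 1412006979354108748474556173079511098598560844684924850629130995363941564488008435372805854681473809091083396016797738764947809115628432514989188646471635173054906891839850000225020627981836334885863899555156213045919745⟩,
  ⟨6405, 95827805, 5, 1757, 4, 7, 28, 2, 0, 23, 4, 102844071612601355169378341840386601858642331387879938456551425⟩,
  ⟨5606, 93698413, 5, 29, 5, 8, 40, 1, 1, 35, 4, 33374797439178223916416057184827770084608729036539278916233692960668338771871004173523017007105⟩,
  ⟨6410, 95828205, 5, 182621, 4, 7, 24, 7, 8, 19, 3, 1496574822605087900462728662759316842705764220665855⟩,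
  ⟨6411, 95828253, 5, 45, 4, 7, 24, 1, 2, 20, 4, 766249962559271256315429728357692246690552739727409153⟩,
  ⟨6414, 95828317, 5, 45, 4, 7, 27, 1, 1, 23, 4, 102844071612531205659536723930425061896823138604563625574137857⟩,
  ⟨6415, 95828325, 5, 229, 5, 8, 39, 1, 1, 34, 4, 65185151254086381374114242179351913990841210172907170355655653561259172743634579562797465601⟩,
  ⟨6417, 11712853, 45, 117029, 5, 8, 41, 3, 3, 36, 4, 248661618201274829432166761271313905308738400259408842519684570352017881840794025852929⟩,
  ⟨6418, 95828709, 5, 899429, 4, 7, 26, 2, 1, 21, 5, 392318671454305148056651140914893086557050135789865795583⟩,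
  ⟨6419, 95828717, 5, 1885, 4, 7, 27, 4, 4, 22, 5, 200867207648179264190906739610241012885709462058084509679615⟩,
  ⟨6420, 95828765, 5, 45, 5, 8, 45, 0, 1, 40, 4, 1174271291390120594471170783860812834442964502645515406469464370770324407615284357370868543095894808062853121⟩,
  ⟨6254, 95598957, 5, 178525, 7, 10, 144, 2, 2, 139, 3, 19386284415916351754079089178450564925773529918149929487991148511836680238678081806896941998923329006503051721946520412972772153821909343101108008492944316428179113004627039316173363690512572299168106865866986857502483879774973028857160181011452696053530573850292241043332729255220701835323922125607250517537541111707146317882417146410510395527456972390261543360527010147336191⟩,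
  ⟨6423, 95828829, 5, 45, 4, 7, 28, 1, 1, 24, 4, 52656155249888357941556083137742337020578516525321811701306228737⟩,
  ⟨6424, 95828837, 5, 186093, 6, 9, 76, 1, 2, 71, 4, 1140610154405548804661742102996204222802049661540148601771347706074083094928341667995415842369723141988867967924086684974119911125547659724066547202424417582390768580031462279105015990580150273⟩,
  ⟨6428, 95831789, 5, 899437, 5, 8, 40, 1, 1, 35, 4, 33374797439178223468569752087221643300579416485370298940059555695284327625576419077427027771393⟩,
  ⟨6432, 95831901, 5, 2925, 4, 7, 24, 1, 3, 19, 4, 1496586241261898388095275618232443930147125585510401⟩,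
  ⟨6438, 95832349, 5, 2925, 5, 8, 38, 1, 2, 33, 4, 127314748565369538578250008721996512976340055901057491152160674037932211654819108278501377⟩,
  ⟨6444, 95832797, 5, 23341, 7, 10, 137, 3, 4, 131, 2, 4105205406280934957997173713696631308459973324941694806147524215707080000404218843418007000451171575768654873965844467992916543274454435160847562494393405229233756217744142407343375775078649311453104797839611216240202059124517330185882908041678823649488653837473041168732892163403566690334453844886165273452368479936034415795214872704721343935759446441985⟩,
  ⟨6446, 95832813, 5, 931677, 9, 12, 582, 14, 13, 576, 5, 1731679542698997220430275839514256052695358129492339435724999354807164255582823833189886597523835063932145459866179858747167599968585392382544556968693147721714743668187961112722693369483261999128130420736968394055143765889373463228308837717647158397363312872528223391187802951551610441528667934263542727476911001809522982169040938229074926176106583837865575872152172212438881136857891775015235025920247819948172753203945986860844861560742689208940206893397041616185295858025999104269596657280936742604281418666031582969669163551922306779774125045820177395526533247681321146282313999825697334328173514084880975086879978621266954872565101642967964005534245225168149157486491713917004498290882291985627053455050558167299791225421085765764041944309245219934216785675634857829340067569421781481551579649605642578906350789196524528317080179007268552341815698088887392653581867618761346172556775620623620000233877636432769801195306875842330323935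962712889398810649951994075745788800379142569384675936330329317463059172419542169330634431197655367428484026366068921628109327843784246367735567728668188104577685787512572077045820522291069887407990074076609746156156962851236867504369600932922865282832796627376277439982161813557172645515627556829672091280717405368518807965831332568883868180957695575997800001759375587026501082860073010478270456781805628934996859163072543056001052737813619145585887549125648610467576532041389647638044538278679526664471934099977539838424827027662452321291987469690316783481823925655026083808989544342102790471343888418802146085508743167⟩]

set_option maxRecDepth 100000 in
theorem nonTab7_ok : List.all nonTab7 Cert.chk = true := by decide +kernel

def nonTab8 : List Cert := [
  ⟨6447, 95832861, 5, 23405, 5, 8, 41, 1, 2, 37, 4, 8749002899323019807015026272165500582392244743489729554718904318281863454340197488634346258126864385⟩,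
  ⟨6450, 95832925, 5, 45, 4, 7, 26, 1, 2, 21, 4, 392319419645738128331710092138018237362888997623152246785⟩,
  ⟨6454, 95835877, 5, 899373, 4, 7, 24, 2, 1, 20, 4, 766249962536966395908163879575163770378266058173186049⟩,
  ⟨6455, 95835885, 5, 23397, 4, 7, 28, 1, 2, 23, 4, 102844071611853072408027670901167710094791922625187831596711937⟩,
  ⟨6457, 95835941, 5, 2925, 5, 8, 37, 1, 2, 32, 4, 248661618378581559902276874311179832033702588966069141847335776159234932541616692396033⟩,
  ⟨6458, 95835949, 5, 29, 4, 7, 25, 2, 2, 20, 4, 766249962436617471684191234712671096143703408800956417⟩,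
  ⟨4931, 91609453, 5, 903005, 8, 11, 240, 3, 3, 234, 2, 4657371408015561899580487630378580791321902145894945803070258804951979926147137583001490785417235312489193404606745211919778303629073434522160461062852918397150014272208012395185744181936319388528289670602085471702754346139025250403850933131388639805599511520889788599018040003665442621584485598291382549018709084716519255486046592150635542235554765152510092510279954003664918475258498922082651115379743037547465083671545025430132612924595665232059022866792453302270772372346730985338570002092156293150076474958015940837849665176918621067162475045906195729262412135707766288183649514125723770507022499679455375107697878398895692709889⟩,
  ⟨5660, 93706605, 5, 931677, 6, 9, 66, 5, 4, 60, 4, 1799565517817278557806838228547679503649465538841192336240375203256174571557059012854139641643007053223797232539597326320343595901187058024728047548729148221423617⟩,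
  ⟨6461, 95836013, 5, 29, 5, 8, 44, 3, 3, 39, 4, 2293498616002587061048357664821645154632333872878435403988036118902588717098808852944587090744497112350721⟩,
  ⟨6463, 95836389, 5, 187245, 5, 8, 39, 1, 2, 34, 4, 65185151254086381402384653009104515403258253046409246911913950423454985320268775002413727745⟩,
  ⟨5984, 95312237, 5, 1456925, 4, 7, 25, 1, 2, 20, 4, 766249962938385679388573845313436482291021223646724097⟩,
  ⟨6465, 95836445, 5, 23405, 6, 9, 67, 2, 3, 62, 2, 471745303102692669337074692113797133381020428523352926432326634880128746114232750093714369477190531517678180954143532400336023429131862793762916475986970682255451619329⟩,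
  ⟨6471, 95836893, 5, 1497965, 7, 10, 153, 8, 10, 147, 2, 91549139753101516292836007778240678447716551127366702613783396477065712686574728739717881666964473233398445300234159625954709603974705048180956639991124681570491805681734319072663071656726363437913979294789294688080809510492082900170067034139100256246131060872786594396250147097947880979000343021960046384319078751725120403058893055105421378911970750698308760557231097474718419055476083811632021505⟩,
  ⟨5336, 93247853, 5, 1424093, 6, 9, 72, 2, 2, 67, 4, 16598062275523971834387049989355393615222728758585652196844108297338451235391498680526944106604241916650667629042523213795690763234281281785216441318688337322796780153456380493168641⟩,
  ⟨6473, 11713765, 45, 349, 5, 8, 40, 3, 4, 35, 3, 971334446197673075958748400731313273028216138638183938800307619171039412407962173439⟩,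
  ⟨6477, 95837021, 5, 186733, 4, 7, 25, 1, 2, 19, 4, 1496586239911567859076674266912463298162531186245633⟩,
  ⟨6481, 11716381, 45, 365, 7, 10, 98, 6, 9, 92, 4, 180736893357325919804742965864596658313509084694138926015494592610258743915742766130257348514024204798363177902050656991666593755885179475844124308269374337395926521667859839307518148964743372782602430907200139281408458753⟩,
  ⟨6483, 1493213, 357, 112429, 3, 6, 13, 4, 3, 9, 2, 4638830651000615681⟩,
  ⟨6484, 95860517, 5, 112941, 4, 7, 22, 1, 1, 17, 4, 5709121413667641330641175754524865242982842369⟩,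
  ⟨6101, 1430941, 373, 181997, 5, 8, 31, 2, 3, 25, 2, 23945244966913026173984264465048405130998043998420993⟩,
  ⟨6487, 95860581, 5, 45, 4, 7, 27, 1, 1, 23, 4, 102844071612028449165295036709014017880123065515455633193697281⟩,
  ⟨6490, 95860965, 5, 899437, 4, 7, 23, 1, 1, 18, 3, 2922992133093980203459015512600905628769368801279⟩,
  ⟨6491, 95860973, 5, 1821, 4, 7, 26, 5, 5, 21, 3, 392318671426477136274975242554838471396528541562961919999⟩,
  ⟨6492, 95861021, 5, 2925, 5, 8, 40, 2, 3, 35, 4, 33374797439178223271813663080711429056794870470148948440535522776871613413139357849485723041793⟩,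
  ⟨6495, 95861085, 5, 5, 4, 7, 27, 0, 0, 23, 4, 102844071612800121515507667707702672120455940785767328262389761⟩,
  ⟨6496, 95861093, 5, 45, 4, 7, 24, 1, 2, 19, 4, 1496586240390712557032336617335980533352205632405505⟩,
  ⟨6499, 95861477, 5, 931677, 6, 9, 85, 3, 2, 80, 3, 2757826131550993649364361822495148086757037862152225021894908186266651452441043293853917201384496307647144825707326233163246918082955975377551407423417991656602502063323721778363638139395172452865379632542129131094015⟩,
  ⟨6501, 11716501, 45, 357, 4, 7, 25, 1, 2, 20, 4, 730750121701364934689834863674883434740888109057⟩,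
  ⟨5534, 93502317, 5, 183133, 3, 6, 15, 1, 2, 10, 3, 618370872362476405408669183⟩,
  ⟨6503, 1493229, 357, 22365, 5, 8, 35, 3, 3, 30, 3, 822752277894464380153134540822203962236361144590854767389966335⟩,
  ⟨6505, 11716509, 45, 2789, 5, 8, 40, 2, 2, 35, 4, 971334446084594998257143110595879669118248106484337895918887361800912827788067602433⟩,
  ⟨6510, 95864605, 5, 932717, 7, 10, 133, 3, 4, 127, 4, 59738601067233466281281634491411842588100028930037293549641582706105910509232018370655743256935375852195218778399865866343830565185674978350486242975965737665706597788343170650312709208515266499631297024567891043695656561989654491175621970346198187742217875419089814218184639493052513822234248137552330905809666819854033532511088842617380667393⟩,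
  ⟨6511, 95864613, 5, 899437, 5, 8, 37, 1, 1, 32, 4, 248661618378581444729326552485553047224253770383882034052269650613830896974259306889217⟩,
  ⟨6514, 95864677, 5, 2917, 4, 7, 25, 1, 1, 20, 4, 766249962581566206117899288664981917246757673567256577⟩,
  ⟨6515, 95864685, 5, 1460445, 5, 8, 43, 2, 2, 38, 4, 4479489484404497284963986070920398352580904306513844141486265472149738353363399765262263363096478220289⟩,
  ⟨6516, 95865053, 5, 45, 4, 7, 23, 0, 1, 19, 2, 1496586239911556227749958802723689023255963818000385⟩,
  ⟨6517, 1435029, 373, 357, 4, 7, 19, 1, 3, 13, 2, 1238393663441346445658165249⟩,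
  ⟨6518, 95865069, 5, 1829, 4, 7, 25, 2, 2, 20, 3, 766247039664704207114488653517474548187818990455226367⟩,
  ⟨6519, 95865117, 5, 23405, 4, 7, 22, 2, 4, 17, 2, 5709121426958977926022157247864859683056451585⟩,
  ⟨6522, 95865181, 5, 2925, 4, 7, 24, 1, 3, 19, 4, 1496586239563103761828887017538652642602816134447105⟩,
  ⟨6525, 11716949, 45, 2861, 4, 7, 25, 9, 10, 20, 2, 730750121898088946099406067560568823118417100801⟩,
  ⟨6526, 95865573, 5, 112349, 4, 7, 26, 3, 2, 20, 3, 766247039831954165533646900177611799634659942051872767⟩,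
  ⟨6527, 95865581, 5, 1885, 4, 7, 27, 3, 3, 22, 3, 200867207644891061341407982062461199174879242359091564118015⟩,
  ⟨6528, 95865629, 5, 940397, 9, 12, 518, 7, 8, 512, 2, 7001482763077572417277652726342607186433041444455607409705049281583182196715169852477158423380441208710302002294402586354834475239721865900551271264370058084838471841759533911398761601198371184785855064791363122325737098274674015815437688917112130925431342460076628184616327609432902966945130279686119079936110071913303347063506107554254930329547549949135432333029744935956948516348616446223682461630324020481494094344488491170355157051423808688055145970887763194450459346065215524863125934283478399460017354367776080358897687982408802849075109984364881421739264837860788232979484936546113557729896568497216076979643968625065820925701629120908045430074485733716868143534831206438178929755903230359281156854670790970256018846452313417302054131513523394287204160524918084259506847782650489403168189347764477837669178239955460372761140934336415008771318593658963703556587491936522963569158138577993378669827645265446440167827468182821574720678033389519392059073598506983966074803146856011513348235777500732913634159654388103169803228421388543687386522715441212307187653726850564560642760154418258027011889579355532748913857975345927410020915144912865876059467692521041578400936618327001691028863376752763384550951795181175444669133687754467092263906373852936545507233369902787213889698155591693163625014743823938575701705179964258636881837925334801333528993261314252678781750680716591497217⟩,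
  ⟨6531, 95865693, 5, 45, 4, 7, 25, 1, 1, 20, 4, 766249962726519343240930639329030818785680822208299009⟩,
  ⟨6537, 95868701, 5, 365, 5, 8, 45, 1, 2, 41, 4, 601226901190921525363303334652710221740884861517348263665670250497246486674126395985951247354576760997299617793⟩,
  ⟨6538, 95868709, 5, 898797, 4, 7, 25, 2, 1, 20, 4, 766249962765546309326946056045839643886392195445948417⟩,
  ⟨6155, 95542125, 5, 22749, 5, 8, 40, 1, 1, 35, 4, 33374797439178223445841035243300983773612293392241180087300965668491093630010287068467832029185⟩,
  ⟨6541, 95868773, 5, 112349, 4, 7, 26, 2, 1, 21, 4, 392319419697118857446935466710933054188096076487188283393⟩,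
  ⟨6543, 95869149, 5, 45, 4, 7, 25, 2, 2, 21, 2, 392319419670000473095863808717135596345507848835581345793⟩,
  ⟨6545, 11717349, 45, 116509, 3, 6, 14, 2, 1, 10, 3, 606236692493090900429311⟩,
  ⟨6546, 95869213, 5, 365, 5, 8, 41, 1, 2, 36, 2, 17087896288113265513901501232936205326638455105954888472001385596630685195471378645570118972604417⟩,
  ⟨6549, 95869277, 5, 969581, 6, 9, 66, 9, 10, 60, 2, 1799565517817278557806838228547447441485593132824335630733249246295779328137651650056512528490502307899260227104753335335565444460052906752342003499466534131073025⟩,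
  ⟨6553, 11717405, 45, 23405, 4, 7, 22, 3, 4, 17, 3, 43557139940124764685916025159800286019583⟩,
  ⟨6555, 95869725, 5, 45, 5, 8, 43, 1, 1, 39, 2, 2293498616002587060643857570403946834321179130937717451767469012059876611382526769464100597374907813199873⟩]

set_option maxRecDepth 100000 in
theorem nonTab8_ok : List.all nonTab8 Cert.chk = true := by decide +kernel

def nonTab : List Cert := nonTab0 ++ nonTab1 ++ nonTab2 ++ nonTab3 ++ nonTab4 ++ nonTab5 ++ nonTab6 ++ nonTab7 ++ nonTab8

theorem nonTab_ok : List.all nonTab Cert.chk = true := by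
  simp only [nonTab, List.all_append, Bool.and_eq_true]
  exact ⟨⟨⟨⟨⟨⟨⟨⟨nonTab0_ok, nonTab1_ok⟩, nonTab2_ok⟩, nonTab3_ok⟩, nonTab4_ok⟩, nonTab5_ok⟩, nonTab6_ok⟩, nonTab7_ok⟩, nonTab8_ok⟩

def codes : List ℕ :=
  litTab.map (fun e => e.1) ++ (nonTab.map (fun x => x.c) ++ [6138, 4854, 6134])

set_option maxRecDepth 100000 in
theorem codes_cov : covAll codes = true := by decide +kernel

theorem codes_good : ∀ c ∈ codes, Good (Pc c) := by
  intro c hc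
  rw [codes, List.mem_append, List.mem_append] at hc
  rcases hc with h | h | h
  · obtain ⟨x, hx, rfl⟩ := List.mem_map.1 h
    intro _
    exact litChk_sound x.1 x.2 (List.all_eq_true.1 litTab_ok x hx)
  · obtain ⟨x, hx, rfl⟩ := List.mem_map.1 h
    rintro ⟨N, hN, hd⟩
    exact (nonChk_sound _ _ _ _ _ _ _ _ _ _ _ _ (List.all_eq_true.1 nonTab_ok x hx) N hN hd).elim
  · simp only [List.mem_cons, List.not_mem_nil, or_false] at h
    rcases h with h | h | h
    · rw [h]; exact good_6138
    · rw [h]; exact good_4854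
    · rw [h]; exact good_6134

end BW

end

theorem borwein_deg_le_eight_newman_imp_littlewood
    (P : Polynomial ℤ) (hP : IsBorwein P) (hdeg : P.natDegree ≤ 8)
    (hN : ∃ N : Polynomial ℤ, IsNewman N ∧ P ∣ N) :
    ∃ L : Polynomial ℤ, IsLittlewood L ∧ P ∣ L := by
  exact BW.borwein_of_codes (BW.covAll_sound BW.codes BW.codes_good BW.codes_cov) P hP hdeg hN
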